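/- arXiv:1506.07024 — 2 statements merged into one kernel-verified Lean document; each statement's English description precedes it below -/
import Mathlib

section
/- Let K be a universal class. If for every cardinal θ there exists a cardinal λ ≥ θ with cf(λ) ≥ θ such that K is categorical in λ, then K is categorical on a tail of cardinals, i.e. there exists a cardinal μ such that K is categorical in every cardinal λ' ≥ μ. -/
noncomputable section

open FirstOrder Cardinal Set

universe u

namespace AECPaper

/-- An `L`-structure whose universe is a set of ordinals. -/
structure Model (L : FirstOrder.Language.{u, u}) : Type (u + 1) where
  carrier : Set Ordinal.{u}
  struc : L.Structure carrier

attribute [instance] Model.struc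

variable {L : FirstOrder.Language.{u, u}}

/-- The universe of a model, as a type. -/
abbrev Model.U (M : Model L) : Type (u + 1) := ↥M.carrier

/-- The cardinality of (the universe of) a model. -/
def Model.card (M : Model L) : Cardinal.{u + 1} := #M.U

/-- `M` is a (literal) substructure of `N`: its universe is included in that of `N` and the
inclusion map is an `L`-embedding. -/
def Model.IsSub (M N : Model L) : Prop :=
  M.carrier ⊆ N.carrier ∧
    ∃ f : L.Embedding M.U N.U, ∀ x : M.U, (↑(f x) : Ordinal.{u}) = (↑x : Ordinal.{u})

/-- A universal class: a class of `L`-structures closed under isomorphisms, under unions of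
`⊆`-increasing chains, and under substructures.  (Ordered by `⊆` it is an AEC with
`LS(K) = |L(K)| + ℵ₀`.) -/
structure UniversalClass (L : FirstOrder.Language.{u, u}) where
  Mem : Model L → Prop
  iso_closed : ∀ {M N : Model L}, Mem M → Nonempty (L.Equiv M.U N.U) → Mem N
  sub_closed : ∀ {M N : Model L}, Mem N → M.IsSub N → Mem M
  union_closed : ∀ {ι : Type (u + 1)} [inst : LinearOrder ι] (Mc : ι → Model L),
      (∀ i, Mem (Mc i)) → (∀ i j, i ≤ j → (Mc i).IsSub (Mc j)) →
      ∀ Mu : Model L, Mu.carrier = ⋃ i, (Mc i).carrier → (∀ i, (Mc i).IsSub Mu) → Mem Mu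

namespace UniversalClass

variable (K : UniversalClass L)

/-- `K` is categorical in `lam`: it has exactly one model of cardinality `lam` up to
isomorphism. -/
def CategoricalIn (lam : Cardinal.{u}) : Prop :=
  (∃ M, K.Mem M ∧ M.card = Cardinal.lift.{u + 1} lam) ∧
    ∀ M N, K.Mem M → K.Mem N → M.card = Cardinal.lift.{u + 1} lam →
      N.card = Cardinal.lift.{u + 1} lam → Nonempty (L.Equiv M.U N.U)

end UniversalClass

end AECPaper

universe v w

namespace AECPaper

variable {L : FirstOrder.Language.{u, u}}

/-- Atomic formulas with variables in `ι`. -/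
inductive Atom (L : FirstOrder.Language.{u, u}) (ι : Type v) : Type (max u v)
  | eq (s t : L.Term ι) : Atom L ι
  | rel {n : ℕ} (R : L.Relations n) (ts : Fin n → L.Term ι) : Atom L ι

namespace Atom

variable {ι : Type v} {κ : Type w} {A : Type*} {B : Type*} [L.Structure A] [L.Structure B]

/-- Truth of an atomic formula under a valuation. -/
def Holds (v : ι → A) : Atom L ι → Prop
  | eq s t => s.realize v = t.realize v
  | rel R ts => Language.Structure.RelMap R fun i => (ts i).realize v

/-- Substitution of terms for variables. -/
def subst (f : ι → L.Term κ) : Atom L ι → Atom L κ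
  | eq s t => eq (s.subst f) (t.subst f)
  | rel R ts => rel R fun i => (ts i).subst f

/-- Renaming of variables. -/
def relabel (f : ι → κ) : Atom L ι → Atom L κ := subst fun i => Language.var (f i)

theorem holds_subst (f : ι → L.Term κ) (v : κ → A) (ψ : Atom L ι) :
    (ψ.subst f).Holds v ↔ ψ.Holds fun i => (f i).realize v := by
  cases ψ <;> simp [subst, Holds]

theorem holds_relabel (f : ι → κ) (v : κ → A) (ψ : Atom L ι) :
    (ψ.relabel f).Holds v ↔ ψ.Holds (v ∘ f) :=
  holds_subst _ _ _

end Atom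

section Types

variable {ι : Type v} {κ : Type w} {A : Type*} {B : Type*} {C : Type*}
  [L.Structure A] [L.Structure B] [L.Structure C]

/-- The atomic type of a family of elements. -/
def atp (L : FirstOrder.Language.{u, u}) {ι : Type*} {A : Type*} [L.Structure A] (v : ι → A) :
    Set (Atom L ι) :=
  {ψ | ψ.Holds v}

theorem mem_atp {v : ι → A} {ψ : Atom L ι} : ψ ∈ atp L v ↔ ψ.Holds v := Iff.rfl

theorem atp_comp_eq_preimage (v : ι → A) (f : κ → ι) :
    atp L (v ∘ f) = Atom.relabel f ⁻¹' atp L v := by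
  ext ψ
  exact (Atom.holds_relabel f v ψ).symm

theorem atp_comp {v : ι → A} {w : ι → B} (h : atp L v = atp L w) (f : κ → ι) :
    atp L (v ∘ f) = atp L (w ∘ f) := by
  rw [atp_comp_eq_preimage, atp_comp_eq_preimage, h]

theorem atp_realize {v : ι → A} {w : ι → B} (h : atp L v = atp L w) (t : κ → L.Term ι) :
    atp L (fun k => (t k).realize v) = atp L (fun k => (t k).realize w) := by
  ext ψ
  rw [mem_atp, mem_atp, ← Atom.holds_subst, ← Atom.holds_subst, ← mem_atp, ← mem_atp, h]

theorem realize_eq_iff_of_atp {v : ι → A} {w : ι → B} (h : atp L v = atp L w) (s t : L.Term ι) :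
    s.realize v = t.realize v ↔ s.realize w = t.realize w := by
  have := Set.ext_iff.1 h (Atom.eq s t)
  exact this

theorem apply_eq_iff_of_atp {v : ι → A} {w : ι → B} (h : atp L v = atp L w) (i j : ι) :
    v i = v j ↔ w i = w j :=
  realize_eq_iff_of_atp h (Language.var i) (Language.var j)

theorem atp_embedding (e : A ↪[L] B) (v : ι → A) : atp L (e ∘ v) = atp L v := by
  ext ψ
  cases ψ with
  | eq s t =>
    simp only [mem_atp, Atom.Holds, Language.HomClass.realize_term]
    exact e.injective.eq_iff
  | rel R ts =>
    simp only [mem_atp, Atom.Holds, Language.HomClass.realize_term]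
    exact e.map_rel R _

/-- Finitely many terms use only finitely many variables. -/
theorem exists_finset_terms {ι : Type v} {n : ℕ} (ts : Fin n → L.Term ι) :
    ∃ s : Finset ι, ∀ X : Set ι, (s : Set ι) ⊆ X →
      ∃ ts' : Fin n → L.Term X, ∀ i, (ts' i).relabel Subtype.val = ts i := by
  classical
  suffices H : ∀ t : L.Term ι, ∃ s : Finset ι, ∀ X : Set ι, (s : Set ι) ⊆ X →
      ∃ t' : L.Term X, t'.relabel Subtype.val = t by
    choose s hs using H
    refine ⟨Finset.univ.biUnion fun i => s (ts i), fun X hX => ?_⟩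
    have : ∀ i, ∃ t' : L.Term X, t'.relabel Subtype.val = ts i := fun i =>
      hs (ts i) X fun x hx => hX (by
        simp only [Finset.coe_biUnion, Set.mem_iUnion]
        exact ⟨i, by simp, hx⟩)
    choose ts' h using this
    exact ⟨ts', h⟩
  intro t
  induction t with
  | var i => exact ⟨{i}, fun X hX => ⟨Language.var ⟨i, hX (by simp)⟩, rfl⟩⟩
  | func F ts ih =>
    choose s hs using ih
    refine ⟨Finset.univ.biUnion s, fun X hX => ?_⟩
    have : ∀ i, ∃ t' : L.Term X, t'.relabel Subtype.val = ts i := fun i =>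
      hs i X fun x hx => hX (by
        simp only [Finset.coe_biUnion, Set.mem_iUnion]
        exact ⟨i, by simp, hx⟩)
    choose ts' h using this
    exact ⟨Language.func F ts', by simp [Language.Term.relabel, h]⟩

theorem Term.subst_var_eq_relabel (f : ι → κ) (t : L.Term ι) :
    t.subst (fun i => Language.var (f i)) = t.relabel f := by
  induction t with
  | var i => rfl
  | func F ts ih => simp [Language.Term.subst, Language.Term.relabel, ih]

@[simp] theorem Atom.relabel_eq (f : ι → κ) (s t : L.Term ι) :
    (Atom.eq s t).relabel f = Atom.eq (s.relabel f) (t.relabel f) := by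
  simp [Atom.relabel, Atom.subst, Term.subst_var_eq_relabel]

@[simp] theorem Atom.relabel_rel (f : ι → κ) {n : ℕ} (R : L.Relations n) (ts : Fin n → L.Term ι) :
    (Atom.rel R ts).relabel f = Atom.rel R fun i => (ts i).relabel f := by
  simp [Atom.relabel, Atom.subst, Term.subst_var_eq_relabel]

theorem Atom.relabel_relabel {μ : Type*} (f : ι → κ) (g : κ → μ) (ψ : Atom L ι) :
    (ψ.relabel f).relabel g = ψ.relabel (g ∘ f) := by
  cases ψ <;> simp

theorem Term.relabel_injective {f : ι → κ} (hf : Function.Injective f) :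
    Function.Injective (Language.Term.relabel f : L.Term ι → L.Term κ) := by
  intro s
  induction s with
  | var i =>
    intro t h
    cases t with
    | var j => simpa [Language.Term.relabel, hf.eq_iff] using h
    | func => simp [Language.Term.relabel] at h
  | @func n F ts ih =>
    intro t h
    cases t with
    | var j => simp [Language.Term.relabel] at h
    | @func m G us =>
      simp only [Language.Term.relabel, Language.Term.func.injEq] at h
      obtain ⟨rfl, hF, hts⟩ := h
      obtain rfl := eq_of_heq hF
      congr 1
      funext i
      exact ih i (congrFun (eq_of_heq hts) i)

theorem Atom.relabel_injective {f : ι → κ} (hf : Function.Injective f) :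
    Function.Injective (Atom.relabel f : Atom L ι → Atom L κ) := by
  intro φ ψ h
  have H := Term.relabel_injective (L := L) hf
  cases φ with
  | eq s t =>
    cases ψ with
    | eq s' t' =>
      simp only [Atom.relabel_eq, Atom.eq.injEq] at h
      rw [H h.1, H h.2]
    | rel => simp at h
  | @rel n R ts =>
    cases ψ with
    | eq => simp at h
    | @rel m R' ts' =>
      simp only [Atom.relabel_rel, Atom.rel.injEq] at h
      obtain ⟨rfl, hR, hts⟩ := h
      obtain rfl := eq_of_heq hR
      congr 1
      funext i
      exact H (congrFun (eq_of_heq hts) i)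

theorem Atom.exists_finset (ψ : Atom L ι) :
    ∃ s : Finset ι, ∀ X : Set ι, (s : Set ι) ⊆ X →
      ∃ ψ' : Atom L X, ψ'.relabel Subtype.val = ψ := by
  cases ψ with
  | eq s t =>
    obtain ⟨F, hF⟩ := exists_finset_terms ![s, t]
    refine ⟨F, fun X hX => ?_⟩
    obtain ⟨ts, h⟩ := hF X hX
    exact ⟨Atom.eq (ts 0) (ts 1), by simp [h]⟩
  | rel R ts =>
    obtain ⟨F, hF⟩ := exists_finset_terms ts
    refine ⟨F, fun X hX => ?_⟩
    obtain ⟨ts', h⟩ := hF X hX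
    exact ⟨Atom.rel R ts', by simp [h]⟩

/-- Atomic types have finite character. -/
theorem atp_eq_of_forall_fin {v : ι → A} {w : ι → B}
    (h : ∀ (n : ℕ) (f : Fin n → ι), atp L (v ∘ f) = atp L (w ∘ f)) : atp L v = atp L w := by
  ext ψ
  obtain ⟨s, hs⟩ := ψ.exists_finset
  obtain ⟨ψ', rfl⟩ := hs s subset_rfl
  have h1 := atp_comp (h _ fun k => (s.equivFin.symm k : ι)) s.equivFin
  have e : (fun k => (s.equivFin.symm k : ι)) ∘ s.equivFin = (Subtype.val : s → ι) := by
    funext x; simp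
  rw [Function.comp_assoc, Function.comp_assoc, e] at h1
  have := Set.ext_iff.1 h1 ψ'
  rw [mem_atp, mem_atp, Atom.holds_relabel, Atom.holds_relabel]
  exact this

/-- A family generates a structure. -/
def Gen (L : FirstOrder.Language.{u, u}) {ι : Type*} {A : Type*} [L.Structure A] (v : ι → A) :
    Prop :=
  ∀ a : A, ∃ t : L.Term ι, t.realize v = a

theorem Gen.exists_embedding {v : ι → A} {w : ι → B} (hv : Gen L v) (h : atp L v = atp L w) :
    ∃ e : A ↪[L] B, ∀ i, e (v i) = w i := by
  choose t ht using hv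
  have key : ∀ s : L.Term ι, (t (s.realize v)).realize w = s.realize w := fun s =>
    (realize_eq_iff_of_atp h _ _).1 (ht _)
  refine ⟨⟨⟨fun a => (t a).realize w, ?_⟩, ?_, ?_⟩, fun i => ?_⟩
  · intro a b hab
    rw [← ht a, ← ht b]
    exact (realize_eq_iff_of_atp h _ _).2 hab
  · intro n F x
    have := key (Language.func F fun i => t (x i))
    simp only [Language.Term.realize_func, ht] at this
    exact this
  · intro n R x
    have := Set.ext_iff.1 h (Atom.rel R fun i => t (x i))
    simpa [mem_atp, Atom.Holds, ht, Function.comp_def] using this.symm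
  · exact key (Language.var i)

theorem Gen.exists_equiv {v : ι → A} {w : ι → B} (hv : Gen L v) (hw : Gen L w)
    (h : atp L v = atp L w) : ∃ e : A ≃[L] B, ∀ i, e (v i) = w i := by
  obtain ⟨e, he⟩ := hv.exists_embedding h
  have hs : Function.Surjective e := by
    intro b
    obtain ⟨t, rfl⟩ := hw b
    refine ⟨t.realize v, ?_⟩
    rw [← Language.HomClass.realize_term e]
    congr 1
    funext i
    exact he i
  refine ⟨⟨Equiv.ofBijective e ⟨e.injective, hs⟩, ?_, ?_⟩, he⟩
  · intro n f x; exact e.map_fun f x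
  · intro n f x; exact e.map_rel f x

theorem gen_closure (S : Set A) :
    Gen L (fun x : S => (⟨x, Language.Substructure.subset_closure x.2⟩ :
      Language.Substructure.closure L S)) := by
  rintro ⟨a, ha⟩
  obtain ⟨t, rfl⟩ := Language.Substructure.mem_closure_iff_exists_term.1 ha
  refine ⟨t, Subtype.ext ?_⟩
  have := Language.HomClass.realize_term (Language.Substructure.closure L S).subtype (t := t)
    (v := fun x : S => (⟨x, Language.Substructure.subset_closure x.2⟩ :
      Language.Substructure.closure L S))
  exact this.symm

/-- The Löwenheim–Skolem number. -/
def ls (L : FirstOrder.Language.{u, u}) : Cardinal.{u} := max ℵ₀ L.card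

theorem aleph0_le_ls : ℵ₀ ≤ ls L := le_max_left _ _

theorem mk_functions_le_ls : #(Σ i, L.Functions i) ≤ ls L := by
  refine le_trans ?_ (le_max_right _ _)
  rw [Language.card, Language.Symbols]
  exact mk_le_of_injective (f := Sum.inl) Sum.inl_injective

theorem mk_term_le {ι : Type u} : #(L.Term ι) ≤ max (ls L) #ι := by
  refine Language.Term.card_le.trans (max_le (aleph0_le_ls.trans (le_max_left _ _)) ?_)
  rw [mk_sum]
  refine add_le_of_le (aleph0_le_ls.trans (le_max_left _ _)) ?_ ?_
  · simp
  · simpa using Or.inl mk_functions_le_ls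

theorem Gen.mk_le {ι A : Type u} [L.Structure A] {v : ι → A} (h : Gen L v) :
    #A ≤ max (ls L) #ι := by
  choose t ht using h
  refine (mk_le_of_injective (f := t) fun a b hab => ?_).trans mk_term_le
  rw [← ht a, hab, ht]

theorem mk_closure_le {A : Type u} [L.Structure A] (S : Set A) :
    #(Language.Substructure.closure L S) ≤ max (ls L) #S :=
  (gen_closure S).mk_le

end Types

/-- A class of structures closed under isomorphic copies of substructures and determined by its
finite tuples. -/
structure LocalClass (L : FirstOrder.Language.{u, u}) where
  Mem : ∀ (A : Type u) [L.Structure A], Prop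
  of_embedding : ∀ {A B : Type u} [L.Structure A] [L.Structure B], (A ↪[L] B) → Mem B → Mem A
  of_local : ∀ {A : Type u} [L.Structure A],
    (∀ (n : ℕ) (v : Fin n → A), ∃ (B : Type u) (_ : L.Structure B) (w : Fin n → B),
      Mem B ∧ atp L v = atp L w) → Mem A

namespace LocalClass

variable (K : LocalClass L)

/-- Realization of types by members of the class. -/
def Realized {ι : Type*} (T : Set (Atom L ι)) : Prop :=
  ∃ (B : Type u) (_ : L.Structure B) (w : ι → B), K.Mem B ∧ atp L w = T

end LocalClass

theorem Atom.subst_relabel {ι κ μ : Type*} (g : κ → μ) (t : ι → L.Term κ)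
    (ψ : Atom L ι) : (ψ.subst t).relabel g = ψ.subst fun i => (t i).relabel g := by
  have key : ∀ s : L.Term ι, (s.subst t).relabel g = s.subst fun i => (t i).relabel g := by
    intro s
    induction s with
    | var i => rfl
    | func F ts ih => simp [Language.Term.subst, Language.Term.relabel, ih]
  cases ψ <;> simp [Atom.subst, key]

namespace LocalClass

variable {K : LocalClass L}

theorem Realized.comap {ι κ : Type*} {T : Set (Atom L ι)} (h : K.Realized T) (f : κ → ι) :
    K.Realized (Atom.relabel f ⁻¹' T) := by
  obtain ⟨B, _, w, hB, rfl⟩ := h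
  exact ⟨B, _, w ∘ f, hB, atp_comp_eq_preimage _ _⟩

theorem realized_subst {ι : Type*} {T : Set (Atom L ι)}
    (h : ∀ (n : ℕ) (f : Fin n → ι), K.Realized (Atom.relabel f ⁻¹' T)) {κ : Type*} [Finite κ]
    (ts : κ → L.Term ι) : K.Realized (Atom.subst ts ⁻¹' T) := by
  obtain ⟨k, ⟨e⟩⟩ := Finite.exists_equiv_fin κ
  obtain ⟨s, hs⟩ := exists_finset_terms (ts ∘ e.symm)
  obtain ⟨ts', h'⟩ := hs s subset_rfl
  obtain ⟨B, _, w, hB, hw⟩ := h _ fun k => (s.equivFin.symm k : ι)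
  refine ⟨B, _, fun k => (ts' (e k)).realize (w ∘ s.equivFin), hB, ?_⟩
  ext ψ
  have e1 : (fun k => (s.equivFin.symm k : ι)) ∘ s.equivFin = (Subtype.val : s → ι) := by
    funext x; simp
  have h2 : ∀ φ : Atom L s, φ.Holds (w ∘ s.equivFin) ↔ φ.relabel Subtype.val ∈ T := by
    intro φ
    rw [← Atom.holds_relabel, ← mem_atp, hw, Set.mem_preimage, Atom.relabel_relabel, e1]
  rw [mem_atp, ← Atom.holds_subst]
  refine (h2 _).trans ?_
  have h3 : (fun k => (ts' (e k)).relabel Subtype.val) = ts := by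
    funext k
    rw [h', Function.comp_apply, e.symm_apply_apply]
  have h4 := Atom.subst_relabel (Subtype.val : s → ι) (fun k => ts' (e k)) ψ
  rw [Set.mem_preimage, ← h3]
  exact iff_of_eq (congrArg (· ∈ T) h4)

/-- A set of atomic formulas all of whose finite parts are realized in the class is realized by a
generating family of a member of the class. -/
theorem exists_model {ι : Type u} (T : Set (Atom L ι))
    (h : ∀ (n : ℕ) (f : Fin n → ι), K.Realized (Atom.relabel f ⁻¹' T)) :
    ∃ (A : Type u) (_ : L.Structure A) (v : ι → A), K.Mem A ∧ Gen L v ∧ atp L v = T := by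
  have refl' : ∀ s, Atom.eq s s ∈ T := by
    intro s
    obtain ⟨B, _, w, hB, hw⟩ := realized_subst h fun _ : Unit => s
    have := (Set.ext_iff.1 hw (Atom.eq (Language.var ()) (Language.var ()))).1 rfl
    exact this
  have symm' : ∀ s t, Atom.eq s t ∈ T → Atom.eq t s ∈ T := by
    intro s t hst
    obtain ⟨B, _, w, hB, hw⟩ := realized_subst h ![s, t]
    have h1 := (Set.ext_iff.1 hw (Atom.eq (Language.var 0) (Language.var 1))).2 hst
    exact (Set.ext_iff.1 hw (Atom.eq (Language.var 1) (Language.var 0))).1 (Eq.symm h1)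
  have trans' : ∀ s t r, Atom.eq s t ∈ T → Atom.eq t r ∈ T → Atom.eq s r ∈ T := by
    intro s t r hst htr
    obtain ⟨B, _, w, hB, hw⟩ := realized_subst h ![s, t, r]
    have h1 := (Set.ext_iff.1 hw (Atom.eq (Language.var 0) (Language.var 1))).2 hst
    have h2 := (Set.ext_iff.1 hw (Atom.eq (Language.var 1) (Language.var 2))).2 htr
    exact (Set.ext_iff.1 hw (Atom.eq (Language.var 0) (Language.var 2))).1 (Eq.trans h1 h2)
  have congrF : ∀ (n : ℕ) (F : L.Functions n) (s t : Fin n → L.Term ι),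
      (∀ i, Atom.eq (s i) (t i) ∈ T) → Atom.eq (Language.func F s) (Language.func F t) ∈ T := by
    intro n F s t hst
    obtain ⟨B, _, w, hB, hw⟩ := realized_subst h (Sum.elim s t)
    have h1 : ∀ i, w (Sum.inl i) = w (Sum.inr i) := fun i =>
      (Set.ext_iff.1 hw (Atom.eq (Language.var (Sum.inl i)) (Language.var (Sum.inr i)))).2 (hst i)
    refine (Set.ext_iff.1 hw (Atom.eq (Language.func F fun i => Language.var (Sum.inl i))
      (Language.func F fun i => Language.var (Sum.inr i)))).1 ?_
    simp [mem_atp, Atom.Holds, h1]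
  have congrR : ∀ (n : ℕ) (R : L.Relations n) (s t : Fin n → L.Term ι),
      (∀ i, Atom.eq (s i) (t i) ∈ T) → (Atom.rel R s ∈ T ↔ Atom.rel R t ∈ T) := by
    intro n R s t hst
    obtain ⟨B, _, w, hB, hw⟩ := realized_subst h (Sum.elim s t)
    have h1 : ∀ i, w (Sum.inl i) = w (Sum.inr i) := fun i =>
      (Set.ext_iff.1 hw (Atom.eq (Language.var (Sum.inl i)) (Language.var (Sum.inr i)))).2 (hst i)
    have h2 := Set.ext_iff.1 hw (Atom.rel R fun i => Language.var (Sum.inl i))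
    have h3 := Set.ext_iff.1 hw (Atom.rel R fun i => Language.var (Sum.inr i))
    refine Iff.trans h2.symm (Iff.trans ?_ h3)
    simp [mem_atp, Atom.Holds, h1]
  let S : Setoid (L.Term ι) := ⟨fun s t => Atom.eq s t ∈ T, refl', symm' _ _, trans' _ _ _⟩
  have hout : ∀ t : L.Term ι, Atom.eq (Quotient.out (Quotient.mk S t)) t ∈ T := fun t =>
    Quotient.exact (Quotient.out_eq (Quotient.mk S t))
  let _ : L.Structure (Quotient S) :=
    { funMap := fun F x => Quotient.mk S (Language.func F fun i => (x i).out)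
      RelMap := fun R x => Atom.rel R (fun i => (x i).out) ∈ T }
  let v : ι → Quotient S := fun i => Quotient.mk S (Language.var i)
  have hv : ∀ t : L.Term ι, t.realize v = Quotient.mk S t := by
    intro t
    induction t with
    | var i => rfl
    | func F ts ih =>
      simp only [Language.Term.realize_func, ih]
      exact Quotient.sound (congrF _ _ _ _ fun i => hout _)
  have hT : atp L v = T := by
    ext ψ
    cases ψ with
    | eq s t =>
      simp only [mem_atp, Atom.Holds, hv]
      exact ⟨fun h => Quotient.exact h, fun h => Quotient.sound h⟩
    | rel R ts =>
      simp only [mem_atp, Atom.Holds, hv]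
      exact congrR _ _ _ _ fun i => hout _
  refine ⟨Quotient S, _, v, K.of_local fun n x => ?_, fun a => ⟨a.out, ?_⟩, hT⟩
  · obtain ⟨B, _, w, hB, hw⟩ := realized_subst h fun i => (x i).out
    refine ⟨B, _, w, hB, ?_⟩
    rw [hw, ← hT]
    ext ψ
    rw [Set.mem_preimage, mem_atp, mem_atp, Atom.holds_subst]
    simp [hv]
  · rw [hv]; exact Quotient.out_eq a

/-- Amalgamation of a directed system of partial types. -/
theorem exists_directed_model {ι : Type u} {P : Type*} [Preorder P] [IsDirectedOrder P]
    [Nonempty P] (S : P → Set ι) (hS : Monotone S) (hcov : ∀ i, ∃ p, i ∈ S p)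
    (W : ∀ p, Set (Atom L (S p))) (hW : ∀ p, K.Realized (W p))
    (hcoh : ∀ p q (h : p ≤ q), Atom.relabel (Set.inclusion (hS h)) ⁻¹' W q = W p) :
    ∃ (A : Type u) (_ : L.Structure A) (v : ι → A), K.Mem A ∧ Gen L v ∧
      ∀ p, atp L (fun i : S p => v i) = W p := by
  let T : Set (Atom L ι) := {ψ | ∃ p, ∃ φ ∈ W p, φ.relabel Subtype.val = ψ}
  have hT : ∀ p (φ : Atom L (S p)), φ.relabel Subtype.val ∈ T ↔ φ ∈ W p := by
    intro p φ
    refine ⟨?_, fun h => ⟨p, φ, h, rfl⟩⟩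
    rintro ⟨q, φ', hφ', he⟩
    obtain ⟨r, hpr, hqr⟩ := exists_ge_ge p q
    rw [← hcoh _ _ hqr] at hφ'
    rw [← hcoh _ _ hpr]
    have : φ'.relabel (Set.inclusion (hS hqr)) = φ.relabel (Set.inclusion (hS hpr)) := by
      apply Atom.relabel_injective (Subtype.val_injective (p := (· ∈ S r)))
      rw [Atom.relabel_relabel, Atom.relabel_relabel]
      exact he
    rw [Set.mem_preimage, this] at hφ'
    exact hφ'
  obtain ⟨A, _, v, hA, hg, hv⟩ := K.exists_model T fun n f => by
    have : ∃ p, ∀ k, f k ∈ S p := by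
      choose p hp using hcov
      obtain ⟨q, hq⟩ := Finite.exists_le fun k => p (f k)
      exact ⟨q, fun k => hS (hq k) (hp _)⟩
    obtain ⟨p, hp⟩ := this
    have := (hW p).comap fun k => (⟨f k, hp k⟩ : S p)
    convert this using 1
    ext ψ
    rw [Set.mem_preimage, Set.mem_preimage, ← hT, Atom.relabel_relabel]
    rfl
  refine ⟨A, _, v, hA, hg, fun p => ?_⟩
  ext φ
  rw [← hT, ← hv]
  exact (Atom.holds_relabel _ _ _).symm

variable {A B : Type u} [L.Structure A] [L.Structure B]

theorem mem_substructure (hA : K.Mem A) (S : L.Substructure A) : K.Mem S :=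
  K.of_embedding S.subtype hA

end LocalClass

/-- Downward Löwenheim–Skolem for universal classes. -/
theorem exists_substructure_card {A : Type u} [L.Structure A] (S : Set A) {κ : Cardinal.{u}}
    (h₁ : ls L ≤ κ) (h₂ : #S ≤ κ) (h₃ : κ ≤ #A) :
    ∃ M : L.Substructure A, S ⊆ M ∧ #M = κ := by
  obtain ⟨T, hT⟩ := le_mk_iff_exists_set.1 h₃
  refine ⟨Language.Substructure.closure L (S ∪ T),
    subset_union_left.trans Language.Substructure.subset_closure, le_antisymm ?_ ?_⟩
  · refine (mk_closure_le _).trans (max_le h₁ ((mk_union_le _ _).trans ?_))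
    exact add_le_of_le (aleph0_le_ls.trans h₁) h₂ hT.le
  · rw [← hT]
    exact mk_le_mk_of_subset (subset_union_right.trans Language.Substructure.subset_closure)

section Recursion

variable {ι : Type*} [LinearOrder ι] [WellFoundedLT ι] {X : Type*}

/-- Choice along a well-order. -/
theorem exists_rec (R : ∀ i : ι, (Iio i → X) → X → Prop) (h : ∀ i g, ∃ x, R i g x) :
    ∃ f : ι → X, ∀ i, R i (fun j => f j) (f i) := by
  choose F hF using h
  let f : ι → X := (wellFounded_lt (α := ι)).fix fun i ih => F i fun j => ih j.1 j.2
  refine ⟨f, fun i => ?_⟩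
  have : f i = F i fun j => f j := (wellFounded_lt (α := ι)).fix_eq _ i
  rw [this]
  exact hF _ _

/-- Choice along a well-order of a monotone family. -/
theorem exists_chain [Preorder X] (R : ∀ i : ι, (Iio i → X) → X → Prop)
    (h : ∀ i g, Monotone g → ∃ x, (∀ j, g j ≤ x) ∧ R i g x) :
    ∃ f : ι → X, Monotone f ∧ ∀ i, R i (fun j => f j) (f i) := by
  obtain ⟨f, hf⟩ := exists_rec
    (fun i (g : Iio i → X) x => Monotone g → (∀ j, g j ≤ x) ∧ R i g x) (fun i g => by
      by_cases hg : Monotone g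
      · obtain ⟨x, hx⟩ := h i g hg
        exact ⟨x, fun _ => hx⟩
      · have : Nonempty (Iio i) := by
          by_contra hc
          rw [not_nonempty_iff] at hc
          exact hg fun a => (hc.false a).elim
        exact ⟨g this.some, fun hg' => absurd hg' hg⟩)
  have key : ∀ i, ∀ j < i, f j ≤ f i := by
    intro i
    induction i using WellFoundedLT.induction with
    | ind i ih =>
      have hm : Monotone fun j : Iio i => f j := by
        intro a b hab
        rcases hab.eq_or_lt with rfl | hlt
        · exact le_rfl
        · exact ih b b.2 a hlt
      exact fun j hj => (hf i hm).1 ⟨j, hj⟩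
  have hm : Monotone f := by
    intro a b hab
    rcases hab.eq_or_lt with rfl | hlt
    · exact le_rfl
    · exact key b a hlt
  exact ⟨f, hm, fun i => (hf i fun a b hab => hm hab).2⟩

end Recursion

theorem exists_orderIso_Iio {α : Type u} [LinearOrder α] [WellFoundedLT α] {ν : Cardinal.{u}}
    (h : #α < ν) : ∃ x : ν.ord.ToType, Nonempty (α ≃o Iio x) := by
  have h1 : Ordinal.type (α := α) (· < ·) < Ordinal.type (α := ν.ord.ToType) (· < ·) := by
    rw [Ordinal.type_toType, lt_ord, Ordinal.card_type]
    exact h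
  obtain ⟨f⟩ := Ordinal.type_lt_iff.1 h1
  refine ⟨f.top, ⟨(OrderIso.ofRelIsoLT f.subrelIso.symm)⟩⟩

section ErdosRado

variable {ι Col : Type u} [LinearOrder ι] [WellFoundedLT ι]

theorem exists_erdos_tree (n : ℕ) (col : (Fin (n + 1) → ι) → Col) :
    ∃ pred : ι → Set ι, ∀ a y, y ∈ pred a ↔ y < a ∧ ∀ t : Fin n → ι, (∀ k, t k ∈ pred y) →
      col (Fin.snoc t y) = col (Fin.snoc t a) := by
  obtain ⟨pred, hp⟩ := exists_rec (X := Set ι) (fun (i : ι) (g : Iio i → Set ι) x =>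
    x = {y | ∃ h : y < i, ∀ t : Fin n → ι, (∀ k, t k ∈ g ⟨y, h⟩) →
      col (Fin.snoc t y) = col (Fin.snoc t i)}) fun i g => ⟨_, rfl⟩
  refine ⟨pred, fun a y => ?_⟩
  rw [hp a]
  simp

/-- A form of the Erdős–Rado theorem. -/
theorem erdos_rado (n : ℕ) : ∀ (Col : Type u) (μ : Cardinal.{u}), ∃ κ : Cardinal.{u},
    ∀ (ι : Type u) [LinearOrder ι] [WellFoundedLT ι], κ ≤ #ι → ∀ col : (Fin n → ι) → Col,
      ∃ S : Set ι, μ ≤ #S ∧ ∀ s t : Fin n → ι, StrictMono s → StrictMono t →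
        (∀ i, s i ∈ S) → (∀ i, t i ∈ S) → col s = col t := by
  induction n with
  | zero =>
    intro Col μ
    refine ⟨μ, fun ι _ _ h col => ⟨univ, by rwa [mk_univ], fun s t _ _ _ _ => ?_⟩⟩
    rw [Subsingleton.elim s t]
  | succ n ih =>
    intro Col μ
    obtain ⟨ν, hν⟩ := ih Col μ
    let Code : Type u := Σ x : ν.ord.ToType, (Fin n → Iio x) → Col
    refine ⟨Order.succ #Code, fun ι _ _ hι col => ?_⟩
    obtain ⟨pred, hp⟩ := exists_erdos_tree n col
    have tr : ∀ a, ∀ y ∈ pred a, pred y ⊆ pred a := by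
      intro a
      induction a using WellFoundedLT.induction with
      | ind a ih =>
        intro y hy z hz
        have h1 := (hp a y).1 hy
        have h2 := (hp y z).1 hz
        refine (hp a z).2 ⟨h2.1.trans h1.1, fun t ht => (h2.2 t ht).trans (h1.2 t fun k => ?_)⟩
        exact ih y h1.1 z hz (ht k)
    have lin : ∀ a z, z ∈ pred a → ∀ y ∈ pred a, z < y → z ∈ pred y := by
      intro a z
      induction z using WellFoundedLT.induction with
      | ind z ih =>
        intro hz y hy hzy
        refine (hp y z).2 ⟨hzy, fun t ht => ?_⟩
        rw [((hp a z).1 hz).2 t ht, ((hp a y).1 hy).2 t fun k => ?_]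
        have h1 := ((hp z (t k)).1 (ht k)).1
        exact ih (t k) h1 (tr a z hz (ht k)) y hy (h1.trans hzy)
    by_cases hbig : ∃ a, ν ≤ #(pred a)
    · obtain ⟨a, ha⟩ := hbig
      obtain ⟨S, hS, hom⟩ := hν (pred a) ha fun t => col (Fin.snoc (fun k => (t k : ι)) a)
      refine ⟨Subtype.val '' S, by rwa [mk_image_eq Subtype.val_injective], ?_⟩
      have key : ∀ s : Fin (n + 1) → ι, StrictMono s → (∀ i, s i ∈ Subtype.val '' S) →
          ∃ s' : Fin n → pred a, StrictMono s' ∧ (∀ i, s' i ∈ S) ∧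
            col s = col (Fin.snoc (fun k => (s' k : ι)) a) := by
        intro s hs hsS
        choose s' hs'S hs' using hsS
        refine ⟨fun k => s' k.castSucc, fun i j hij => ?_, fun i => hs'S _, ?_⟩
        · change (s' i.castSucc : ι) < s' j.castSucc
          rw [hs', hs']
          exact hs (by simpa using hij)
        · have h1 : s (Fin.last n) ∈ pred a := by rw [← hs']; exact (s' _).2
          have h2 := ((hp a _).1 h1).2 (fun k => s k.castSucc) fun k => by
            refine lin a _ ?_ _ h1 (hs (Fin.castSucc_lt_last k))
            rw [← hs']; exact (s' _).2
          simp only [hs']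
          rw [← h2]
          congr 1
          exact (Fin.snoc_init_self s).symm
      intro s t hs ht hsS htS
      obtain ⟨s', h1, h2, h3⟩ := key s hs hsS
      obtain ⟨t', h4, h5, h6⟩ := key t ht htS
      rw [h3, h6]
      exact hom s' t' h1 h4 h2 h5
    · exfalso
      push Not at hbig
      let Q : ι → Code → Prop := fun a c => ∃ e : pred a ≃o Iio c.1,
        ∀ t : Fin n → Iio c.1, c.2 t = col (Fin.snoc (fun k => (e.symm (t k) : ι)) a)
      have ex : ∀ a, ∃ c, Q a c := fun a => by
        obtain ⟨x, ⟨e⟩⟩ := exists_orderIso_Iio (hbig a)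
        exact ⟨⟨x, fun t => col (Fin.snoc (fun k => (e.symm (t k) : ι)) a)⟩, e, fun t => rfl⟩
      have same : ∀ p q, pred p = pred q →
          (∀ t : Fin n → ι, (∀ k, t k ∈ pred p) → col (Fin.snoc t p) = col (Fin.snoc t q)) →
          p = q := by
        intro p q hpq h
        rcases lt_trichotomy p q with hlt | heq | hlt
        · have : p ∈ pred q := (hp q p).2 ⟨hlt, h⟩
          rw [← hpq] at this
          exact absurd ((hp p p).1 this).1 (lt_irrefl _)
        · exact heq
        · have : q ∈ pred p := (hp p q).2 ⟨hlt, fun t ht => (h t (hpq ▸ ht)).symm⟩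
          rw [hpq] at this
          exact absurd ((hp q q).1 this).1 (lt_irrefl _)
      have uniq : ∀ c a b, Q a c → Q b c → a = b := by
        rintro ⟨x, c⟩ a b ⟨e, he⟩ ⟨e', he'⟩
        have hpre : ∀ (a : ι) (p : ι), p ∈ pred a → ∀ z, z ∈ pred p ↔ z ∈ pred a ∧ z < p :=
          fun a p hpa z => ⟨fun hz => ⟨tr a p hpa hz, ((hp p z).1 hz).1⟩,
            fun hz => lin a z hz.1 p hpa hz.2⟩
        have eqs : ∀ y : Iio x, (e.symm y : ι) = e'.symm y := by
          intro y
          induction y using WellFoundedLT.induction with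
          | ind y ih =>
            have hpq : pred (e.symm y : ι) = pred (e'.symm y : ι) := by
              ext z
              rw [hpre a _ (e.symm y).2, hpre b _ (e'.symm y).2]
              constructor
              · rintro ⟨hz, hlt⟩
                have h1 : e ⟨z, hz⟩ < y := by
                  rw [← e.symm.lt_iff_lt, e.symm_apply_apply]; exact hlt
                have h2 := ih _ h1
                rw [e.symm_apply_apply] at h2
                change z = _ at h2
                refine ⟨by rw [h2]; exact (e'.symm _).2, ?_⟩
                rw [h2]
                exact e'.symm.lt_iff_lt.2 h1
              · rintro ⟨hz, hlt⟩
                have h1 : e' ⟨z, hz⟩ < y := by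
                  rw [← e'.symm.lt_iff_lt, e'.symm_apply_apply]; exact hlt
                have h2 := ih _ h1
                rw [e'.symm_apply_apply] at h2
                change _ = z at h2
                refine ⟨by rw [← h2]; exact (e.symm _).2, ?_⟩
                rw [← h2]
                exact e.symm.lt_iff_lt.2 h1
            refine same _ _ hpq fun t ht => ?_
            have ht1 : ∀ k, t k ∈ pred a ∧ t k < e.symm y := fun k =>
              (hpre a _ (e.symm y).2 _).1 (ht k)
            rw [((hp a _).1 (e.symm y).2).2 t ht,
              ((hp b _).1 (e'.symm y).2).2 t (fun k => hpq ▸ ht k)]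
            have h3 := (he fun k => e ⟨t k, (ht1 k).1⟩).symm.trans (he' _)
            have h4 : ∀ k, ((e'.symm (e ⟨t k, (ht1 k).1⟩) : pred b) : ι) = t k := fun k => by
              rw [← ih _ (by
                rw [← e.symm.lt_iff_lt, e.symm_apply_apply]; exact (ht1 k).2),
                e.symm_apply_apply]
            simpa [h4] using h3
        have hab : pred a = pred b := by
          ext z
          constructor
          · intro hz
            have := eqs (e ⟨z, hz⟩)
            rw [e.symm_apply_apply] at this
            change z = _ at this
            rw [this]; exact (e'.symm _).2
          · intro hz
            have := eqs (e' ⟨z, hz⟩)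
            rw [e'.symm_apply_apply] at this
            change _ = z at this
            rw [← this]; exact (e.symm _).2
        refine same a b hab fun t ht => ?_
        have h3 := (he fun k => e ⟨t k, ht k⟩).symm.trans (he' _)
        have h4 : ∀ k, ((e'.symm (e ⟨t k, ht k⟩) : pred b) : ι) = t k := fun k => by
          rw [← eqs, e.symm_apply_apply]
        simpa [h4] using h3
      choose code hcode using ex
      have inj : Function.Injective code := fun a b hab =>
        uniq (code a) a b (hcode a) (hab ▸ hcode b)
      exact absurd (mk_le_of_injective inj) (not_le.2 (Order.succ_le_iff.1 hι))

end ErdosRado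

theorem exists_strictMono_nat (ι : Type*) [LinearOrder ι] [WellFoundedLT ι] [Infinite ι] :
    ∃ f : ℕ → ι, StrictMono f := by
  obtain ⟨g, hg⟩ := exists_increasing_or_nonincreasing_subseq (· < · : ι → ι → Prop)
    (Infinite.natEmbedding ι)
  rcases hg with hg | hg
  · exact ⟨_, fun m n hmn => hg m n hmn⟩
  · exfalso
    have : ∀ m n, m < n → Infinite.natEmbedding ι (g n) < Infinite.natEmbedding ι (g m) := by
      intro m n hmn
      refine lt_of_le_of_ne (not_lt.1 (hg m n hmn)) fun h => ?_
      exact hmn.ne' (g.injective ((Infinite.natEmbedding ι).injective h))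
    exact (RelEmbedding.natGT _ fun n => this n (n + 1) n.lt_succ_self).not_wellFounded
      (wellFounded_lt (α := ι))

/-- Order-indiscernible families of `κ`-tuples over a fixed family of parameters. -/
def Indisc (L : FirstOrder.Language.{u, u}) {D J κ A : Type*} [L.Structure A] [Preorder J]
    (d : D → A) (c : J → κ → A) : Prop :=
  ∀ (n : ℕ) (s t : Fin n → J), StrictMono s → StrictMono t →
    atp L (Sum.elim d fun x : Fin n × κ => c (s x.1) x.2) =
      atp L (Sum.elim d fun x : Fin n × κ => c (t x.1) x.2)

namespace LocalClass

variable {K : LocalClass L}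

/-- Models generated by order-indiscernibles with prescribed types. -/
theorem exists_stretch_of_template {D : Type u} {κ : Type}
    (Φ : ∀ n, Set (Atom L (D ⊕ (Fin n × κ)))) (hΦ : ∀ n, K.Realized (Φ n))
    (hcoh : ∀ k n (s : Fin k → Fin n), StrictMono s →
      Atom.relabel (Sum.map id (Prod.map s id)) ⁻¹' Φ n = Φ k)
    (J : Type u) [LinearOrder J] :
    ∃ (A : Type u) (_ : L.Structure A) (d : D → A) (c : J → κ → A), K.Mem A ∧
      Gen L (Sum.elim d fun x : J × κ => c x.1 x.2) ∧
      ∀ n (t : Fin n → J), StrictMono t →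
        atp L (Sum.elim d fun x : Fin n × κ => c (t x.1) x.2) = Φ n := by
  classical
  let S : Finset J → Set (D ⊕ (J × κ)) := fun p => {x | ∀ j k, x = Sum.inr (j, k) → j ∈ p}
  have hS : Monotone S := fun p q hpq x hx j k h => hpq (hx j k h)
  let o : ∀ p : Finset J, p ≃o Fin p.card := fun p => (p.orderIsoOfFin rfl).symm
  let φ : ∀ p, S p → D ⊕ (Fin p.card × κ) := fun p x =>
    match x with
    | ⟨Sum.inl d, _⟩ => Sum.inl d
    | ⟨Sum.inr (j, k), h⟩ => Sum.inr (o p ⟨j, h j k rfl⟩, k)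
  have hφ : ∀ p q (h : p ≤ q), φ q ∘ Set.inclusion (hS h) =
      Sum.map id (Prod.map (fun i => o q ⟨(o p).symm i, h ((o p).symm i).2⟩) id) ∘ φ p := by
    intro p q h
    funext ⟨x, hx⟩
    rcases x with d | ⟨j, k⟩
    · rfl
    · simp [φ]
  obtain ⟨A, _, v, hA, hg, hv⟩ := K.exists_directed_model S hS
    (fun x => by
      rcases x with d | ⟨j, k⟩
      · exact ⟨∅, fun j k h => by simp at h⟩
      · refine ⟨{j}, fun j' k' h => ?_⟩
        simp only [Sum.inr.injEq, Prod.mk.injEq] at h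
        simp [h.1])
    (fun p => Atom.relabel (φ p) ⁻¹' Φ p.card) (fun p => (hΦ _).comap _) (fun p q h => by
      rw [← hcoh p.card q.card (fun i => o q ⟨(o p).symm i, h ((o p).symm i).2⟩)
        (fun a b hab => (o q).lt_iff_lt.2 ((o p).symm.lt_iff_lt.2 hab))]
      ext ψ
      simp only [Set.mem_preimage, Atom.relabel_relabel, hφ p q h])
  refine ⟨A, _, fun d => v (Sum.inl d), fun j k => v (Sum.inr (j, k)), hA, ?_, fun n t ht => ?_⟩
  · convert hg using 1
    funext x
    rcases x with d | ⟨j, k⟩ <;> rfl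
  · let p := Finset.univ.image t
    have hp : ∀ i, t i ∈ p := fun i => Finset.mem_image_of_mem _ (Finset.mem_univ _)
    let g : D ⊕ (Fin n × κ) → S p := fun x =>
      ⟨Sum.map id (Prod.map t id) x, by
        rcases x with d | ⟨i, k⟩
        · intro j k h; simp at h
        · intro j k h
          simp only [Sum.map_inr, Prod.map_apply, Sum.inr.injEq, Prod.mk.injEq] at h
          rw [← h.1]; exact hp i⟩
    have h1 : (Sum.elim (fun d => v (Sum.inl d)) fun x : Fin n × κ => v (Sum.inr (t x.1, x.2))) =
        (fun i : S p => v i) ∘ g := by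
      funext x
      rcases x with d | ⟨i, k⟩ <;> rfl
    rw [h1, atp_comp_eq_preimage, hv, ← hcoh n p.card (fun i => o p ⟨t i, hp i⟩)
      (fun a b hab => (o p).lt_iff_lt.2 (ht hab))]
    ext ψ
    simp only [Set.mem_preimage, Atom.relabel_relabel]
    have h2 : φ p ∘ g = Sum.map id (Prod.map (fun i => o p ⟨t i, hp i⟩) id) := by
      funext x
      rcases x with d | ⟨i, k⟩ <;> rfl
    rw [h2]

/-- Indiscernible sequences can be stretched to arbitrary linear orders. -/
theorem exists_stretch {D : Type u} {κ : Type} {B : Type u} [L.Structure B] (hB : K.Mem B)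
    {d : D → B} {c : ℕ → κ → B} (h : Indisc L d c) (J : Type u) [LinearOrder J] :
    ∃ (A : Type u) (_ : L.Structure A) (d' : D → A) (c' : J → κ → A), K.Mem A ∧
      Gen L (Sum.elim d' fun x : J × κ => c' x.1 x.2) ∧
      ∀ n (s : Fin n → J) (t : Fin n → ℕ), StrictMono s → StrictMono t →
        atp L (Sum.elim d' fun x : Fin n × κ => c' (s x.1) x.2) =
          atp L (Sum.elim d fun x : Fin n × κ => c (t x.1) x.2) := by
  obtain ⟨A, _, d', c', hA, hg, hc⟩ := K.exists_stretch_of_template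
    (fun n => atp L (Sum.elim d fun x : Fin n × κ => c x.1 x.2)) (fun n => ⟨B, _, _, hB, rfl⟩)
    (fun k n s hs => by
      rw [← atp_comp_eq_preimage, ← h k (fun i => s i) (fun i => i) (fun a b hab => hs hab)
        (fun a b hab => hab)]
      congr 1
      funext x
      rcases x with d | ⟨i, k⟩ <;> rfl) J
  exact ⟨A, _, d', c', hA, hg, fun n s t hs ht => (hc n s hs).trans
    (h n (fun i => i) t (fun a b hab => hab) ht)⟩

/-- Long sequences in members of the class all of whose increasing `n`-tuples have type `Φ`. -/
def Template (K : LocalClass L) (n : ℕ) (Φ : Set (Atom L (Fin n))) : Prop :=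
  ∀ μ : Cardinal.{u}, ∃ (A : Type u) (_ : L.Structure A) (ι : Type u) (_ : LinearOrder ι)
    (_ : WellFoundedLT ι) (s : ι → A), K.Mem A ∧ Function.Injective s ∧ μ ≤ #ι ∧
      ∀ t : Fin n → ι, StrictMono t → atp L (s ∘ t) = Φ

theorem Template.exists_succ {n : ℕ} {Φ : Set (Atom L (Fin n))} (h : K.Template n Φ) :
    ∃ Ψ : Set (Atom L (Fin (n + 1))), Atom.relabel Fin.castSucc ⁻¹' Ψ = Φ ∧
      K.Template (n + 1) Ψ := by
  by_contra! hc
  have hc' : ∀ Ψ : Set (Atom L (Fin (n + 1))), ∃ μ : Cardinal.{u},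
      Atom.relabel Fin.castSucc ⁻¹' Ψ = Φ → ¬ ∃ (A : Type u) (_ : L.Structure A) (ι : Type u)
        (_ : LinearOrder ι) (_ : WellFoundedLT ι) (s : ι → A), K.Mem A ∧ Function.Injective s ∧
        μ ≤ #ι ∧ ∀ t : Fin (n + 1) → ι, StrictMono t → atp L (s ∘ t) = Ψ := by
    intro Ψ
    by_cases hΨ : Atom.relabel Fin.castSucc ⁻¹' Ψ = Φ
    · have := hc Ψ hΨ
      rw [Template, not_forall] at this
      obtain ⟨μ, hμ⟩ := this
      exact ⟨μ, fun _ => hμ⟩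
    · exact ⟨0, fun h => absurd h hΨ⟩
  choose μ hμ using hc'
  obtain ⟨κ, hκ⟩ := erdos_rado (n + 1) (Set (Atom L (Fin (n + 1)))) (max ℵ₀ (iSup μ))
  obtain ⟨A, _, ι, _, _, s, hA, hs, hι, hom⟩ := h κ
  obtain ⟨S, hS, hS'⟩ := hκ ι hι fun t => atp L (s ∘ t)
  have : S.Infinite := infinite_coe_iff.1 (aleph0_le_mk_iff.1 ((le_max_left _ _).trans hS))
  obtain ⟨F, hF, hFc⟩ := this.exists_subset_card_eq (n + 1)
  let t₀ := F.orderEmbOfFin hFc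
  have ht₀ : ∀ i, t₀ i ∈ S := fun i => hF (F.orderEmbOfFin_mem hFc i)
  refine hμ (atp L (s ∘ t₀)) ?_ ⟨A, _, S, inferInstance, inferInstance, fun x => s x, hA,
    hs.comp Subtype.val_injective, ?_, fun t ht => ?_⟩
  · rw [← atp_comp_eq_preimage]
    exact hom _ (t₀.strictMono.comp (Fin.strictMono_castSucc))
  · exact (le_ciSup bddAbove_of_small _).trans ((le_max_right _ _).trans hS)
  · exact hS' (fun i => t i) t₀ (fun a b hab => ht hab) t₀.strictMono (fun i => (t i).2) ht₀

theorem Template.exists_nat {n : ℕ} {Φ : Set (Atom L (Fin n))} (h : K.Template n Φ) :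
    ∃ (A : Type u) (_ : L.Structure A) (s : ℕ → A), K.Mem A ∧ Function.Injective s ∧
      ∀ t : Fin n → ℕ, StrictMono t → atp L (s ∘ t) = Φ := by
  obtain ⟨A, _, ι, _, _, s, hA, hs, hι, hom⟩ := h ℵ₀
  have : Infinite ι := aleph0_le_mk_iff.1 hι
  obtain ⟨f, hf⟩ := exists_strictMono_nat ι
  exact ⟨A, _, s ∘ f, hA, hs.comp hf.injective, fun t ht => hom _ (hf.comp ht)⟩

/-- A class with arbitrarily large members contains an infinite sequence of order-indiscernibles. -/
theorem exists_indisc (h : ∀ μ : Cardinal.{u}, ∃ (A : Type u) (_ : L.Structure A),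
    K.Mem A ∧ μ ≤ #A) :
    ∃ (A : Type u) (_ : L.Structure A) (c : ℕ → Unit → A), K.Mem A ∧
      (∀ i j, i ≠ j → c i () ≠ c j ()) ∧ Indisc L (PEmpty.elim : PEmpty.{u + 1} → A) c := by
  have start : ∃ Φ, K.Template 0 Φ := by
    by_contra! hc
    simp only [Template, not_forall] at hc
    choose μ hμ using hc
    obtain ⟨A, _, hA, hAμ⟩ := h (iSup μ)
    let s : Fin 0 → A := Fin.elim0
    obtain ⟨e⟩ : Nonempty (A ≃ (#A).ord.ToType) := by
      rw [← Cardinal.eq, mk_ord_toType]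
    refine hμ (atp L s) ⟨A, _, (#A).ord.ToType, inferInstance, inferInstance, e.symm, hA,
      e.symm.injective, ?_, fun t _ => ?_⟩
    · rw [mk_ord_toType]
      exact (le_ciSup bddAbove_of_small _).trans hAμ
    · congr 1
      exact Subsingleton.elim _ _
  obtain ⟨Φ₀, hΦ₀⟩ := start
  let T : ∀ n, {Φ // K.Template n Φ} := fun n => Nat.rec ⟨Φ₀, hΦ₀⟩
    (fun n Φ => ⟨Φ.2.exists_succ.choose, Φ.2.exists_succ.choose_spec.2⟩) n
  have hT : ∀ n, Atom.relabel Fin.castSucc ⁻¹' (T (n + 1)).1 = (T n).1 := fun n =>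
    (T n).2.exists_succ.choose_spec.1
  have hle : ∀ k m, Atom.relabel (Fin.castAdd m) ⁻¹' (T (k + m)).1 = (T k).1 := by
    intro k m
    induction m with
    | zero =>
      ext ψ
      have : (Fin.castAdd 0 : Fin k → Fin (k + 0)) = id := rfl
      rw [this]
      cases ψ <;> simp
    | succ m ih =>
      rw [← ih, ← hT (k + m)]
      ext ψ
      simp only [Set.mem_preimage, Atom.relabel_relabel]
      rfl
  have ext : ∀ k m (t : Fin k → ℕ), StrictMono t → ∃ t' : Fin (k + m) → ℕ, StrictMono t' ∧
      t' ∘ Fin.castAdd m = t := by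
    intro k m t ht
    let b := Finset.univ.sup t + 1
    have hb : ∀ i, t i < b := fun i => Nat.lt_succ_of_le (Finset.le_sup (f := t) (Finset.mem_univ i))
    refine ⟨Fin.append t fun i => b + i, ?_, ?_⟩
    · intro i j hij
      induction i using Fin.addCases with
      | left i =>
        induction j using Fin.addCases with
        | left j =>
          rw [Fin.append_left, Fin.append_left]
          exact ht hij
        | right j =>
          simp only [Fin.append_left, Fin.append_right]
          exact (hb i).trans_le (Nat.le_add_right _ _)
      | right i =>
        induction j using Fin.addCases with
        | left j =>
          exfalso
          rw [Fin.lt_def] at hij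
          simp only [Fin.val_natAdd, Fin.val_castAdd] at hij
          omega
        | right j =>
          rw [Fin.lt_def] at hij
          simp only [Fin.val_natAdd] at hij
          simp only [Fin.append_right]
          omega
    · funext i; simp
  have hcoh : ∀ k n (s : Fin k → Fin n), StrictMono s →
      Atom.relabel s ⁻¹' (T n).1 = (T k).1 := by
    intro k n s hs
    have hkn : k ≤ n := by simpa using Fintype.card_le_of_injective s hs.injective
    obtain ⟨m, rfl⟩ := Nat.exists_eq_add_of_le hkn
    obtain ⟨A, _, c, hA, hc, hom⟩ := (T (k + m)).2.exists_nat
    obtain ⟨t', ht', htt⟩ := ext k m (fun i => s i) fun a b hab => hs hab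
    have h1 := atp_comp_eq_preimage (L := L) (c ∘ t') (Fin.castAdd m)
    have h2 := atp_comp_eq_preimage (L := L) (c ∘ Fin.val) s
    rw [hom t' ht', hle, Function.comp_assoc, htt] at h1
    rw [hom _ (fun a b hab => hab)] at h2
    rw [← h1, ← h2]
    rfl
  let p : ∀ n, PEmpty.{u + 1} ⊕ (Fin n × Unit) → Fin n := fun n =>
    Sum.elim PEmpty.elim fun x => x.1
  obtain ⟨A, _, d, c, hA, hg, hc⟩ := K.exists_stretch_of_template (D := PEmpty.{u + 1}) (κ := Unit)
    (fun n => Atom.relabel (p n) ⁻¹' (T n).1)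
    (fun n => by
      obtain ⟨A, _, c, hA, hc, hom⟩ := (T n).2.exists_nat
      exact Realized.comap ⟨A, _, c ∘ Fin.val, hA, hom _ fun a b hab => hab⟩ _)
    (fun k n s hs => by
      rw [← hcoh k n s hs]
      ext ψ
      simp only [Set.mem_preimage, Atom.relabel_relabel]
      have : p n ∘ Sum.map id (Prod.map s id) = s ∘ p k := by
        funext x
        rcases x with x | x
        · exact x.elim
        · rfl
      rw [this]) (ULift.{u} ℕ)
  have hd : ∀ d' : PEmpty.{u + 1} → A, d' = d := fun d' => Subsingleton.elim _ _
  have key : ∀ n (t : Fin n → ℕ), StrictMono t →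
      atp L (Sum.elim (PEmpty.elim : PEmpty.{u + 1} → A) fun x : Fin n × Unit =>
        c ⟨t x.1⟩ x.2) = Atom.relabel (p n) ⁻¹' (T n).1 := by
    intro n t ht
    rw [hd PEmpty.elim]
    exact hc n (fun i => ⟨t i⟩) fun a b hab => ht hab
  refine ⟨A, _, fun n => c ⟨n⟩, hA, ?_, fun n s t hs ht => (key n s hs).trans (key n t ht).symm⟩
  have hlt : ∀ i j, i < j → c ⟨i⟩ () ≠ c ⟨j⟩ () := by
    intro i j hij h
    obtain ⟨B, _, b, hB, hb, hom⟩ := (T 2).2.exists_nat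
    have hm : StrictMono ![i, j] := by
      intro a b hab
      fin_cases a <;> fin_cases b <;> simp_all
    have h1 := key 2 ![i, j] hm
    rw [← hom (fun i => i) (fun a b hab => hab), ← atp_comp_eq_preimage] at h1
    have h2 := (apply_eq_iff_of_atp h1 (Sum.inr (0, ())) (Sum.inr (1, ()))).1 h
    exact absurd (hb h2) (by decide)
  intro i j hij
  rcases lt_or_gt_of_ne hij with h | h
  · exact hlt i j h
  · exact (hlt j i h).symm

end LocalClass

theorem Indisc.atp_eq {D J κ A μ : Type*} [L.Structure A] [LinearOrder J] {d : D → A}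
    {c : J → κ → A} (h : Indisc L d c) {f g : μ → J} (hfg : ∀ x y, f x < f y ↔ g x < g y) :
    atp L (Sum.elim d fun x : μ × κ => c (f x.1) x.2) =
      atp L (Sum.elim d fun x : μ × κ => c (g x.1) x.2) := by
  classical
  have heq : ∀ x y, f x = f y ↔ g x = g y := fun x y => by
    have h1 := hfg x y
    have h2 := hfg y x
    rw [le_antisymm_iff, le_antisymm_iff, ← not_lt, ← not_lt, ← not_lt, ← not_lt, h1, h2]
  refine atp_eq_of_forall_fin fun n a => ?_
  let q : Finset μ := Finset.univ.biUnion fun i => Sum.elim (fun _ => ∅) (fun x => {x.1}) (a i)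
  let p : Finset J := q.image f
  let o : p ≃o Fin p.card := (p.orderIsoOfFin rfl).symm
  have hp : ∀ j : p, ∃ x, f x = j := fun j => by
    obtain ⟨x, -, hx⟩ := Finset.mem_image.1 j.2
    exact ⟨x, hx⟩
  choose r hr using hp
  have hs : StrictMono fun i => ((o.symm i : p) : J) := fun i j hij => o.symm.lt_iff_lt.2 hij
  have ht : StrictMono fun i => g (r (o.symm i)) := fun i j hij => by
    rw [← hfg, hr, hr]; exact hs hij
  have hq : ∀ i x k, a i = Sum.inr (x, k) → f x ∈ p := fun i x k hx =>
    Finset.mem_image_of_mem _ (Finset.mem_biUnion.2 ⟨i, Finset.mem_univ _, by simp [hx]⟩)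
  have hb : ∀ i, ∃ y : D ⊕ (Fin p.card × κ),
      Sum.elim d (fun x : Fin p.card × κ => c (o.symm x.1 : p) x.2) y =
        Sum.elim d (fun x : μ × κ => c (f x.1) x.2) (a i) ∧
      Sum.elim d (fun x : Fin p.card × κ => c (g (r (o.symm x.1))) x.2) y =
        Sum.elim d (fun x : μ × κ => c (g x.1) x.2) (a i) := by
    intro i
    rcases hx : a i with y | ⟨x, k⟩
    · exact ⟨Sum.inl y, rfl, rfl⟩
    · refine ⟨Sum.inr (o ⟨f x, hq i x k hx⟩, k), ?_, ?_⟩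
      · simp
      · simp only [Sum.elim_inr, OrderIso.symm_apply_apply]
        rw [← (heq _ x).1 (hr ⟨f x, hq i x k hx⟩)]
  choose b hb1 hb2 using hb
  have h1 := atp_comp (h p.card _ _ hs ht) b
  have e1 : (Sum.elim d fun x : Fin p.card × κ => c (o.symm x.1 : p) x.2) ∘ b =
      (Sum.elim d fun x : μ × κ => c (f x.1) x.2) ∘ a := funext hb1
  have e2 : (Sum.elim d fun x : Fin p.card × κ => c (g (r (o.symm x.1))) x.2) ∘ b =
      (Sum.elim d fun x : μ × κ => c (g x.1) x.2) ∘ a := funext hb2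
  rw [← e1, ← e2]
  exact h1

/-- Order-indiscernible families of elements. -/
def OIndisc (L : FirstOrder.Language.{u, u}) {J A : Type*} [L.Structure A] [Preorder J]
    (e : J → A) : Prop :=
  Indisc L (PEmpty.elim : PEmpty.{u + 1} → A) fun j (_ : Unit) => e j

theorem OIndisc.atp_eq {J A μ : Type*} [L.Structure A] [LinearOrder J]
    {e : J → A} (h : OIndisc L e) {f g : μ → J} (hfg : ∀ x y, f x < f y ↔ g x < g y) :
    atp L (e ∘ f) = atp L (e ∘ g) :=
  atp_comp (Indisc.atp_eq h hfg) fun x => Sum.inr (x, ())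

/-- Ehrenfeucht–Mostowski models. -/
theorem LocalClass.exists_em {K : LocalClass L}
    (h : ∀ μ : Cardinal.{u}, ∃ (A : Type u) (_ : L.Structure A), K.Mem A ∧ μ ≤ #A)
    (J : Type u) [LinearOrder J] :
    ∃ (A : Type u) (_ : L.Structure A) (e : J → A), K.Mem A ∧ Function.Injective e ∧
      Gen L e ∧ OIndisc L e := by
  obtain ⟨B, _, c, hB, hc, hi⟩ := K.exists_indisc h
  obtain ⟨A, _, d, e, hA, hg, he⟩ := K.exists_stretch hB hi J
  have hd : d = PEmpty.elim := Subsingleton.elim _ _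
  subst hd
  have hinj : ∀ i j, i < j → e i () ≠ e j () := by
    intro i j hij h
    have h1 := he 2 ![i, j] (fun k => k) (by
      intro a b hab
      fin_cases a <;> fin_cases b <;> simp_all) (fun a b hab => hab)
    exact hc _ _ (by decide) ((apply_eq_iff_of_atp h1 (Sum.inr (0, ())) (Sum.inr (1, ()))).1 h)
  refine ⟨A, _, fun j => e j (), hA, fun i j hij => ?_, fun a => ?_, fun n s t hs ht => ?_⟩
  · rcases lt_trichotomy i j with h | h | h
    · exact absurd hij (hinj i j h)
    · exact h
    · exact absurd hij.symm (hinj j i h)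
  · obtain ⟨t, rfl⟩ := hg a
    refine ⟨t.relabel (Sum.elim PEmpty.elim fun x => x.1), ?_⟩
    rw [Language.Term.realize_relabel]
    congr 1
    funext x
    rcases x with x | x
    · exact x.elim
    · rfl
  · exact (he n s (fun k => k) hs fun a b hab => hab).trans
      (he n t (fun k => k) ht fun a b hab => hab).symm

theorem mk_em {J A : Type u} [L.Structure A] {e : J → A} (he : Function.Injective e)
    (hg : Gen L e) (hJ : ls L ≤ #J) : #A = #J :=
  le_antisymm (hg.mk_le.trans (max_le hJ le_rfl)) (mk_le_of_injective he)

/-- The types of finite tuples over a family of parameters. -/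
def typesOver (L : FirstOrder.Language.{u, u}) {δ : Type v} {A : Type w} [L.Structure A]
    (d : δ → A) : Set (Σ n : ℕ, Set (Atom L (δ ⊕ Fin n))) :=
  range fun x : Σ n : ℕ, Fin n → A => ⟨x.1, atp L (Sum.elim d x.2)⟩

/-- There are at most `ρ` types over `ρ` parameters. -/
def Stab (L : FirstOrder.Language.{u, u}) (A : Type u) [L.Structure A] (ρ : Cardinal.{u}) : Prop :=
  ∀ (δ : Type u) (d : δ → A), #δ ≤ ρ → #(typesOver L d) ≤ ρ

theorem Stab.of_embedding {A B : Type u} [L.Structure A] [L.Structure B] {ρ : Cardinal.{u}}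
    (h : Stab L B ρ) (e : A ↪[L] B) : Stab L A ρ := by
  intro δ d hδ
  refine (mk_le_mk_of_subset ?_).trans (h δ (e ∘ d) hδ)
  rintro _ ⟨⟨n, a⟩, rfl⟩
  refine ⟨⟨n, e ∘ a⟩, ?_⟩
  simp only [Sigma.mk.injEq, heq_eq_eq, true_and]
  rw [← atp_embedding e, Sum.comp_elim]

theorem mk_range_le_of_code {α β Y : Type u} {F : α → β} (c : α → Y)
    (h : ∀ x y, c x = c y → F x = F y) : #(range F) ≤ #Y := by
  have hs : ∀ z : range F, ∃ x, F x = z := fun z => z.2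
  choose s hs using hs
  refine mk_le_of_injective (f := fun z => c (s z)) fun z z' hz => Subtype.ext ?_
  rw [← hs, ← hs]
  exact h _ _ hz

theorem mk_sigma_nat_le {f : ℕ → Type u} {ρ : Cardinal.{u}} (hρ : ℵ₀ ≤ ρ)
    (h : ∀ n, #(f n) ≤ ρ) : #(Σ n, f n) ≤ ρ := by
  rw [mk_sigma]
  refine (sum_le_sum _ (fun _ => ρ) h).trans ?_
  rw [sum_const]
  simp only [mk_nat, lift_aleph0, lift_uzero]
  exact mul_le_of_le hρ hρ le_rfl

theorem mk_fin_fun_le {X : Type u} {ρ : Cardinal.{u}} (hρ : ℵ₀ ≤ ρ) (h : #X ≤ ρ) (n : ℕ) :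
    #(Fin n → X) ≤ ρ := by
  rw [mk_arrow]
  simp only [mk_fin, lift_natCast, lift_uzero]
  exact (power_le_power_right h).trans (power_nat_le hρ)

/-- In a generated structure a finite tuple is given by terms in finitely many generators. -/
theorem Gen.exists_fin {ι A : Type*} [L.Structure A] {v : ι → A} (h : Gen L v) {n : ℕ}
    (a : Fin n → A) : ∃ (m : ℕ) (w : Fin m → ι) (s : Fin n → L.Term (Fin m)),
      a = fun k => (s k).realize (v ∘ w) := by
  choose t ht using fun k => h (a k)
  obtain ⟨F, hF⟩ := exists_finset_terms t
  obtain ⟨t', ht'⟩ := hF F subset_rfl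
  refine ⟨F.card, fun k => F.equivFin.symm k, fun k => (t' k).relabel F.equivFin, funext fun k => ?_⟩
  rw [← ht, ← ht', Language.Term.realize_relabel, Language.Term.realize_relabel]
  congr 1
  funext x
  simp

theorem mk_finset_iUnion_le {ι κ : Type u} {ρ : Cardinal.{u}} (hρ : ℵ₀ ≤ ρ) (hκ : #κ ≤ ρ)
    (s : κ → Finset ι) : #(⋃ x, (s x : Set ι) : Set ι) ≤ ρ := by
  refine (mk_iUnion_le _).trans (mul_le_of_le hρ hκ (ciSup_le' fun x => ?_))
  exact (lt_aleph0_of_finite _).le.trans hρ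

/-- Initial cuts in a well-ordered subset are coded by the elements of the subset. -/
theorem exists_cut_code {I : Type u} [LinearOrder I] [WellFoundedLT I] (J : Set I) :
    ∃ c : I → Option J × Option J, ∀ x y, c x = c y →
      ∀ j ∈ J, (j < x ↔ j < y) ∧ (x < j ↔ y < j) := by
  have key : ∀ P : I → I → Prop, (∀ x i j, P x i → i ≤ j → P x j) →
      ∃ c : I → Option J, ∀ x y, c x = c y → ∀ j ∈ J, P x j ↔ P y j := by
    intro P hP
    have : ∀ x, ∃ o : Option J, ∀ j ∈ J, P x j ↔ ∃ m ∈ o, (m : I) ≤ j := by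
      intro x
      by_cases h : ∃ j : J, P x j
      · obtain ⟨m, hm, hmin⟩ := (wellFounded_lt (α := J)).has_min {j | P x j} h
        refine ⟨some m, fun j hj => ?_⟩
        simp only [Option.mem_def, Option.some.injEq, exists_eq_left']
        exact ⟨fun hx => not_lt.1 fun hlt => hmin ⟨j, hj⟩ hx hlt, fun hx => hP x m j hm hx⟩
      · push Not at h
        refine ⟨none, fun j hj => ?_⟩
        simpa using h ⟨j, hj⟩
    choose c hc using this
    exact ⟨c, fun x y hxy j hj => by rw [hc x j hj, hc y j hj, hxy]⟩
  obtain ⟨c, hc⟩ := key (fun x j => x ≤ j) fun x i j h h' => h.trans h'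
  obtain ⟨c', hc'⟩ := key (fun x j => x < j) fun x i j h h' => h.trans_le h'
  refine ⟨fun x => (c x, c' x), fun x y hxy j hj => ⟨?_, ?_⟩⟩
  · rw [← not_le, ← not_le, hc x y (Prod.ext_iff.1 hxy).1 j hj]
  · exact hc' x y (Prod.ext_iff.1 hxy).2 j hj

theorem stab_em {I A : Type u} [LinearOrder I] [WellFoundedLT I] [L.Structure A] {e : I → A}
    (hg : Gen L e) (hi : OIndisc L e) {ρ : Cardinal.{u}} (hρ : ls L ≤ ρ) : Stab L A ρ := by
  intro δ d hδ
  have hρ' : ℵ₀ ≤ ρ := aleph0_le_ls.trans hρ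
  have hsup : ∀ x, ∃ s : Finset I, ∀ X : Set I, (s : Set I) ⊆ X →
      ∃ t : L.Term X, t.realize (fun i : X => e i) = d x := by
    intro x
    obtain ⟨t, ht⟩ := hg (d x)
    obtain ⟨s, hs⟩ := exists_finset_terms ![t]
    refine ⟨s, fun X hX => ?_⟩
    obtain ⟨t', ht'⟩ := hs X hX
    refine ⟨t' 0, ?_⟩
    have := ht' 0
    simp only [Matrix.cons_val_zero] at this
    rw [← ht, ← this, Language.Term.realize_relabel]
    rfl
  choose s hs using hsup
  let J : Set I := ⋃ x, (s x : Set I)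
  have hJ : #J ≤ ρ := mk_finset_iUnion_le hρ' hδ s
  choose t ht using fun x => hs x J (subset_iUnion (fun x => (s x : Set I)) x)
  obtain ⟨c, hc⟩ := exists_cut_code J
  let Y : Type u := Σ n : ℕ, Σ m : ℕ, (Fin n → L.Term (Fin m)) × (Fin m → Option J × Option J) ×
    (Fin m → Fin m → Prop)
  have hY : #Y ≤ ρ := by
    refine mk_sigma_nat_le hρ' fun n => mk_sigma_nat_le hρ' fun m => ?_
    have h1 : #(Option J) ≤ ρ := by
      rw [mk_option]; exact add_le_of_le hρ' hJ (one_le_aleph0.trans hρ')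
    have h2 : #(L.Term (Fin m)) ≤ ρ := by
      refine (mk_le_of_injective (Term.relabel_injective (L := L)
        (f := (ULift.up : Fin m → ULift.{u} (Fin m))) ULift.up_injective)).trans
        (mk_term_le.trans (max_le hρ ?_))
      exact (lt_aleph0_of_finite _).le.trans hρ'
    rw [mk_prod, mk_prod]
    simp only [lift_uzero, lift_id]
    refine mul_le_of_le hρ' (mk_fin_fun_le hρ' h2 n) ?_
    refine mul_le_of_le hρ' (mk_fin_fun_le hρ' ?_ m) ?_
    · rw [mk_prod]
      simpa using mul_le_of_le hρ' h1 h1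
    · exact (lift_le_aleph0.2 (lt_aleph0_of_finite _).le).trans hρ'
  let Q : (Σ n : ℕ, Fin n → A) → Y → Prop := fun x y => ∃ w : Fin y.2.1 → I,
    x = ⟨y.1, fun k => (y.2.2.1 k).realize (e ∘ w)⟩ ∧ y.2.2.2.1 = c ∘ w ∧
      y.2.2.2.2 = fun i j => w i < w j
  have ex : ∀ x, ∃ y, Q x y := by
    rintro ⟨n, a⟩
    obtain ⟨m, w, s, rfl⟩ := hg.exists_fin a
    exact ⟨⟨n, m, s, c ∘ w, fun i j => w i < w j⟩, w, rfl, rfl, rfl⟩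
  choose code hcode using ex
  refine (mk_range_le_of_code code fun x x' hxx => ?_).trans hY
  have h1 := hcode x
  have h2 := hcode x'
  rw [← hxx] at h2
  obtain ⟨w, hx, hp, hr⟩ := h1
  obtain ⟨w', hx', hp', hr'⟩ := h2
  generalize code x = y at *
  obtain ⟨n, m, s, p, r⟩ := y
  simp only at hx hx' hp hp' hr hr'
  subst hx hx'
  simp only [Sigma.mk.injEq, heq_eq_eq, true_and]
  have hcw : ∀ i, c (w i) = c (w' i) := fun i => congrFun (hp.symm.trans hp') i
  have hrw : ∀ i j, w i < w j ↔ w' i < w' j := fun i j => by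
    have := congrFun (congrFun (hr.symm.trans hr') i) j
    exact iff_of_eq this
  have h3 : atp L (e ∘ Sum.elim (fun j : J => (j : I)) w) =
      atp L (e ∘ Sum.elim (fun j : J => (j : I)) w') := by
    refine hi.atp_eq fun x y => ?_
    rcases x with x | x <;> rcases y with y | y
    · rfl
    · exact (hc _ _ (hcw y) x x.2).1
    · exact (hc _ _ (hcw x) y y.2).2
    · exact hrw x y
  have h4 := atp_realize h3 (Sum.elim (fun x => (t x).relabel Sum.inl)
    fun k => (s k).relabel Sum.inr)
  have h5 : ∀ w : Fin m → I, (fun k => ((Sum.elim (fun x => (t x).relabel Sum.inl)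
      (fun k => (s k).relabel Sum.inr) : δ ⊕ Fin n → L.Term (J ⊕ Fin m)) k).realize
      (e ∘ Sum.elim (fun j : J => (j : I)) w)) =
      Sum.elim d fun k => (s k).realize (e ∘ w) := by
    intro w
    funext x
    rcases x with x | x
    · simp only [Sum.elim_inl, Language.Term.realize_relabel, ← ht]
      rfl
    · simp only [Sum.elim_inr, Language.Term.realize_relabel]
      rfl
  rw [h5, h5] at h4
  exact h4

theorem mk_Iio_ord_lt {c : Cardinal.{u}} (i : c.ord.ToType) : #(Iio i) < c :=
  (mk_Iio_lt i (by rw [mk_ord_toType, Ordinal.type_toType])).trans_eq (mk_ord_toType c)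

/-- Every infinite cardinal `κ` bounds the size of a set cofinally separating the points of some
linear order of size greater than `κ`. -/
theorem exists_separated_order (κ : Cardinal.{u}) (hκ : ℵ₀ ≤ κ) :
    ∃ (J : Type u) (_ : LinearOrder J) (J₀ : Set J), κ < #J ∧ #J ≤ 2 ^ κ ∧ #J₀ ≤ κ ∧
      ∀ x x', x < x' → ∃ y ∈ J₀, x ≤ y ∧ y < x' := by
  classical
  have hne : {ν : Cardinal.{u} | κ < 2 ^ ν}.Nonempty := ⟨κ, cantor κ⟩
  obtain ⟨ν, hν, hmin⟩ := (wellFounded_lt (α := Cardinal.{u})).has_min _ hne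
  have hνκ : ν ≤ κ := not_lt.1 (hmin κ (cantor κ))
  let W := ν.ord.ToType
  have hW : #W = ν := mk_ord_toType ν
  let F : (Σ i : W, (Iio i → Bool)) → Lex (W → Bool) := fun p => toLex fun j =>
    if h : j < p.1 then p.2 ⟨j, h⟩ else decide (p.1 < j)
  have hcard : #(Lex (W → Bool)) = 2 ^ ν := by
    change #(W → Bool) = _
    rw [mk_arrow]; simp [hW]
  refine ⟨Lex (W → Bool), inferInstance, range F, hcard ▸ hν, ?_, ?_, ?_⟩
  · rw [hcard]; exact power_le_power_left two_ne_zero hνκ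
  · refine mk_range_le.trans ?_
    rw [mk_sigma]
    refine (sum_le_sum _ (fun _ => κ) fun i => ?_).trans ?_
    · rw [mk_arrow]
      simp only [mk_bool, lift_ofNat, lift_uzero]
      have : #(Iio i) < ν := mk_Iio_ord_lt i
      exact not_lt.1 fun h => hmin _ h this
    · rw [sum_const, lift_id, lift_id, hW]
      exact mul_le_of_le hκ hνκ le_rfl
  · rintro x x' ⟨i, hi, hlt⟩
    have hx : x i = false ∧ x' i = true := by
      revert hlt
      cases x i <;> cases x' i <;> simp
    refine ⟨F ⟨i, fun j => x j⟩, mem_range_self _, ?_, ⟨i, fun j hj => ?_, ?_⟩⟩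
    · refine Pi.toLex_monotone (a := ofLex x) fun j => ?_
      by_cases hj : j < i
      · simp [hj]
      · rcases (not_lt.1 hj).lt_or_eq with h | rfl
        · simp [hj, h]
        · simp [hx.1]
    · have : F ⟨i, fun j => x j⟩ j = x j := by
        change dite _ _ _ = _
        simp [hj]
      rw [← hi j hj]
      exact this
    · have : F ⟨i, fun j => x j⟩ i = false := by
        change dite _ _ _ = _
        simp
      change F ⟨i, fun j => x j⟩ i < x' i
      rw [this, hx.2]
      decide

/-- Every sequence of countable tuples of an Ehrenfeucht–Mostowski model contains an indiscernible
one. -/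
theorem exists_indisc_subsequence (L : FirstOrder.Language.{u, u}) (κ : Type) :
    ∃ ζ : Cardinal.{u}, ∀ (I A ι : Type u) [LinearOrder I] [Nonempty I] [L.Structure A]
      [LinearOrder ι] [WellFoundedLT ι] (e : I → A), Gen L e → OIndisc L e → ζ ≤ #ι →
      ∀ c : ι → κ → A, ∃ f : ℕ → ι, StrictMono f ∧
        Indisc L (PEmpty.elim : PEmpty.{u + 1} → A) fun j => c (f j) := by
  let X := κ × ℕ
  obtain ⟨ζ, hζ⟩ := erdos_rado 2 ((κ → L.Term ℕ) × Set ((X ⊕ X) × (X ⊕ X))) ℵ₀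
  refine ⟨ζ, fun I A ι _ _ _ _ _ e hg hi hι c => ?_⟩
  have hterm : ∀ i x, ∃ (t : L.Term ℕ) (w : ℕ → I), c i x = t.realize (e ∘ w) := by
    intro i x
    obtain ⟨m, w, s, h⟩ := hg.exists_fin fun _ : Fin 1 => c i x
    refine ⟨(s 0).relabel Fin.val, fun k => if h : k < m then w ⟨k, h⟩ else Classical.arbitrary I, ?_⟩
    rw [Language.Term.realize_relabel, congrFun h 0]
    congr 1
    funext k
    simp
  choose τ w hτ using hterm
  let W : ι → X → I := fun i x => w i x.1 x.2
  let col : (Fin 2 → ι) → (κ → L.Term ℕ) × Set ((X ⊕ X) × (X ⊕ X)) := fun s =>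
    (τ (s 0), {p | Sum.elim (W (s 0)) (W (s 1)) p.1 < Sum.elim (W (s 0)) (W (s 1)) p.2})
  obtain ⟨S, hS, hcol⟩ := hζ ι hι col
  have : Infinite S := infinite_iff.2 hS
  obtain ⟨f, hf⟩ := exists_strictMono_nat S
  have hpair : ∀ i j i' j' : ℕ, i < j → i' < j' → τ (f i) = τ (f i') ∧ ∀ p q : X ⊕ X,
      Sum.elim (W (f i)) (W (f j)) p < Sum.elim (W (f i)) (W (f j)) q ↔
      Sum.elim (W (f i')) (W (f j')) p < Sum.elim (W (f i')) (W (f j')) q := by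
    intro i j i' j' h h'
    have hs : ∀ i j : ℕ, i < j → StrictMono ![(f i : ι), f j] := fun i j h a b hab => by
      fin_cases a <;> fin_cases b <;> simp_all [hf.lt_iff_lt]
    have hm : ∀ i j : ℕ, ∀ k, ![(f i : ι), f j] k ∈ S := fun i j k => by
      fin_cases k <;> simp
    have := hcol _ _ (hs i j h) (hs i' j' h') (hm _ _) (hm _ _)
    refine ⟨(Prod.ext_iff.1 this).1, fun p q => ?_⟩
    exact (Set.ext_iff.1 (Prod.ext_iff.1 this).2 (p, q))
  refine ⟨fun i => f i, fun i j h => hf h, fun n s t hs ht => ?_⟩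
  have hτ0 : ∀ i j : ℕ, τ (f i) = τ (f j) := fun i j =>
    (hpair i (i + 1) j (j + 1) i.lt_succ_self j.lt_succ_self).1
  have h1 : atp L (e ∘ fun x : Fin n × X => W (f (s x.1)) x.2) =
      atp L (e ∘ fun x : Fin n × X => W (f (t x.1)) x.2) := by
    refine hi.atp_eq ?_
    rintro ⟨i, x⟩ ⟨j, y⟩
    rcases lt_trichotomy i j with h | rfl | h
    · exact (hpair _ _ _ _ (hs h) (ht h)).2 (Sum.inl x) (Sum.inr y)
    · exact (hpair _ _ _ _ (s i).lt_succ_self (t i).lt_succ_self).2 (Sum.inl x) (Sum.inl y)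
    · exact (hpair _ _ _ _ (hs h) (ht h)).2 (Sum.inr x) (Sum.inl y)
  have h2 := atp_realize h1 (fun y : PEmpty.{u + 1} ⊕ (Fin n × κ) => Sum.elim PEmpty.elim
    (fun x : Fin n × κ => (τ (f 0) x.2).relabel fun k => (x.1, (x.2, k))) y)
  have h3 : ∀ s : Fin n → ℕ, (fun y : PEmpty.{u + 1} ⊕ (Fin n × κ) => (Sum.elim PEmpty.elim
    (fun x : Fin n × κ => (τ (f 0) x.2).relabel fun k => (x.1, (x.2, k))) y :
      L.Term (Fin n × X)).realize (e ∘ fun x : Fin n × X => W (f (s x.1)) x.2)) =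
      Sum.elim PEmpty.elim fun x : Fin n × κ => c (f (s x.1)) x.2 := by
    intro s
    funext y
    rcases y with y | ⟨i, x⟩
    · exact y.elim
    · simp only [Sum.elim_inr, Language.Term.realize_relabel, hτ, hτ0 (s i) 0]
      rfl
  rw [h3, h3] at h2
  exact h2

namespace LocalClass

/-- Arbitrarily large members. -/
def Arb (K : LocalClass L) : Prop :=
  ∀ μ : Cardinal.{u}, ∃ (A : Type u) (_ : L.Structure A), K.Mem A ∧ μ ≤ #A

/-- Categoricity in a cardinal. -/
def Cat (K : LocalClass L) (lam : Cardinal.{u}) : Prop :=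
  (∃ (A : Type u) (_ : L.Structure A), K.Mem A ∧ #A = lam) ∧
    ∀ (A B : Type u) [L.Structure A] [L.Structure B], K.Mem A → K.Mem B → #A = lam →
      #B = lam → Nonempty (A ≃[L] B)

variable {K : LocalClass L} {lam : Cardinal.{u}}

theorem Cat.exists_em (hc : K.Cat lam) (ha : K.Arb) (hl : ls L ≤ lam) {A : Type u}
    [L.Structure A] (hA : K.Mem A) (hcard : #A = lam) :
    ∃ e : lam.ord.ToType → A, Gen L e ∧ OIndisc L e := by
  obtain ⟨B, _, e, hB, hi, hg, ho⟩ := K.exists_em ha lam.ord.ToType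
  have hJ : #lam.ord.ToType = lam := mk_ord_toType lam
  obtain ⟨f⟩ := hc.2 B A hB hA ((mk_em hi hg (hJ.symm ▸ hl)).trans hJ) hcard
  refine ⟨f ∘ e, fun a => ?_, fun n s t hs ht => ?_⟩
  · obtain ⟨t, ht⟩ := hg (f.symm a)
    refine ⟨t, ?_⟩
    have := Language.HomClass.realize_term f (t := t) (v := e)
    rw [ht] at this
    rw [this]
    exact f.apply_symm_apply a
  · have h := ho n s t hs ht
    rw [← atp_embedding f.toEmbedding, ← atp_embedding f.toEmbedding, Sum.comp_elim,
      Sum.comp_elim] at h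
    convert h using 2 <;> congr 1 <;> funext x <;> exact x.elim

theorem Cat.stab (hc : K.Cat lam) (ha : K.Arb) (hl : ls L ≤ lam) {A : Type u}
    [L.Structure A] (hA : K.Mem A) (hcard : #A = lam) {ρ : Cardinal.{u}} (hρ : ls L ≤ ρ) :
    Stab L A ρ := by
  obtain ⟨e, hg, ho⟩ := hc.exists_em ha hl hA hcard
  exact stab_em hg ho hρ

end LocalClass

/-- A family of tuples witnessing the order property. -/
def OrderProp (L : FirstOrder.Language.{u, u}) {ι A : Type*} [L.Structure A] [LE ι] {p : ℕ}
    (b : ι → Fin p → A) (m m' : ι → ℕ → A) : Prop :=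
  ∀ i j, i ≤ j ↔ atp L (Sum.elim (b i) (m j)) = atp L (Sum.elim (b i) (m' j))

theorem not_orderProp_of_stab {A J : Type u} [L.Structure A] [LinearOrder J]
    (hs : Stab L A (ls L)) {p : ℕ} {b : J → Fin p → A} {m m' : J → ℕ → A}
    (h : OrderProp L b m m') {J₁ J₀ : Set J} (h₁ : ls L < #J₁) (h₀ : #J₀ ≤ ls L)
    (hsep : ∀ x ∈ J₁, ∀ x' ∈ J₁, x < x' → ∃ y ∈ J₀, x ≤ y ∧ y < x') : False := by
  have hω : ℵ₀ ≤ ls L := aleph0_le_ls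
  let d : J₀ × (ℕ ⊕ ℕ) → A := fun z => Sum.elim (m z.1) (m' z.1) z.2
  have hδ : #(J₀ × (ℕ ⊕ ℕ)) ≤ ls L := by
    rw [mk_prod]
    simp only [lift_uzero, mk_eq_aleph0, lift_aleph0]
    exact mul_le_of_le hω h₀ hω
  have key : ∀ x ∈ J₁, ∀ x' ∈ J₁, x < x' → atp L (Sum.elim d (b x)) ≠ atp L (Sum.elim d (b x')) := by
    intro x hx x' hx' hlt heq
    obtain ⟨y, hy, hxy, hyx⟩ := hsep x hx x' hx' hlt
    have e1 := atp_comp heq (Sum.elim Sum.inr fun k => Sum.inl (⟨y, hy⟩, Sum.inl k) :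
      Fin p ⊕ ℕ → (J₀ × (ℕ ⊕ ℕ)) ⊕ Fin p)
    have e2 := atp_comp heq (Sum.elim Sum.inr fun k => Sum.inl (⟨y, hy⟩, Sum.inr k) :
      Fin p ⊕ ℕ → (J₀ × (ℕ ⊕ ℕ)) ⊕ Fin p)
    rw [Sum.comp_elim, Sum.comp_elim] at e1 e2
    have e3 := (h x y).1 hxy
    exact not_le_of_gt hyx ((h x' y).2 (e1.symm.trans (e3.trans e2)))
  refine h₁.not_ge (le_trans ?_ (hs _ d hδ))
  refine mk_le_of_injective (f := fun x : J₁ => (⟨_, ⟨p, b x⟩, rfl⟩ : typesOver L d)) ?_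
  intro x x' hxx
  have heq : atp L (Sum.elim d (b x)) = atp L (Sum.elim d (b x')) := by
    simpa using Subtype.ext_iff.1 hxx
  rcases lt_trichotomy (x : J) x' with h | h | h
  · exact absurd heq (key _ x.2 _ x'.2 h)
  · exact Subtype.ext h
  · exact absurd heq.symm (key _ x'.2 _ x.2 h)

theorem OrderProp.stretch {A B D : Type u} {J : Type*} [L.Structure A] [L.Structure B]
    [LinearOrder J]
    {p : ℕ} {d : D → A} {d' : D → B} {c : ℕ → Fin p ⊕ (ℕ ⊕ ℕ) → A} {c' : J → Fin p ⊕ (ℕ ⊕ ℕ) → B}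
    (hcc : ∀ n (s : Fin n → J) (t : Fin n → ℕ), StrictMono s → StrictMono t →
      atp L (Sum.elim d' fun x : Fin n × (Fin p ⊕ (ℕ ⊕ ℕ)) => c' (s x.1) x.2) =
        atp L (Sum.elim d fun x : Fin n × (Fin p ⊕ (ℕ ⊕ ℕ)) => c (t x.1) x.2))
    (h : OrderProp L (fun i k => c i (Sum.inl k)) (fun i k => c i (Sum.inr (Sum.inl k)))
      (fun i k => c i (Sum.inr (Sum.inr k)))) :
    OrderProp L (fun i k => c' i (Sum.inl k)) (fun i k => c' i (Sum.inr (Sum.inl k)))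
      (fun i k => c' i (Sum.inr (Sum.inr k))) ∧ ∃ k, Function.Injective fun i => c' i k := by
  have hpair : ∀ x y, x < y → ∀ i j : ℕ, i < j → atp L (Sum.elim (c' x) (c' y)) =
      atp L (Sum.elim (c i) (c j)) := by
    intro x y hxy i j hij
    have h1 := hcc 2 ![x, y] ![i, j]
      (fun a b hab => by fin_cases a <;> fin_cases b <;> simp_all)
      (fun a b hab => by fin_cases a <;> fin_cases b <;> simp_all)
    have h2 := atp_comp h1 (Sum.elim (fun k => Sum.inr (0, k)) fun k => Sum.inr (1, k))
    rw [Sum.comp_elim, Sum.comp_elim] at h2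
    exact h2
  have hone : ∀ x, ∀ i : ℕ, atp L (c' x) = atp L (c i) := by
    intro x i
    have h1 := hcc 1 ![x] ![i] (Subsingleton.strictMono _) (Subsingleton.strictMono _)
    exact atp_comp h1 (fun k => Sum.inr (0, k))
  have htwo : ∀ x y, ∃ i j : ℕ, (x ≤ y ↔ i ≤ j) ∧
      atp L (Sum.elim (c' x) (c' y)) = atp L (Sum.elim (c i) (c j)) := by
    intro x y
    rcases lt_trichotomy x y with h | rfl | h
    · exact ⟨0, 1, iff_of_true h.le zero_lt_one.le, hpair x y h 0 1 zero_lt_one⟩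
    · exact ⟨0, 0, iff_of_true le_rfl le_rfl, by
        have := atp_comp (hone x 0) (Sum.elim id id)
        rwa [Sum.comp_elim, Sum.comp_elim] at this⟩
    · refine ⟨1, 0, iff_of_false h.not_ge (by decide), ?_⟩
      have := atp_comp (hpair y x h 0 1 zero_lt_one) (Sum.elim Sum.inr Sum.inl)
      rwa [Sum.comp_elim, Sum.comp_elim] at this
  refine ⟨fun x y => ?_, ?_⟩
  · obtain ⟨i, j, hij, h'⟩ := htwo x y
    have e1 := atp_comp h' (Sum.map Sum.inl (Sum.inr ∘ Sum.inl))
    have e2 := atp_comp h' (Sum.map Sum.inl (Sum.inr ∘ Sum.inr))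
    rw [Sum.elim_comp_map, Sum.elim_comp_map] at e1 e2
    rw [hij, h i j]
    exact ⟨fun h => e1.trans (h.trans e2.symm), fun h => e1.symm.trans (h.trans e2)⟩
  · have hne : ∃ k, c 0 k ≠ c 1 k := by
      by_contra! hall
      have : c 0 = c 1 := funext hall
      have h1 := (h 0 0).1 le_rfl
      have h2 := mt (h 1 0).2 (by decide)
      simp only [this] at h1 h2
      exact h2 h1
    obtain ⟨k, hk⟩ := hne
    refine ⟨k, ?_⟩
    have : ∀ x y, x < y → c' x k ≠ c' y k := fun x y hxy h => hk
      ((apply_eq_iff_of_atp (hpair x y hxy 0 1 zero_lt_one) (Sum.inl k) (Sum.inr k)).1 h)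
    intro x y hxy
    rcases lt_trichotomy x y with h | h | h
    · exact absurd hxy (this _ _ h)
    · exact h
    · exact absurd hxy.symm (this _ _ h)

theorem LocalClass.Cat.false_of_orderProp_nat {K : LocalClass L} (ha : K.Arb)
    {lam : Cardinal.{u}} (hc : K.Cat lam) (h2 : 2 ^ ls L ≤ lam) {p : ℕ} {A : Type u}
    [L.Structure A] (hA : K.Mem A) {c : ℕ → Fin p ⊕ (ℕ ⊕ ℕ) → A}
    (hi : Indisc L (PEmpty.elim : PEmpty.{u + 1} → A) c)
    (hop : OrderProp L (fun i k => c i (Sum.inl k)) (fun i k => c i (Sum.inr (Sum.inl k)))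
      (fun i k => c i (Sum.inr (Sum.inr k)))) : False := by
  have hls : ls L ≤ lam := (cantor _).le.trans h2
  have hω : ℵ₀ ≤ lam := aleph0_le_ls.trans hls
  obtain ⟨J₁, _, J₀, hJ₁, hJ₁', hJ₀, hsep⟩ := exists_separated_order (ls L) aleph0_le_ls
  let W := lam.ord.ToType
  obtain ⟨B, _, d', c', hB, hgB, hcc⟩ := K.exists_stretch hA hi (J₁ ⊕ₗ W)
  obtain ⟨hop', k, hinj⟩ := hop.stretch hcc
  have hJ : #(J₁ ⊕ₗ W) = lam := by
    change #(J₁ ⊕ W) = lam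
    rw [mk_sum]
    simp only [lift_id]
    rw [mk_ord_toType]
    exact add_eq_right hω (hJ₁'.trans h2)
  have hBc : #B = lam := by
    refine le_antisymm (hgB.mk_le.trans (max_le hls ?_)) (hJ ▸ mk_le_of_injective hinj)
    rw [mk_sum]
    simp only [lift_uzero, mk_pempty, zero_add, mk_prod, hJ, lift_id]
    refine mul_le_of_le hω le_rfl ?_
    exact (lift_le_aleph0.2 (mk_le_aleph0)).trans hω
  refine not_orderProp_of_stab (hc.stab ha hls hB hBc le_rfl) hop'
    (J₁ := range fun x : J₁ => toLex (Sum.inl x)) (J₀ := (fun x : J₁ => toLex (Sum.inl x)) '' J₀)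
    ?_ (mk_image_le.trans hJ₀) ?_
  · rwa [mk_range_eq _ fun x y h => by simpa using h]
  · rintro _ ⟨x, rfl⟩ _ ⟨x', rfl⟩ hlt
    obtain ⟨y, hy, hxy, hyx⟩ := hsep x x' (by simpa using hlt)
    exact ⟨_, ⟨y, hy, rfl⟩, by simpa using hxy, by simpa using hyx⟩

theorem LocalClass.exists_no_orderProp_aux (K : LocalClass L) (ha : K.Arb) (p : ℕ) :
    ∃ ζ : Cardinal.{u}, ∀ (ξ lam : Cardinal.{u}), ζ ≤ ξ → K.Cat lam → 2 ^ ls L ≤ lam → ξ ≤ lam →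
      ∀ (A : Type u) [L.Structure A], K.Mem A → lam ≤ #A →
        ∀ (b : ξ.ord.ToType → Fin p → A) (m m' : ξ.ord.ToType → ℕ → A),
          ¬ OrderProp L b m m' := by
  obtain ⟨ζ, hζ⟩ := exists_indisc_subsequence L (Fin p ⊕ (ℕ ⊕ ℕ))
  refine ⟨ζ, fun ξ lam hξ hc h2 hl A _ hA hcard b m m' hop => ?_⟩
  have hls : ls L ≤ lam := (cantor _).le.trans h2
  have hω : ℵ₀ ≤ lam := aleph0_le_ls.trans hls
  let c : ξ.ord.ToType → Fin p ⊕ (ℕ ⊕ ℕ) → A := fun i => Sum.elim (b i) (Sum.elim (m i) (m' i))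
  obtain ⟨M, hM, hMc⟩ := exists_substructure_card (range fun x : ξ.ord.ToType ×
    (Fin p ⊕ (ℕ ⊕ ℕ)) => c x.1 x.2) hls (by
      refine mk_range_le.trans ?_
      rw [mk_prod, mk_ord_toType]
      simp only [lift_uzero]
      refine mul_le_of_le hω hl ?_
      exact (lift_le_aleph0.2 (mk_le_aleph0)).trans hω) hcard
  have hcM : ∀ i x, c i x ∈ M := fun i x => hM ⟨(i, x), rfl⟩
  obtain ⟨e, hg, ho⟩ := hc.exists_em ha hls (mem_substructure hA M) hMc
  have : Nonempty lam.ord.ToType := mk_ne_zero_iff.1 (by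
    rw [mk_ord_toType]; exact (aleph0_pos.trans_le hω).ne')
  obtain ⟨f, hf, hi⟩ := hζ _ _ ξ.ord.ToType e hg ho (by rwa [mk_ord_toType])
    fun i x => (⟨c i x, hcM i x⟩ : M)
  refine hc.false_of_orderProp_nat ha h2 (mem_substructure hA M) hi fun i j => ?_
  rw [← hf.le_iff_le, hop, ← atp_embedding M.subtype, ← atp_embedding M.subtype, Sum.comp_elim,
    Sum.comp_elim]
  rfl

/-- Long order properties are incompatible with categoricity. -/
theorem LocalClass.exists_no_orderProp (K : LocalClass L) (ha : K.Arb) :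
    ∃ ζ : Cardinal.{u}, ∀ (ξ lam : Cardinal.{u}), ζ ≤ ξ → K.Cat lam → 2 ^ ls L ≤ lam → ξ ≤ lam →
      ∀ (A : Type u) [L.Structure A], K.Mem A → lam ≤ #A →
        ∀ (p : ℕ) (b : ξ.ord.ToType → Fin p → A) (m m' : ξ.ord.ToType → ℕ → A),
          ¬ OrderProp L b m m' := by
  choose ζ hζ using K.exists_no_orderProp_aux ha
  refine ⟨⨆ p, ζ p, fun ξ lam hξ hc h2 hl A _ hA hcard p => ?_⟩
  exact hζ p ξ lam ((le_ciSup (bddAbove_of_small) p).trans hξ) hc h2 hl A hA hcard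

namespace LocalClass

/-- Every type over the parameters `d` realized in an extension is realized. -/
def ECat (K : LocalClass L) {δ A : Type u} [L.Structure A] (d : δ → A) : Prop :=
  ∀ (N : Type u) [L.Structure N], K.Mem N → ∀ (e : A ↪[L] N) (n : ℕ) (a : Fin n → N),
    ∃ a' : Fin n → A, atp L (Sum.elim (e ∘ d) a) = atp L (Sum.elim d a')

variable {K : LocalClass L}

theorem ECat.comp {δ δ' A : Type u} [L.Structure A] {d : δ → A} (h : K.ECat d) (f : δ' → δ) :
    K.ECat (d ∘ f) := by
  intro N _ hN e n a
  obtain ⟨a', ha⟩ := h N hN e n a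
  refine ⟨a', ?_⟩
  have := atp_comp ha (Sum.map f id)
  rwa [Sum.elim_comp_map, Sum.elim_comp_map] at this

theorem ECat.map {δ A B : Type u} [L.Structure A] [L.Structure B] {d : δ → A} (h : K.ECat d)
    (g : A ↪[L] B) : K.ECat (g ∘ d) := by
  intro N _ hN e n a
  obtain ⟨a', ha⟩ := h N hN (e.comp g) n a
  refine ⟨g ∘ a', ?_⟩
  rw [← Sum.comp_elim, atp_embedding, ← ha]
  rfl

variable (K) in
/-- A member of `K` of size `lam` presented on a subset of `Ω`. -/
structure Pres (Ω : Type u) (lam : Cardinal.{u}) where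
  X : Set Ω
  card : #X = lam
  A : Type u
  [str : L.Structure A]
  v : X → A
  mem : K.Mem A
  bij : Function.Bijective v

attribute [instance] Pres.str

namespace Pres

variable {Ω : Type u} {lam : Cardinal.{u}}

instance : Preorder (K.Pres Ω lam) where
  le P Q := ∃ h : P.X ⊆ Q.X, atp L (Q.v ∘ inclusion h) = atp L P.v
  le_refl P := ⟨Subset.rfl, rfl⟩
  le_trans P Q R := by
    rintro ⟨h, h'⟩ ⟨k, k'⟩
    exact ⟨h.trans k, (atp_comp k' (inclusion h)).trans h'⟩

theorem gen (P : K.Pres Ω lam) : Gen L P.v := fun a => by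
  obtain ⟨x, rfl⟩ := P.bij.2 a
  exact ⟨Language.var x, rfl⟩

theorem mk_A (P : K.Pres Ω lam) : #P.A = lam :=
  (mk_congr (Equiv.ofBijective _ P.bij)).symm.trans P.card

theorem exists_embedding {P Q : K.Pres Ω lam} (h : P ≤ Q) :
    ∃ e : P.A ↪[L] Q.A, ∀ x, e (P.v x) = Q.v (inclusion h.1 x) :=
  P.gen.exists_embedding h.2.symm

theorem exists_union {ι : Type u} [LinearOrder ι] [Nonempty ι] (G : ι → K.Pres Ω lam)
    (hG : Monotone G) (hω : ℵ₀ ≤ lam) (hι : #ι ≤ lam) :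
    ∃ Q : K.Pres Ω lam, (∀ i, G i ≤ Q) ∧ Q.X = ⋃ i, (G i).X := by
  let S : ι → Set ↥(⋃ i, (G i).X) := fun i => {x | (x : Ω) ∈ (G i).X}
  have hS : Monotone S := fun i j h x hx => (hG h).1 hx
  let g : ∀ i, S i → (G i).X := fun i x => ⟨x, x.2⟩
  have hcoh : ∀ i j (h : i ≤ j), atp L (((G j).v ∘ g j) ∘ inclusion (hS h)) =
      atp L ((G i).v ∘ g i) := fun i j h => atp_comp (hG h).2 (g i)
  obtain ⟨A, _, v, hA, hg, hv⟩ := K.exists_directed_model S hS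
    (fun x => by obtain ⟨i, hi⟩ := mem_iUnion.1 x.2; exact ⟨i, hi⟩)
    (fun i => atp L ((G i).v ∘ g i)) (fun i => ⟨_, _, _, (G i).mem, rfl⟩)
    (fun i j h => by rw [← hcoh i j h, atp_comp_eq_preimage _ (inclusion (hS h))])
  have hfin : ∀ s : Finset ↥(⋃ i, (G i).X), ∃ i, (s : Set _) ⊆ S i := by
    intro s
    choose p hp using fun x : ↥(⋃ i, (G i).X) => mem_iUnion.1 x.2
    classical
    obtain ⟨i, hi⟩ := (s.image p).exists_le
    exact ⟨i, fun x hx => hS (hi _ (Finset.mem_image_of_mem _ hx)) (hp x)⟩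
  have hcard : #↥(⋃ i, (G i).X) = lam := by
    refine le_antisymm ((mk_iUnion_le _).trans (mul_le_of_le hω hι (ciSup_le' fun i =>
      (G i).card.le))) ?_
    have i := Classical.arbitrary ι
    refine (G i).card.ge.trans ?_
    exact mk_le_mk_of_subset (subset_iUnion (fun i => (G i).X) i)
  refine ⟨⟨⋃ i, (G i).X, hcard, A, v, hA, fun x y hxy => ?_, fun a => ?_⟩, fun i =>
    ⟨subset_iUnion (fun i => (G i).X) i, ?_⟩, rfl⟩
  · classical
    obtain ⟨i, hi⟩ := hfin {x, y}
    have hx : x ∈ S i := hi (by simp)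
    have hy : y ∈ S i := hi (by simp)
    have := (G i).bij.1 ((apply_eq_iff_of_atp (hv i) ⟨x, hx⟩ ⟨y, hy⟩).1 hxy)
    have hxy' : (x : Ω) = y := congrArg (fun z : (G i).X => (z : Ω)) this
    exact Subtype.ext hxy'
  · obtain ⟨t, rfl⟩ := hg a
    obtain ⟨s, hs⟩ := exists_finset_terms ![t]
    obtain ⟨i, hi⟩ := hfin s
    obtain ⟨t', ht'⟩ := hs _ hi
    have ht := ht' 0
    simp only [Matrix.cons_val_zero] at ht
    obtain ⟨y, hy⟩ := (G i).bij.2 ((t' 0).realize ((G i).v ∘ g i))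
    let y' : S i := ⟨⟨y, subset_iUnion (fun i => (G i).X) i y.2⟩, y.2⟩
    refine ⟨y', ?_⟩
    have := (realize_eq_iff_of_atp (hv i) (t' 0) (Language.var y')).2 hy.symm
    rw [← ht, Language.Term.realize_relabel]
    exact this.symm
  · exact atp_comp (hv i) fun x : (G i).X =>
      (⟨⟨x, subset_iUnion (fun i => (G i).X) i x.2⟩, x.2⟩ : S i)

theorem exists_upper {ι : Type u} [LinearOrder ι] (P : K.Pres Ω lam) (G : ι → K.Pres Ω lam)
    (hG : Monotone G) (hP : ∀ i, P ≤ G i) (hω : ℵ₀ ≤ lam) (hι : #ι ≤ lam) :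
    ∃ Q : K.Pres Ω lam, P ≤ Q ∧ ∀ i, G i ≤ Q := by
  cases isEmpty_or_nonempty ι with
  | inl h => exact ⟨P, le_rfl, fun i => h.elim i⟩
  | inr h =>
    obtain ⟨Q, hQ, -⟩ := exists_union G hG hω hι
    exact ⟨Q, (hP (Classical.arbitrary ι)).trans (hQ _), hQ⟩

theorem exists_extension (hω : ℵ₀ ≤ lam) (hΩ : lam < #Ω) (P : K.Pres Ω lam) {N : Type u}
    [L.Structure N] (hN : K.Mem N) (hc : #N = lam) (e : P.A ↪[L] N) :
    ∃ (Q : K.Pres Ω lam) (h : P ≤ Q) (i : N ≃[L] Q.A),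
      ∀ x, i (e (P.v x)) = Q.v (inclusion h.1 x) := by
  classical
  let w : P.X → N := e ∘ P.v
  have hw : Function.Injective w := e.injective.comp P.bij.1
  have hcompl : #↥(range w)ᶜ ≤ #↥(P.X)ᶜ := by
    refine ((mk_set_le _).trans hc.le).trans ?_
    by_contra! h
    have := mk_sum_compl P.X
    rw [P.card] at this
    have h2 : lam + #↥(P.X)ᶜ ≤ lam := add_le_of_le hω le_rfl h.le
    exact absurd (this ▸ h2) hΩ.not_ge
  obtain ⟨j⟩ := hcompl
  let g : N → Ω := fun n => if h : n ∈ range w then (h.choose : P.X) else j ⟨n, h⟩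
  have hgw : ∀ x, g (w x) = x := fun x => by
    have h : w x ∈ range w := ⟨x, rfl⟩
    simp only [g, dif_pos h]
    rw [hw h.choose_spec]
  have hgn : ∀ n (h : n ∉ range w), g n = j ⟨n, h⟩ := fun n h => by simp only [g, dif_neg h]
  have hg : Function.Injective g := by
    intro a b hab
    by_cases ha : a ∈ range w <;> by_cases hb : b ∈ range w
    · obtain ⟨x, rfl⟩ := ha
      obtain ⟨y, rfl⟩ := hb
      rw [hgw, hgw] at hab
      rw [Subtype.ext hab]
    · obtain ⟨x, rfl⟩ := ha
      rw [hgw, hgn b hb] at hab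
      exact absurd x.2 (hab ▸ (j ⟨b, hb⟩).2)
    · obtain ⟨x, rfl⟩ := hb
      rw [hgw, hgn a ha] at hab
      exact absurd x.2 (hab ▸ (j ⟨a, ha⟩).2)
    · rw [hgn a ha, hgn b hb] at hab
      exact Subtype.ext_iff.1 (j.injective (Subtype.ext hab))
  let E := Equiv.ofInjective g hg
  have hEv : ∀ (x : P.X) (h : (x : Ω) ∈ range g), E.symm ⟨x, h⟩ = w x := fun x h => by
    rw [Equiv.symm_apply_eq]
    exact Subtype.ext (hgw x).symm
  have hsub : P.X ⊆ range g := fun x hx => ⟨w ⟨x, hx⟩, hgw ⟨x, hx⟩⟩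
  let Q : K.Pres Ω lam := ⟨range g, (mk_congr E).symm.trans hc, N, E.symm, hN, E.symm.bijective⟩
  refine ⟨Q, ⟨hsub, ?_⟩, Language.Equiv.refl L N, fun x => (hEv x _).symm⟩
  have : Q.v ∘ inclusion hsub = e ∘ P.v := funext fun x => hEv x _
  rw [this, atp_embedding]

/-- The types over `D` realized in a presented model. -/
def typ (D : Set Ω) (P : K.Pres Ω lam) : Set (Σ n : ℕ, Set (Atom L (D ⊕ Fin n))) :=
  {τ | ∃ h : D ⊆ P.X, τ ∈ typesOver L (P.v ∘ inclusion h)}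

theorem typ_mono (D : Set Ω) : Monotone (typ D : K.Pres Ω lam → _) := by
  rintro P Q h _ ⟨hD, ⟨n, a⟩, rfl⟩
  obtain ⟨e, he⟩ := exists_embedding h
  refine ⟨hD.trans h.1, ⟨n, e ∘ a⟩, ?_⟩
  simp only [Sigma.mk.injEq, heq_eq_eq, true_and]
  rw [← atp_embedding e (Sum.elim (P.v ∘ inclusion hD) a), Sum.comp_elim]
  congr 2
  funext x
  exact (he (inclusion hD x)).symm

end Pres

end LocalClass

namespace LocalClass
variable {K : LocalClass L}

namespace Pres

variable {Ω : Type u} {lam : Cardinal.{u}}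

theorem exists_typ_of_not_eCat (hΩ : lam < #Ω) (hls : ls L ≤ lam) {D : Set Ω}
    {P : K.Pres Ω lam} (hD : D ⊆ P.X) (h : ¬ K.ECat (P.v ∘ inclusion hD)) :
    ∃ Q ≥ P, ∃ τ ∈ typ D Q, τ ∉ typ D P := by
  have hω := aleph0_le_ls.trans hls
  simp only [ECat, not_forall] at h
  obtain ⟨N, _, hN, e, n, a, ha⟩ := h
  obtain ⟨M, hM, hMc⟩ := exists_substructure_card (range e ∪ range a) hls (by
      refine (mk_union_le _ _).trans (add_le_of_le hω (mk_range_le.trans P.mk_A.le) ?_)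
      exact (lt_aleph0_of_finite _).le.trans hω)
    (by rw [← P.mk_A]; exact mk_le_of_injective e.injective)
  obtain ⟨e', he'⟩ := P.gen.exists_embedding
    (w := fun x => (⟨e (P.v x), hM (Or.inl ⟨_, rfl⟩)⟩ : M)) (by
      rw [← atp_embedding e, ← atp_embedding M.subtype]
      rfl)
  let a' : Fin n → M := fun k => ⟨a k, hM (Or.inr ⟨k, rfl⟩)⟩
  obtain ⟨Q, hQ, i, hi⟩ := exists_extension hω hΩ P (mem_substructure hN M) hMc e'
  refine ⟨Q, hQ, ⟨n, atp L (Sum.elim (e ∘ P.v ∘ inclusion hD) a)⟩, ⟨hD.trans hQ.1,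
    ⟨n, i ∘ a'⟩, ?_⟩, ?_⟩
  · simp only [Sigma.mk.injEq, heq_eq_eq, true_and]
    have : (Q.v ∘ inclusion (hD.trans hQ.1)) = i.toEmbedding ∘ e' ∘ P.v ∘ inclusion hD :=
      funext fun x => (hi (inclusion hD x)).symm
    rw [this]
    have h2 : M.subtype ∘ (Sum.elim (e' ∘ P.v ∘ inclusion hD) a') =
        Sum.elim (e ∘ P.v ∘ inclusion hD) a := by
      rw [Sum.comp_elim]
      congr 1
      funext x
      exact congrArg Subtype.val (he' (inclusion hD x))
    rw [← h2, atp_embedding, ← atp_embedding i.toEmbedding, Sum.comp_elim]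
    rfl
  · rintro ⟨_, ⟨n', b⟩, hb⟩
    simp only [Sigma.mk.injEq] at hb
    obtain ⟨rfl, hb⟩ := hb
    exact ha ⟨b, (eq_of_heq hb).symm⟩

theorem exists_eCat (ha : K.Arb) (hc : K.Cat lam) (hΩ : lam < #Ω) {ρ : Cardinal.{u}}
    (hρ : ls L ≤ ρ) (hρl : ρ < lam) {D : Set Ω} (hDρ : #D ≤ ρ) (P : K.Pres Ω lam)
    (hD : D ⊆ P.X) : ∃ Q ≥ P, ∃ h : D ⊆ Q.X, K.ECat (Q.v ∘ inclusion h) := by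
  by_contra! hcon
  have hls := hρ.trans hρl.le
  have hω := aleph0_le_ls.trans hls
  let W := (Order.succ ρ).ord.ToType
  have hW : #W = Order.succ ρ := mk_ord_toType _
  have hWl : #W ≤ lam := hW.trans_le (Order.succ_le_of_lt hρl)
  let X := {Q : K.Pres Ω lam // P ≤ Q}
  obtain ⟨f, hf, hfn⟩ := exists_chain (X := X) (ι := W)
    (fun i g x => ∃ τ ∈ typ D x.1, ∀ j, τ ∉ typ D (g j).1) (by
      intro i g hg
      obtain ⟨U, hPU, hU⟩ := exists_upper P (fun j => (g j).1) hg (fun j => (g j).2) hω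
        ((mk_set_le _).trans hWl)
      obtain ⟨Q, hQ, τ, hτ, hτ'⟩ := exists_typ_of_not_eCat hΩ hls (hD.trans hPU.1) (hcon U hPU _)
      exact ⟨⟨Q, hPU.trans hQ⟩, fun j => (hU j).trans hQ, τ, hτ,
        fun j hj => hτ' (typ_mono D (hU j) hj)⟩)
  choose τ hτ hτ' using hfn
  obtain ⟨U, hPU, hU⟩ := exists_upper P (fun j => (f j).1) hf (fun j => (f j).2) hω hWl
  have hst := hc.stab ha hls U.mem U.mk_A hρ _ (U.v ∘ inclusion (hD.trans hPU.1)) hDρ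
  have hne : ∀ i j, i < j → τ i ≠ τ j := fun i j hij h => hτ' j ⟨i, hij⟩ (h ▸ hτ i)
  have hinj : Function.Injective τ := by
    intro i j hij
    rcases lt_trichotomy i j with h | h | h
    · exact absurd hij (hne _ _ h)
    · exact h
    · exact absurd hij.symm (hne _ _ h)
  have hmem : ∀ i, τ i ∈ typesOver L (U.v ∘ inclusion (hD.trans hPU.1)) := fun i => by
    obtain ⟨_, h⟩ := typ_mono D (hU i) (hτ i)
    exact h
  have : #W ≤ ρ := (mk_le_of_injective (f := fun i => (⟨τ i, hmem i⟩ : typesOver L _))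
    fun i j h => hinj (Subtype.ext_iff.1 h)).trans hst
  rw [hW] at this
  exact (Order.lt_succ ρ).not_ge this

end Pres

theorem Cat.exists_eCat {lam : Cardinal.{u}} (ha : K.Arb) (hc : K.Cat lam) (hl : ls L < lam) :
    ∃ (A : Type u) (_ : L.Structure A), K.Mem A ∧ #A = lam ∧
      ∀ (δ : Type u) (d : δ → A), #δ < lam.ord.cof → K.ECat d := by
  have hω := aleph0_le_ls.trans hl.le
  let Ω := (Order.succ lam).ord.ToType
  have hΩ : lam < #Ω := by rw [mk_ord_toType]; exact Order.lt_succ lam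
  let W := lam.ord.ToType
  have hW : #W = lam := mk_ord_toType _
  obtain ⟨P⟩ : Nonempty (K.Pres Ω lam) := by
    obtain ⟨B, _, hB, hBc⟩ := hc.1
    obtain ⟨X, hX⟩ := le_mk_iff_exists_set.1 hΩ.le
    obtain ⟨E⟩ := Cardinal.eq.1 (hX.trans hBc.symm)
    exact ⟨⟨X, hX, B, E, hB, E.bijective⟩⟩
  have hen : ∀ Q : K.Pres Ω lam, ∃ e : W → Q.X, Function.Surjective e := fun Q => by
    obtain ⟨E⟩ := Cardinal.eq.1 (hW.trans Q.card.symm)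
    exact ⟨E, E.surjective⟩
  choose en hen using hen
  let D : ∀ i : W, (Iio i → K.Pres Ω lam) → Set Ω := fun i g =>
    range fun p : Iio i × Iio i => (en (g p.1) p.2 : Ω)
  obtain ⟨f, hf, hfn⟩ := exists_chain (X := {Q : K.Pres Ω lam // P ≤ Q}) (ι := W)
    (fun i g x => ∃ h : D i (fun j => (g j).1) ⊆ x.1.X, K.ECat (x.1.v ∘ inclusion h)) (by
      intro i g hg
      obtain ⟨U, hPU, hU⟩ := Pres.exists_upper P (fun j => (g j).1) hg (fun j => (g j).2) hω
        ((mk_set_le _).trans hW.le)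
      have hi : #(Iio i) < lam := mk_Iio_ord_lt i
      have hρ : max (ls L) #(Iio i) < lam := max_lt hl hi
      obtain ⟨Q, hQ, h⟩ := Pres.exists_eCat ha hc hΩ (le_max_left _ _) hρ
        (D := D i fun j => (g j).1) (by
          refine mk_range_le.trans ?_
          rw [mk_prod, lift_id]
          exact mul_le_of_le (aleph0_le_ls.trans (le_max_left _ _)) (le_max_right _ _)
            (le_max_right _ _)) U (by
          rintro _ ⟨p, rfl⟩
          exact (hU p.1).1 (en (g p.1).1 p.2).2)
      exact ⟨⟨Q, hPU.trans hQ⟩, fun j => (hU j).trans hQ, h⟩)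
  have : Nonempty W := mk_ne_zero_iff.1 (by rw [hW]; exact (aleph0_pos.trans_le hω).ne')
  obtain ⟨U, hU, hUX⟩ := Pres.exists_union (fun i => (f i).1) hf hω hW.le
  refine ⟨U.A, _, U.mem, U.mk_A, fun δ d hδ => ?_⟩
  have h1 : ∀ x, ∃ (i j : W) (h : (en (f i).1 j : Ω) ∈ U.X), U.v ⟨en (f i).1 j, h⟩ = d x := by
    intro x
    obtain ⟨y, hy⟩ := U.bij.2 (d x)
    obtain ⟨i, hi⟩ := mem_iUnion.1 (hUX.subset y.2)
    obtain ⟨j, hj⟩ := hen (f i).1 ⟨y, hi⟩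
    refine ⟨i, j, ?_, ?_⟩
    · rw [hj]; exact y.2
    · rw [← hy]
      congr 1
      have h : (en (f i).1 j : Ω) = y := congrArg Subtype.val hj
      exact Subtype.ext h
  choose i j hij hd using h1
  have hsup : ∃ a : W, ∀ x, i x < a ∧ j x < a := by
    by_contra! hno
    have hcof : IsCofinal (range fun x => max (i x) (j x)) := by
      intro a
      obtain ⟨x, hx⟩ := hno a
      refine ⟨_, ⟨x, rfl⟩, ?_⟩
      by_cases h : i x < a
      · exact (hx h).trans (le_max_right _ _)
      · exact (not_lt.1 h).trans (le_max_left _ _)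
    have := (Order.cof_le hcof).trans mk_range_le
    rw [Ordinal.cof_toType] at this
    exact this.not_gt hδ
  obtain ⟨a, haa⟩ := hsup
  obtain ⟨hD, hE⟩ := hfn a
  obtain ⟨e, he⟩ := Pres.exists_embedding (hU a)
  let F : δ → D a fun j => (f j).1 := fun x => ⟨en (f (i x)).1 (j x),
    ⟨(⟨i x, (haa x).1⟩, ⟨j x, (haa x).2⟩), rfl⟩⟩
  have := (hE.map e).comp F
  convert this using 1
  funext x
  rw [← hd x]
  exact (he (inclusion hD (F x))).symm

/-- Over few parameters, large members realize every type realized in an extension. -/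
theorem Cat.eCat {lam : Cardinal.{u}} (ha : K.Arb) (hc : K.Cat lam) (hl : ls L < lam)
    {M : Type u} [L.Structure M] (hM : K.Mem M) (hcard : lam ≤ #M) {δ : Type u} (d : δ → M)
    (hδ : #δ < lam.ord.cof) : K.ECat d := by
  obtain ⟨A, _, hA, hAc, h⟩ := hc.exists_eCat ha hl
  obtain ⟨S, hS, hSc⟩ := exists_substructure_card (range d) hl.le
    (mk_range_le.trans (hδ.le.trans (Ordinal.cof_ord_le lam))) hcard
  obtain ⟨g⟩ := hc.2 A S hA (mem_substructure hM S) hAc hSc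
  have h1 := (h δ (fun x => g.symm ⟨d x, hS ⟨x, rfl⟩⟩) hδ).map
    (S.subtype.comp g.toEmbedding)
  convert h1 using 1
  funext x
  simp

end LocalClass

namespace LocalClass
variable {K : LocalClass L}

variable (K) in
/-- Members of size at least `lam` realize all types over `ζ` parameters and have no order property
of length `ζ`. -/
structure Base (ζ lam : Cardinal.{u}) : Prop where
  ls_le : ls L ≤ lam
  aleph : ℵ₀ ≤ ζ
  le : ζ ≤ lam
  ec : ∀ (M : Type u) [L.Structure M], K.Mem M → lam ≤ #M → ∀ (δ : Type u) (d : δ → M), #δ ≤ ζ →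
    K.ECat d
  nop : ∀ (A : Type u) [L.Structure A], K.Mem A → lam ≤ #A →
    ∀ (p : ℕ) (b : ζ.ord.ToType → Fin p → A) (m m' : ζ.ord.ToType → ℕ → A), ¬ OrderProp L b m m'

variable {ζ lam : Cardinal.{u}}

theorem Base.exists_nonsplitting_nat (hB : K.Base ζ lam) {M N : Type u} [L.Structure M]
    [L.Structure N] (hM : K.Mem M) (hN : K.Mem N) (hc : lam ≤ #M) (e : M ↪[L] N) {p : ℕ}
    (a : Fin p → N) : ∃ C : Set M, #C ≤ ζ ∧ ∀ m m' : ℕ → M,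
      atp L (Sum.elim (fun x : C => (x : M)) m) = atp L (Sum.elim (fun x : C => (x : M)) m') →
      atp L (Sum.elim a (e ∘ m)) = atp L (Sum.elim a (e ∘ m')) := by
  by_contra! hcon
  let W := ζ.ord.ToType
  let X := (Fin p → M) × (ℕ → M) × (ℕ → M)
  let fam : ∀ i : W, (Iio i → X) → Iio i × (Fin p ⊕ (ℕ ⊕ ℕ)) → M := fun i g z =>
    Sum.elim (g z.1).1 (Sum.elim (g z.1).2.1 (g z.1).2.2) z.2
  have hcf : #(Fin p ⊕ (ℕ ⊕ ℕ)) ≤ ℵ₀ := mk_le_aleph0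
  have hfam : ∀ i : W, #(Iio i × (Fin p ⊕ (ℕ ⊕ ℕ))) ≤ ζ := fun i => by
    rw [mk_prod, lift_uzero]
    exact mul_le_of_le hB.aleph (mk_Iio_ord_lt i).le ((lift_le_aleph0.2 hcf).trans hB.aleph)
  obtain ⟨f, hf⟩ := exists_rec (ι := W) (X := X) (fun i g x =>
    atp L (Sum.elim (e ∘ fam i g) a) = atp L (Sum.elim (fam i g) x.1) ∧
    atp L (Sum.elim (Sum.elim (fam i g) x.1) x.2.1) =
      atp L (Sum.elim (Sum.elim (fam i g) x.1) x.2.2) ∧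
    atp L (Sum.elim a (e ∘ x.2.1)) ≠ atp L (Sum.elim a (e ∘ x.2.2))) (by
      intro i g
      obtain ⟨b, hb⟩ := hB.ec M hM hc _ (fam i g) (hfam i) N hN e p a
      obtain ⟨m, m', hm, hne⟩ := hcon (range (fam i g) ∪ range b) (by
        refine (mk_union_le _ _).trans (add_le_of_le hB.aleph (mk_range_le.trans (hfam i)) ?_)
        exact (lt_aleph0_of_finite _).le.trans hB.aleph)
      refine ⟨(b, m, m'), hb, ?_, hne⟩
      exact atp_comp hm (Sum.map (Sum.elim (fun z => ⟨fam i g z, Or.inl ⟨z, rfl⟩⟩)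
        fun k => ⟨b k, Or.inr ⟨k, rfl⟩⟩) id) |> fun h => by
          rw [Sum.elim_comp_map, Sum.elim_comp_map, Sum.comp_elim] at h
          exact h)
  refine hB.nop M hM hc p (fun i => (f i).1) (fun i => (f i).2.1) (fun i => (f i).2.2) ?_
  intro i j
  constructor
  · intro hij
    obtain ⟨-, h, -⟩ := hf j
    rcases hij.lt_or_eq with hlt | rfl
    · exact atp_comp h (Sum.map (fun k => Sum.inl (⟨i, hlt⟩, Sum.inl k)) id) |> fun h => by
        rw [Sum.elim_comp_map, Sum.elim_comp_map] at h
        exact h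
    · exact atp_comp h (Sum.map Sum.inr id) |> fun h => by
        rw [Sum.elim_comp_map, Sum.elim_comp_map] at h
        exact h
  · intro h
    by_contra hij
    have hlt : j < i := not_le.1 hij
    obtain ⟨h1, -, -⟩ := hf i
    obtain ⟨-, -, h2⟩ := hf j
    have e1 := atp_comp h1 (Sum.elim Sum.inr fun k => Sum.inl (⟨j, hlt⟩, Sum.inr (Sum.inl k)))
    have e2 := atp_comp h1 (Sum.elim Sum.inr fun k => Sum.inl (⟨j, hlt⟩, Sum.inr (Sum.inr k)))
    rw [Sum.comp_elim, Sum.comp_elim] at e1 e2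
    exact h2 (e1.trans (h.trans e2.symm))

/-- Types of finite tuples over large members do not split over few parameters. -/
theorem Base.exists_nonsplitting (hB : K.Base ζ lam) {M N : Type u} [L.Structure M]
    [L.Structure N] (hM : K.Mem M) (hN : K.Mem N) (hc : lam ≤ #M) (e : M ↪[L] N)
    (F : Finset N) : ∃ C : Set M, #C ≤ ζ ∧ ∀ (ι : Type u) (m m' : ι → M),
      atp L (Sum.elim (fun x : C => (x : M)) m) = atp L (Sum.elim (fun x : C => (x : M)) m') →
      atp L (Sum.elim (fun x : F => (x : N)) (e ∘ m)) =
        atp L (Sum.elim (fun x : F => (x : N)) (e ∘ m')) := by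
  obtain ⟨C, hC, h⟩ := hB.exists_nonsplitting_nat hM hN hc e fun k => (F.equivFin.symm k : N)
  refine ⟨C, hC, fun ι m m' hm => atp_eq_of_forall_fin fun n f => ?_⟩
  rcases isEmpty_or_nonempty ι with hι | hι
  · rw [Subsingleton.elim m m']
  have hpad : ∃ g : Fin n → Fin F.card ⊕ ℕ, ∃ q : ℕ → ι, ∀ m : ι → M,
      Sum.elim (fun x : F => (x : N)) (e ∘ m) ∘ f =
        Sum.elim (fun k => (F.equivFin.symm k : N)) (e ∘ m ∘ q) ∘ g := by
    have : ∀ k : ℕ, ∃ x : ι, ∀ h : k < n, ∀ y, f ⟨k, h⟩ = Sum.inr y → x = y := by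
      intro k
      by_cases h : ∃ (h : k < n) (y : ι), f ⟨k, h⟩ = Sum.inr y
      · obtain ⟨h, y, hy⟩ := h
        exact ⟨y, fun _ z hz => Sum.inr_injective (hy.symm.trans hz)⟩
      · exact ⟨Classical.arbitrary ι, fun h' y hy => absurd ⟨h', y, hy⟩ h⟩
    choose q hq using this
    refine ⟨fun k => Sum.map F.equivFin (fun _ => (k : ℕ)) (f k), q,
      fun m => funext fun k => ?_⟩
    rcases hk : f k with x | x
    · simp [hk]
    · simp [hk, hq k k.2 x hk]
  obtain ⟨g, q, hg⟩ := hpad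
  rw [hg, hg]
  exact atp_comp (h _ _ (atp_comp hm (Sum.map id q) |> fun h => by
    rw [Sum.elim_comp_map, Sum.elim_comp_map] at h
    exact h)) g

/-- Amalgamation over large members. -/
theorem Base.exists_amalgam (hB : K.Base ζ lam) {M₀ M₁ M₂ : Type u} [L.Structure M₀]
    [L.Structure M₁] [L.Structure M₂] (h₀ : K.Mem M₀) (h₁ : K.Mem M₁) (h₂ : K.Mem M₂)
    (hc : lam ≤ #M₀) (e₁ : M₀ ↪[L] M₁) (e₂ : M₀ ↪[L] M₂) :
    ∃ (N : Type u) (_ : L.Structure N) (f₁ : M₁ ↪[L] N) (f₂ : M₂ ↪[L] N), K.Mem N ∧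
      ∀ m, f₁ (e₁ m) = f₂ (e₂ m) := by
  classical
  have : Nonempty M₀ := mk_ne_zero_iff.1
    ((aleph0_pos.trans_le (hB.aleph.trans (hB.le.trans hc))).ne')
  let Real : Set M₀ → Finset M₂ → (M₂ → M₀) → Prop := fun C F h =>
    atp L (Sum.elim (fun x : C => (x : M₀)) fun x : F => h x) =
      atp L (Sum.elim (fun x : C => e₂ x) fun x : F => (x : M₂))
  have hreal_mono : ∀ {C C' F F' h}, C ⊆ C' → F ⊆ F' → Real C' F' h → Real C F h := by
    intro C C' F F' h hC hF hr
    have := atp_comp hr (Sum.map (inclusion hC) fun x : F => (⟨x, hF x.2⟩ : F'))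
    rw [Sum.elim_comp_map, Sum.elim_comp_map] at this
    exact this
  have hreal : ∀ (C : Set M₀) (F : Finset M₂), #C ≤ ζ → ∃ h, Real C F h := by
    intro C F hC
    obtain ⟨a, ha⟩ := hB.ec M₀ h₀ hc C (fun x => x) hC M₂ h₂ e₂ F.card
      fun k => (F.equivFin.symm k : M₂)
    refine ⟨fun x => if h : x ∈ F then a (F.equivFin ⟨x, h⟩) else Classical.arbitrary M₀, ?_⟩
    have := atp_comp ha (Sum.map id F.equivFin)
    rw [Sum.elim_comp_map, Sum.elim_comp_map] at this
    convert this.symm using 2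
    · congr 1
      funext x
      simp
    · congr 1
      funext x
      simp
  choose C hC hns using fun F => hB.exists_nonsplitting h₀ h₁ hc e₁ F
  let S : Finset M₁ × Finset M₂ → Set (M₁ ⊕ M₂) := fun p => {x | Sum.elim (· ∈ p.1) (· ∈ p.2) x}
  have hS : Monotone S := by
    rintro p q h (x | x) hx
    · exact h.1 hx
    · exact h.2 hx
  let val : (M₂ → M₀) → M₁ ⊕ M₂ → M₁ := fun h => Sum.elim id (e₁ ∘ h)
  have hind : ∀ p h h', Real (C p.1) p.2 h → Real (C p.1) p.2 h' →
      atp L (fun i : S p => val h i) = atp L (fun i : S p => val h' i) := by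
    intro p h h' hr hr'
    have h1 := hns p.1 p.2 (fun x => h x) (fun x => h' x) (hr.trans hr'.symm)
    have hg : ∀ i : S p, ∃ j : p.1 ⊕ p.2, ∀ h, val h i =
        Sum.elim (fun x : p.1 => (x : M₁)) (e₁ ∘ fun x : p.2 => h x) j := by
      rintro ⟨x | x, hx⟩
      · exact ⟨Sum.inl ⟨x, hx⟩, fun h => rfl⟩
      · exact ⟨Sum.inr ⟨x, hx⟩, fun h => rfl⟩
    choose g hg using hg
    have h2 := atp_comp h1 g
    convert h2 using 2 <;> exact funext fun i => hg i _
  choose h hh using fun p : Finset M₁ × Finset M₂ => hreal (C p.1) p.2 (hC p.1)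
  have hW : ∀ p k, Real (C p.1) p.2 k → atp L (fun i : S p => val k i) =
    atp L (fun i : S p => val (h p) i) := fun p k hk => hind p k _ hk (hh p)
  obtain ⟨N, _, v, hN, hg, hv⟩ := K.exists_directed_model S hS (by
      rintro (x | x)
      · exact ⟨({x}, ∅), Finset.mem_singleton_self x⟩
      · exact ⟨(∅, {x}), Finset.mem_singleton_self x⟩)
    (fun p => atp L (fun i : S p => val (h p) i)) (fun p => ⟨_, _, _, h₁, rfl⟩) (by
      intro p q hpq
      obtain ⟨k, hk⟩ := hreal (C p.1 ∪ C q.1) q.2 ((mk_union_le _ _).trans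
        (add_le_of_le hB.aleph (hC _) (hC _)))
      rw [← hW q k (hreal_mono subset_union_right subset_rfl hk),
        ← hW p k (hreal_mono subset_union_left hpq.2 hk), ← atp_comp_eq_preimage]
      rfl)
  have hfin₁ : atp L (id : M₁ → M₁) = atp L (v ∘ Sum.inl) := by
    refine atp_eq_of_forall_fin fun n f => ?_
    let p : Finset M₁ × Finset M₂ := (Finset.univ.image f, ∅)
    have hm : ∀ k, f k ∈ Finset.univ.image f :=
      fun k => Finset.mem_image_of_mem f (Finset.mem_univ k)
    exact (atp_comp (hv p) fun k : Fin n => (⟨Sum.inl (f k), hm k⟩ : S p)).symm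
  have hfin₂ : atp L (id : M₂ → M₂) = atp L (v ∘ Sum.inr) := by
    refine atp_eq_of_forall_fin fun n f => ?_
    let p : Finset M₁ × Finset M₂ := (∅, Finset.univ.image f)
    have hm : ∀ k, f k ∈ Finset.univ.image f :=
      fun k => Finset.mem_image_of_mem f (Finset.mem_univ k)
    have h1 := (atp_comp (hv p) fun k : Fin n => (⟨Sum.inr (f k), hm k⟩ : S p)).symm
    refine Eq.trans ?_ h1
    have h2 := atp_comp (hh p) fun k : Fin n => Sum.inr (⟨f k, hm k⟩ : p.2)
    exact h2.symm.trans (atp_embedding e₁ _).symm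
  obtain ⟨f₁, hf₁⟩ := Gen.exists_embedding (v := (id : M₁ → M₁))
    (fun a => ⟨Language.var a, rfl⟩) hfin₁
  obtain ⟨f₂, hf₂⟩ := Gen.exists_embedding (v := (id : M₂ → M₂))
    (fun a => ⟨Language.var a, rfl⟩) hfin₂
  refine ⟨N, _, f₁, f₂, hN, fun m => ?_⟩
  let p : Finset M₁ × Finset M₂ := ({e₁ m}, {e₂ m})
  obtain ⟨k, hk⟩ := hreal (C p.1 ∪ {m}) p.2 ((mk_union_le _ _).trans
    (add_le_of_le hB.aleph (hC _) ((lt_aleph0_of_finite _).le.trans hB.aleph)))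
  have hkm : k (e₂ m) = m := ((apply_eq_iff_of_atp hk
    (Sum.inl ⟨m, Or.inr rfl⟩) (Sum.inr ⟨e₂ m, Finset.mem_singleton_self _⟩)).2 rfl).symm
  have h1 := (hv p).trans (hW p k (hreal_mono subset_union_left subset_rfl hk)).symm
  have h2 := (apply_eq_iff_of_atp h1 ⟨Sum.inl (e₁ m), Finset.mem_singleton_self _⟩
    ⟨Sum.inr (e₂ m), Finset.mem_singleton_self _⟩).2 (by simp [val, hkm])
  exact (hf₁ (e₁ m)).trans (h2.trans (hf₂ (e₂ m)).symm)

end LocalClass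

theorem Stab.exists_realizing {A : Type u} [L.Structure A] {ρ : Cardinal.{u}} (h : Stab L A ρ)
    (T : Set A) (hT : #T ≤ ρ) : ∃ Y : Set A, #Y ≤ ρ ∧ ∀ a, ∃ b ∈ Y,
      atp L (Sum.elim (fun x : T => (x : A)) fun _ : Unit => b) =
        atp L (Sum.elim (fun x : T => (x : A)) fun _ : Unit => a) := by
  let τ : A → typesOver L (fun x : T => (x : A)) := fun a => ⟨_, ⟨⟨1, fun _ => a⟩, rfl⟩⟩
  choose r hr using fun p : range τ => p.2
  refine ⟨range r, mk_range_le.trans ((mk_set_le _).trans (h T _ hT)),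
    fun a => ⟨_, ⟨⟨τ a, a, rfl⟩, rfl⟩, ?_⟩⟩
  have h1 : τ (r ⟨τ a, a, rfl⟩) = τ a := hr _
  have h2 := eq_of_heq (Sigma.mk.inj_iff.1 (congrArg Subtype.val h1)).2
  have h3 := atp_comp h2 (Sum.map id fun _ : Unit => (0 : Fin 1))
  rw [Sum.elim_comp_map, Sum.elim_comp_map] at h3
  exact h3

/-- A sequence of realizations of a type not splitting over `C` is indiscernible. -/
theorem indisc_of_nonsplitting {A : Type u} [L.Structure A] {M C : Set A} {x : A}
    {P : ℕ → Set A} (hP : Monotone P) (hPM : ∀ n, P n ⊆ M) {a : ℕ → A} (ha : ∀ n, a n ∈ P (n + 1))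
    (htp : ∀ n, atp L (Sum.elim (fun z : P n => (z : A)) fun _ : Unit => a n) =
      atp L (Sum.elim (fun z : P n => (z : A)) fun _ : Unit => x))
    (hC : C ⊆ P 0)
    (hns : ∀ (ι : Type u) (m m' : ι → A), (∀ i, m i ∈ M) → (∀ i, m' i ∈ M) →
      atp L (Sum.elim (fun z : C => (z : A)) m) = atp L (Sum.elim (fun z : C => (z : A)) m') →
      atp L (Sum.elim (fun _ : Unit => x) m) = atp L (Sum.elim (fun _ : Unit => x) m')) :
    Indisc L (fun z : P 0 => (z : A)) fun n (_ : Unit) => a n := by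
  have haP : ∀ k n, k < n → a k ∈ P n := fun k n h => hP h (ha k)
  have key : ∀ (n : ℕ) (s t : Fin n → ℕ), StrictMono s → StrictMono t →
      atp L (Sum.elim (fun z : P 0 => (z : A)) (a ∘ s)) =
        atp L (Sum.elim (fun z : P 0 => (z : A)) (a ∘ t)) := by
    intro n
    induction n with
    | zero => intro s t _ _; rw [Subsingleton.elim s t]
    | succ n ih =>
      intro s t hs ht
      have hc : StrictMono (Fin.castSucc : Fin n → Fin (n + 1)) := Fin.strictMono_castSucc
      have h1 := ih _ _ (hs.comp hc) (ht.comp hc)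
      let m : (Fin (n + 1) → ℕ) → P 0 ⊕ Fin n → A := fun s =>
        Sum.elim (fun z : P 0 => (z : A)) (a ∘ s ∘ Fin.castSucc)
      have hmem : ∀ s : Fin (n + 1) → ℕ, StrictMono s → ∀ i, m s i ∈ P (s (Fin.last n)) := by
        rintro s hs (i | i)
        · exact hP (Nat.zero_le _) i.2
        · exact haP _ _ (hs (Fin.castSucc_lt_last i))
      have h2 : atp L (Sum.elim (fun _ : Unit => x) (m s)) =
          atp L (Sum.elim (fun _ : Unit => x) (m t)) := by
        refine hns _ _ _ (fun i => hPM _ (hmem s hs i)) (fun i => hPM _ (hmem t ht i)) ?_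
        have := atp_comp h1 (Sum.elim (fun z : C => Sum.inl (⟨z, hC z.2⟩ : P 0)) id)
        rwa [Sum.comp_elim, Sum.comp_elim] at this
      have h3 : ∀ s : Fin (n + 1) → ℕ, StrictMono s →
          atp L (Sum.elim (fun _ : Unit => a (s (Fin.last n))) (m s)) =
            atp L (Sum.elim (fun _ : Unit => x) (m s)) := by
        intro s hs
        have := atp_comp (htp (s (Fin.last n)))
          (Sum.elim Sum.inr fun i => Sum.inl ⟨m s i, hmem s hs i⟩)
        rwa [Sum.comp_elim, Sum.comp_elim] at this
      have h4 := ((h3 s hs).trans h2).trans (h3 t ht).symm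
      have h5 := atp_comp h4 (Sum.elim (fun z => Sum.inr (Sum.inl z))
        (Fin.lastCases (Sum.inl ()) fun i => Sum.inr (Sum.inr i)))
      have h6 : ∀ s : Fin (n + 1) → ℕ, Sum.elim (fun _ : Unit => a (s (Fin.last n))) (m s) ∘
          (Sum.elim (fun z => Sum.inr (Sum.inl z))
            (Fin.lastCases (Sum.inl ()) fun i => Sum.inr (Sum.inr i))) =
          Sum.elim (fun z : P 0 => (z : A)) (a ∘ s) := by
        intro s
        funext i
        rcases i with i | i
        · rfl
        · induction i using Fin.lastCases with
          | last => simp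
          | cast i => simp [m]
      rwa [h6, h6] at h5
  exact fun n s t hs ht => atp_comp (key n s t hs ht) (Sum.map id Prod.fst) |> fun h => by
    rw [Sum.elim_comp_map, Sum.elim_comp_map] at h
    exact h

namespace LocalClass
variable {K : LocalClass L} {ζ lam : Cardinal.{u}}

/-- Over few parameters there is an indiscernible sequence. -/
theorem Base.exists_indisc_over (hB : K.Base ζ lam) (hζ : ζ < lam) {A : Type u} [L.Structure A]
    (hA : K.Mem A) {ρ : Cardinal.{u}} (hs : Stab L A ρ) (h₁ : lam ≤ ρ) (h₂ : ρ < #A) {δ : Type u}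
    (d : δ → A) (hδ : #δ ≤ ρ) :
    ∃ a : ℕ → A, Function.Injective a ∧ Indisc L d fun n (_ : Unit) => a n := by
  let W := (Order.succ ζ).ord.ToType
  have hω : ℵ₀ ≤ ρ := hB.aleph.trans (hB.le.trans h₁)
  have hW : #W ≤ ρ := by
    rw [mk_ord_toType]
    exact (Order.succ_le_of_lt hζ).trans h₁
  let X := {S : L.Substructure A // #S ≤ ρ}
  have hU : ∀ (V : Type u) (g : V → X), #V ≤ ρ → #(⋃ j, ((g j).1 : Set A) : Set A) ≤ ρ :=
    fun V g hV => (mk_iUnion_le _).trans (mul_le_of_le hω hV (ciSup_le' fun j => (g j).2))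
  obtain ⟨f, hf, hR⟩ := exists_chain (ι := W) (X := X) (fun i g x => range d ⊆ x.1 ∧
      lam ≤ #x.1 ∧ ∀ a, ∃ b ∈ x.1,
        atp L (Sum.elim (fun z : (⋃ j, ((g j).1 : Set A) : Set A) => (z : A)) fun _ : Unit => b) =
        atp L (Sum.elim (fun z : (⋃ j, ((g j).1 : Set A) : Set A) => (z : A)) fun _ : Unit => a))
    (by
      intro i g _
      have hi : #(Iio i) ≤ ρ := (mk_set_le _).trans hW
      obtain ⟨Y, hY, hYa⟩ := hs.exists_realizing _ (hU _ g hi)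
      obtain ⟨S, hS, hSc⟩ := exists_substructure_card (range d ∪ Y ∪ ⋃ j, ((g j).1 : Set A))
        (hB.ls_le.trans h₁) ((mk_union_le _ _).trans (add_le_of_le hω ((mk_union_le _ _).trans
          (add_le_of_le hω (mk_range_le.trans hδ) hY)) (hU _ g hi))) h₂.le
      refine ⟨⟨S, hSc.le⟩, fun j => ?_, ?_, hSc.symm ▸ h₁, fun a => ?_⟩
      · exact fun z hz => hS (Or.inr (mem_iUnion.2 ⟨j, hz⟩))
      · exact fun z hz => hS (Or.inl (Or.inl hz))
      · obtain ⟨b, hb, h⟩ := hYa a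
        exact ⟨b, hS (Or.inl (Or.inr hb)), h⟩)
  have hreg : Cardinal.IsRegular (Order.succ ζ) := isRegular_succ hB.aleph
  have : NoMaxOrder W := Cardinal.noMaxOrder hreg.aleph0_le
  have hne : Nonempty W := mk_ne_zero_iff.1 (by
    rw [mk_ord_toType]
    exact (aleph0_pos.trans_le hreg.aleph0_le).ne')
  let M : L.Substructure A := ⨆ i, (f i).1
  have hdir : Directed (· ≤ ·) fun i => (f i).1 :=
    Monotone.directed_le fun i j hij => hf hij
  have hM : ∀ z, z ∈ M ↔ ∃ i, z ∈ (f i).1 := fun z =>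
    Language.Substructure.mem_iSup_of_directed hdir
  have hfM : ∀ i, ((f i).1 : Set A) ⊆ M := fun i z hz => (hM z).2 ⟨i, hz⟩
  have hMc : lam ≤ #M := (hR hne.some).2.1.trans (mk_le_mk_of_subset (hfM _))
  obtain ⟨x, hx⟩ : ∃ x, x ∉ M := by
    by_contra! hall
    refine (hU W f hW).not_gt (h₂.trans_le ?_)
    rw [← mk_univ]
    exact mk_le_mk_of_subset fun z _ => mem_iUnion.2 ((hM z).1 (hall z))
  obtain ⟨C, hC, hns⟩ := hB.exists_nonsplitting (K.mem_substructure hA M) hA hMc M.subtype {x}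
  choose ind hind using fun c : C => (hM c.1).1 c.1.2
  obtain ⟨i₁, hi₁⟩ : ∃ i₁, ∀ c, ind c ≤ i₁ := by
    by_contra! hcon
    have hcof : IsCofinal (range ind) := fun i => by
      obtain ⟨c, hc⟩ := hcon i
      exact ⟨_, ⟨c, rfl⟩, hc.le⟩
    have := (Order.cof_le hcof).trans (mk_range_le.trans hC)
    rw [Ordinal.cof_toType, hreg.cof_ord] at this
    exact (Order.lt_succ ζ).not_ge this
  obtain ⟨i₂, hi₂⟩ := exists_gt i₁
  obtain ⟨j, hj, hj0⟩ := Nat.exists_strictMono' i₂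
  let P : ℕ → Set A := fun n => ⋃ k : Iio (j n), ((f k).1 : Set A)
  have hmemP : ∀ n i z, i < j n → z ∈ (f i).1 → z ∈ P n := fun n i z hi hz =>
    mem_iUnion.2 ⟨⟨i, hi⟩, hz⟩
  have hPmono : Monotone P := fun n n' hnn z hz => by
    obtain ⟨k, hk⟩ := mem_iUnion.1 hz
    exact hmemP n' k z (k.2.trans_le (hj.monotone hnn)) hk
  have hPM : ∀ n, P n ⊆ M := fun n => iUnion_subset fun k => hfM k
  choose a haf ha using fun n => (hR (j n)).2.2 x
  have haP : ∀ n, a n ∈ P (n + 1) := fun n => hmemP _ _ _ (hj n.lt_succ_self) (haf n)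
  have hi0 : i₁ < j 0 := hj0 ▸ hi₂
  have hind' := indisc_of_nonsplitting (M := M) (C := Subtype.val '' C) hPmono hPM haP ha (by
      rintro _ ⟨c, hc, rfl⟩
      exact hmemP 0 i₁ c hi0 (hf (hi₁ ⟨c, hc⟩) (hind ⟨c, hc⟩)))
    (by
      intro ι m m' hm hm' h
      have h1 := hns ι (fun i => ⟨m i, hm i⟩) (fun i => ⟨m' i, hm' i⟩) (by
        rw [← atp_embedding M.subtype, ← atp_embedding M.subtype (Sum.elim _ fun i => ⟨m' i, _⟩),
          Sum.comp_elim, Sum.comp_elim]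
        have := atp_comp h (Sum.map (fun c : C => (⟨c, c, c.2, rfl⟩ : Subtype.val '' C)) id)
        rw [Sum.elim_comp_map, Sum.elim_comp_map] at this
        exact this)
      have h2 := atp_comp h1 (Sum.map
        (fun _ : Unit => (⟨x, Finset.mem_singleton_self x⟩ : ({x} : Finset A))) id)
      rw [Sum.elim_comp_map, Sum.elim_comp_map] at h2
      exact h2)
  refine ⟨a, ?_, fun n s t hs ht => ?_⟩
  · have hlt : ∀ k n, k < n → a k ≠ a n := by
      intro k n hkn h
      have hk : a k ∈ P n := hPmono hkn (haP k)
      have : a k = x := (apply_eq_iff_of_atp (ha n) (Sum.inl ⟨a k, hk⟩) (Sum.inr ())).1 h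
      exact hx (this ▸ hPM n hk)
    intro k n h
    rcases lt_trichotomy k n with hkn | hkn | hkn
    · exact absurd h (hlt _ _ hkn)
    · exact hkn
    · exact absurd h.symm (hlt _ _ hkn)
  · have := atp_comp (hind' n s t hs ht)
      (Sum.map (fun z => ⟨d z, hmemP 0 i₁ _ hi0 ((hR i₁).1 ⟨z, rfl⟩)⟩) id)
    rw [Sum.elim_comp_map, Sum.elim_comp_map] at this
    exact this

end LocalClass

/-- Types realized in a stretched structure are realized in the original one. -/
theorem exists_realize_of_stretch {A B D J κ : Type*} [L.Structure A] [L.Structure B]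
    [LinearOrder J] {d : D → A} {d' : D → B} {c : ℕ → κ → A} {c' : J → κ → B}
    (hg : Gen L (Sum.elim d' fun x : J × κ => c' x.1 x.2))
    (hcc : ∀ n (s : Fin n → J) (t : Fin n → ℕ), StrictMono s → StrictMono t →
      atp L (Sum.elim d' fun x : Fin n × κ => c' (s x.1) x.2) =
        atp L (Sum.elim d fun x : Fin n × κ => c (t x.1) x.2)) (b : B) :
    ∃ a, atp L (Sum.elim d' fun _ : Unit => b) = atp L (Sum.elim d fun _ : Unit => a) := by
  classical
  obtain ⟨m, w, s, hs⟩ := hg.exists_fin fun _ : Fin 1 => b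
  have hb := congrFun hs 0
  let F : Finset J := Finset.univ.biUnion fun x : Fin m => Sum.elim (fun _ => ∅) (fun y => {y.1}) (w x)
  let o := F.orderEmbOfFin rfl
  have hw : ∀ x, ∃ z : D ⊕ (Fin F.card × κ), Sum.map id (Prod.map o id) z = w x := by
    intro x
    rcases hx : w x with y | y
    · exact ⟨Sum.inl y, rfl⟩
    · have hy : y.1 ∈ F := Finset.mem_biUnion.2 ⟨x, Finset.mem_univ x, by
        rw [hx]
        exact Finset.mem_singleton_self _⟩
      obtain ⟨k, hk⟩ : y.1 ∈ range o := by
        rw [Finset.range_orderEmbOfFin]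
        exact hy
      exact ⟨Sum.inr (k, y.2), by simp [hk]⟩
  choose w' hw' using hw
  have h1 := hcc F.card o (fun k => k) o.strictMono fun _ _ h => h
  refine ⟨(s 0).realize (Sum.elim d (fun x : Fin F.card × κ => c x.1 x.2) ∘ w'), ?_⟩
  have h2 := atp_realize h1 (Sum.elim (fun z => Language.var (Sum.inl z))
    fun _ : Unit => (s 0).relabel w')
  convert h2 using 2
  · funext z
    rcases z with z | z
    · rfl
    · rw [Sum.elim_inr, Sum.elim_inr, Language.Term.realize_relabel, hb]
      congr 1
      funext x
      rw [Function.comp_apply, Function.comp_apply, ← hw']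
      rcases w' x with y | y <;> rfl
  · funext z
    rcases z with z | z
    · rfl
    · rw [Sum.elim_inr, Sum.elim_inr, Language.Term.realize_relabel]

theorem injective_of_stretch {A B D J : Type*} [L.Structure A] [L.Structure B]
    [LinearOrder J] {d : D → A} {d' : D → B} {c : ℕ → Unit → A} {c' : J → Unit → B}
    (hc : Function.Injective fun n => c n ())
    (hcc : ∀ n (s : Fin n → J) (t : Fin n → ℕ), StrictMono s → StrictMono t →
      atp L (Sum.elim d' fun x : Fin n × Unit => c' (s x.1) x.2) =
        atp L (Sum.elim d fun x : Fin n × Unit => c (t x.1) x.2)) :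
    Function.Injective fun j => c' j () := by
  have hinj : ∀ i j, i < j → c' i () ≠ c' j () := by
    intro i j hij h
    have h1 := hcc 2 ![i, j] (fun k => k) (by
      intro a b hab
      fin_cases a <;> fin_cases b <;> simp_all) (fun a b hab => hab)
    exact absurd (hc ((apply_eq_iff_of_atp h1 (Sum.inr (0, ())) (Sum.inr (1, ()))).1 h)) (by decide)
  intro i j hij
  rcases lt_trichotomy i j with h | h | h
  · exact absurd hij (hinj i j h)
  · exact h
  · exact absurd hij.symm (hinj j i h)

theorem gen_closure_range {G A : Type*} [L.Structure A] (v : G → A) :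
    Gen L fun i => (⟨v i, Language.Substructure.subset_closure ⟨i, rfl⟩⟩ :
      Language.Substructure.closure L (range v)) := by
  intro a
  obtain ⟨t, rfl⟩ := gen_closure (range v) a
  refine ⟨t.relabel fun x => x.2.choose, ?_⟩
  rw [Language.Term.realize_relabel]
  congr 1
  funext x
  exact Subtype.ext x.2.choose_spec

namespace LocalClass
variable {K : LocalClass L} {ζ lam : Cardinal.{u}}

variable (K) in
/-- A base whose threshold is a categoricity cardinal, in a class with categoricity cardinals of
unbounded cofinality. -/
structure Tail (ζ lam : Cardinal.{u}) : Prop extends K.Base ζ lam where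
  lt : ζ < lam
  ls_lt : ls L < lam
  cat : K.Cat lam
  unbounded : ∀ θ : Cardinal.{u}, ∃ c : Cardinal.{u}, θ ≤ c ∧ θ ≤ c.ord.cof ∧ K.Cat c

theorem arb_of_unbounded
    (h : ∀ θ : Cardinal.{u}, ∃ c : Cardinal.{u}, θ ≤ c ∧ θ ≤ c.ord.cof ∧ K.Cat c) : K.Arb := by
  intro μ
  obtain ⟨c, hμ, -, ⟨A, _, hA, rfl⟩, -⟩ := h μ
  exact ⟨A, _, hA, hμ⟩

theorem Tail.exists_embedding (hT : K.Tail ζ lam) {A : Type u} [L.Structure A] (hA : K.Mem A)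
    (hl : lam ≤ #A) {c : Cardinal.{u}} (hc : K.Cat c) (hAc : #A ≤ c) :
    ∃ (B : Type u) (_ : L.Structure B), K.Mem B ∧ #B = c ∧ Nonempty (A ↪[L] B) := by
  obtain ⟨M, _, hM, hMc⟩ := hc.1
  have hlc : lam ≤ c := hl.trans hAc
  have h0 : #(∅ : Set A) ≤ lam ∧ #(∅ : Set M) ≤ lam := by simp
  obtain ⟨S, -, hS⟩ := exists_substructure_card (∅ : Set A) hT.ls_le h0.1 hl
  obtain ⟨T, -, hTc⟩ := exists_substructure_card (∅ : Set M) hT.ls_le h0.2 (hMc.symm ▸ hlc)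
  obtain ⟨e⟩ := hT.cat.2 S T (K.mem_substructure hA S) (K.mem_substructure hM T) hS hTc
  obtain ⟨N, _, f₁, f₂, hN, -⟩ := hT.exists_amalgam (K.mem_substructure hA S) hA hM hS.ge S.subtype
    (T.subtype.comp e.toEmbedding)
  obtain ⟨B, hB, hBc⟩ := exists_substructure_card (range f₁) (hT.ls_le.trans hlc)
    (mk_range_le.trans hAc) (hMc ▸ mk_le_of_injective f₂.injective)
  exact ⟨B, _, K.mem_substructure hN B, hBc, ⟨f₁.codRestrict B fun a => hB ⟨a, rfl⟩⟩⟩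

theorem Tail.stab (hT : K.Tail ζ lam) {A : Type u} [L.Structure A] (hA : K.Mem A)
    (hl : lam ≤ #A) {ρ : Cardinal.{u}} (hρ : ls L ≤ ρ) : Stab L A ρ := by
  obtain ⟨c, hc, -, hcat⟩ := hT.unbounded #A
  obtain ⟨B, _, hB, hBc, ⟨e⟩⟩ := hT.exists_embedding hA hl hcat hc
  exact (hcat.stab (arb_of_unbounded hT.unbounded) (hT.ls_le.trans (hl.trans hc)) hB hBc
    hρ).of_embedding e

/-- Large members are saturated. -/
theorem Tail.exists_realize (hT : K.Tail ζ lam) {A B G : Type u} [L.Structure A] [L.Structure B]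
    (hA : K.Mem A) (hB : K.Mem B) {v : G → A} {w : G → B} (h : atp L v = atp L w)
    (hv : lam ≤ #(range v)) (hG : #G < #A) (b : B) :
    ∃ a, atp L (Sum.elim v fun _ : Unit => a) = atp L (Sum.elim w fun _ : Unit => b) := by
  have ha := arb_of_unbounded hT.unbounded
  let N₀ := Language.Substructure.closure L (range v)
  have hN₀ : K.Mem N₀ := K.mem_substructure hA N₀
  have hlN : lam ≤ #N₀ := hv.trans (mk_le_mk_of_subset Language.Substructure.subset_closure)
  have hNA : #N₀ < #A := (gen_closure_range v).mk_le.trans_lt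
    (max_lt (hT.ls_lt.trans_le (hv.trans (mk_range_le.trans hG.le))) hG)
  obtain ⟨a, hai, hind⟩ := hT.exists_indisc_over hT.lt hA (hT.stab hA (hlN.trans hNA.le)
    (hT.ls_le.trans hlN)) hlN hNA (fun z : N₀ => (z : A)) le_rfl
  obtain ⟨c, hc, hcof, hcat⟩ := hT.unbounded (Order.succ #N₀)
  have hNc : #N₀ < c := (Order.lt_succ _).trans_le hc
  obtain ⟨B', _, d', c', hB', hg, hcc⟩ := K.exists_stretch hA hind c.ord.ToType
  have hinj := injective_of_stretch (c := fun n (_ : Unit) => a n) hai hcc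
  have hcB : c ≤ #B' := by
    rw [← mk_ord_toType c]
    exact mk_le_of_injective hinj
  have hd : atp L (id : N₀ → N₀) = atp L d' := by
    have := atp_comp (hcc 0 Fin.elim0 Fin.elim0 (fun x => x.elim0) (fun x => x.elim0)) Sum.inl
    rw [Sum.elim_comp_inl, Sum.elim_comp_inl] at this
    rw [this]
    exact (atp_embedding N₀.subtype id).symm
  obtain ⟨g, hgd⟩ := Gen.exists_embedding (v := (id : N₀ → N₀)) (fun a => ⟨Language.var a, rfl⟩) hd
  obtain ⟨k, hk⟩ := (gen_closure_range v).exists_embedding (w := w) (by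
    rw [← h, ← atp_embedding N₀.subtype]
    rfl)
  obtain ⟨N, _, f₁, f₂, hN, hf⟩ := hT.exists_amalgam hN₀ hB' hB hlN g k
  obtain ⟨b', hb'⟩ := hcat.eCat ha (hT.ls_lt.trans (hlN.trans_lt hNc)) hB' hcB d'
    ((Order.lt_succ _).trans_le hcof) N hN f₁ 1 fun _ => f₂ b
  obtain ⟨x, hx⟩ := exists_realize_of_stretch (c := fun n (_ : Unit) => a n) hg hcc (b' 0)
  refine ⟨x, ?_⟩
  let ι : G → N₀ := fun i => ⟨v i, Language.Substructure.subset_closure ⟨i, rfl⟩⟩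
  have h1 := atp_comp hx (Sum.map ι id)
  have h2 := atp_comp hb' (Sum.map ι fun _ : Unit => (0 : Fin 1))
  rw [Sum.elim_comp_map, Sum.elim_comp_map] at h1 h2
  refine h1.symm.trans (h2.symm.trans ?_)
  rw [← atp_embedding f₂ (Sum.elim w _), Sum.comp_elim]
  congr 2
  funext i
  exact (congrArg f₁ (hgd (ι i)).symm).trans ((hf (ι i)).trans (congrArg f₂ (hk i)))

end LocalClass

/-- A relation preserving atomic formulas. -/
def Partial (L : FirstOrder.Language.{u, u}) {A B : Type*} [L.Structure A] [L.Structure B]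
    (G : Set (A × B)) : Prop :=
  atp L (fun x : G => x.1.1) = atp L (fun x : G => x.1.2)

theorem Partial.sUnion {A B : Type*} [L.Structure A] [L.Structure B] {𝒢 : Set (Set (A × B))}
    (hne : 𝒢.Nonempty) (hd : DirectedOn (· ⊆ ·) 𝒢) (h : ∀ G ∈ 𝒢, Partial L G) :
    Partial L (⋃₀ 𝒢) := by
  refine atp_eq_of_forall_fin fun n f => ?_
  obtain ⟨G, hG, hs⟩ := hd.exists_mem_subset_of_finite_of_subset_sUnion hne
    (s := range fun k => (f k : A × B)) (finite_range _) (by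
      rintro _ ⟨k, rfl⟩
      exact (f k).2)
  exact atp_comp (h G hG) fun k => (⟨f k, hs ⟨k, rfl⟩⟩ : G)

theorem Partial.swap {A B : Type*} [L.Structure A] [L.Structure B] {G : Set (A × B)}
    (h : Partial L G) : Partial L (Prod.swap ⁻¹' G) :=
  atp_comp h.symm fun x : Prod.swap ⁻¹' G => (⟨x.1.swap, x.2⟩ : G)

namespace LocalClass
variable {K : LocalClass L} {ζ lam : Cardinal.{u}}

theorem Tail.exists_partial_insert (hT : K.Tail ζ lam) {A B : Type u} [L.Structure A]
    [L.Structure B] (hA : K.Mem A) (hB : K.Mem B) {G : Set (A × B)} (hG : Partial L G)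
    (hl : lam ≤ #(Prod.fst '' G)) (hGA : #G < #A) (b : B) :
    ∃ a, Partial L (insert (a, b) G) := by
  obtain ⟨a, ha⟩ := hT.exists_realize hA hB hG (by
    refine hl.trans (mk_le_mk_of_subset ?_)
    rintro _ ⟨x, hx, rfl⟩
    exact ⟨⟨x, hx⟩, rfl⟩) hGA b
  refine ⟨a, ?_⟩
  have : ∀ x : (insert (a, b) G : Set (A × B)), ∃ y : G ⊕ Unit,
      Sum.elim (fun x : G => x.1) (fun _ => (a, b)) y = x := by
    rintro ⟨x, rfl | hx⟩
    · exact ⟨Sum.inr (), rfl⟩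
    · exact ⟨Sum.inl ⟨x, hx⟩, rfl⟩
  choose g hg using this
  have h1 := atp_comp ha g
  rw [Partial]
  convert h1 using 2
  · funext x
    rw [← hg x]
    rcases hx : g x with y | y <;> simp [hx]
  · funext x
    rw [← hg x]
    rcases hx : g x with y | y <;> simp [hx]

theorem Tail.nonempty_equiv (hT : K.Tail ζ lam) {A B : Type u} [L.Structure A]
    [L.Structure B] (hA : K.Mem A) (hB : K.Mem B) (hl : lam < #A) (hAB : #A = #B) :
    Nonempty (A ≃[L] B) := by
  have hω : ℵ₀ ≤ lam := aleph0_le_ls.trans hT.ls_le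
  obtain ⟨S, -, hS⟩ := exists_substructure_card (∅ : Set A) hT.ls_le (by simp) hl.le
  obtain ⟨T, -, hTc⟩ := exists_substructure_card (∅ : Set B) hT.ls_le (by simp) (hAB ▸ hl.le)
  obtain ⟨e⟩ := hT.cat.2 S T (K.mem_substructure hA S) (K.mem_substructure hB T) hS hTc
  let G₀ : Set (A × B) := range fun s : S => ((s : A), (e s : B))
  have hG₀ : Partial L G₀ := by
    choose g hg using fun x : G₀ => x.2
    have h1 : atp L (fun s : S => (s : A)) = atp L (fun s : S => (e s : B)) :=
      (atp_embedding S.subtype id).trans (atp_embedding (T.subtype.comp e.toEmbedding) id).symm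
    have h2 := atp_comp h1 g
    rw [Partial]
    convert h2 using 2
    · exact funext fun x => congrArg Prod.fst (hg x).symm
    · exact funext fun x => congrArg Prod.snd (hg x).symm
  have hG₀c : #G₀ ≤ lam := mk_range_le.trans hS.le
  have hfst : ∀ G, G₀ ⊆ G → lam ≤ #(Prod.fst '' G) := fun G h => by
    rw [← hS]
    exact mk_le_mk_of_subset fun s hs => ⟨_, h ⟨⟨s, hs⟩, rfl⟩, rfl⟩
  have hsnd : ∀ G, G₀ ⊆ G → lam ≤ #(Prod.fst '' (Prod.swap ⁻¹' G : Set (B × A))) := fun G h => by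
    rw [← hTc]
    refine mk_le_mk_of_subset fun t ht => ⟨(t, (e.symm ⟨t, ht⟩ : A)), h ⟨e.symm ⟨t, ht⟩, ?_⟩, rfl⟩
    simp
  let W := (#A).ord.ToType
  obtain ⟨α⟩ : Nonempty (W ≃ A) := Cardinal.eq.1 (mk_ord_toType _)
  obtain ⟨β⟩ : Nonempty (W ≃ B) := Cardinal.eq.1 ((mk_ord_toType _).trans hAB)
  let X := {G : Set (A × B) // G₀ ⊆ G ∧ Partial L G}
  have hU : ∀ (V : Set W) (g : V → X), Monotone g →
      Partial L (⋃₀ insert G₀ (range fun j => (g j).1)) := by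
    intro V g hg
    refine Partial.sUnion (insert_nonempty _ _) ?_ ?_
    · rintro _ (rfl | ⟨i, rfl⟩) _ (rfl | ⟨j, rfl⟩)
      · exact ⟨_, Or.inl rfl, subset_rfl, subset_rfl⟩
      · exact ⟨_, Or.inr ⟨j, rfl⟩, (g j).2.1, subset_rfl⟩
      · exact ⟨_, Or.inr ⟨i, rfl⟩, subset_rfl, (g i).2.1⟩
      · rcases le_total i j with h | h
        · exact ⟨_, Or.inr ⟨j, rfl⟩, hg h, subset_rfl⟩
        · exact ⟨_, Or.inr ⟨i, rfl⟩, subset_rfl, hg h⟩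
    · rintro _ (rfl | ⟨j, rfl⟩)
      · exact hG₀
      · exact (g j).2.2
  let κ : W → Cardinal.{u} := fun i => max #(Iio i) lam
  obtain ⟨f, hf, hR⟩ := exists_chain (ι := W) (X := X) (fun i g x =>
      (∀ j : Iio i, #(g j).1 ≤ κ j) → #x.1 ≤ κ i ∧ (∃ b, (α i, b) ∈ x.1) ∧ ∃ a, (a, β i) ∈ x.1)
    (by
      intro i g hg
      let U := ⋃₀ insert G₀ (range fun j => (g j).1)
      have hUp : Partial L U := hU _ g hg
      have h0U : G₀ ⊆ U := subset_sUnion_of_mem (mem_insert _ _)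
      have hgU : ∀ j, (g j).1 ⊆ U := fun j => subset_sUnion_of_mem (Or.inr ⟨j, rfl⟩)
      by_cases hb : ∀ j : Iio i, #(g j).1 ≤ κ j
      · have hκω : ℵ₀ ≤ κ i := hω.trans (le_max_right _ _)
        have hκA : κ i < #A := max_lt (mk_Iio_ord_lt i) hl
        have hUc : #U ≤ κ i := by
          have : U = G₀ ∪ ⋃ j, (g j).1 := by
            simp [U]
          rw [this]
          refine (mk_union_le _ _).trans (add_le_of_le hκω (hG₀c.trans (le_max_right _ _)) ?_)
          refine (mk_iUnion_le _).trans (mul_le_of_le hκω (le_max_left _ _) (ciSup_le' fun j => ?_))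
          exact (hb j).trans (max_le_max (mk_le_mk_of_subset (Iio_subset_Iio j.2.le)) le_rfl)
        obtain ⟨a, ha⟩ := hT.exists_partial_insert hA hB hUp (hfst U h0U) (hUc.trans_lt hκA) (β i)
        let U' := insert (a, β i) U
        have hU'c : #U' ≤ κ i := (mk_insert_le).trans
          (add_le_of_le hκω hUc (one_le_aleph0.trans hκω))
        have hUU' : U ⊆ U' := subset_insert _ _
        have hsw : #(Prod.swap ⁻¹' U' : Set (B × A)) ≤ κ i :=
          (mk_preimage_of_injective _ _ Prod.swap_injective).trans hU'c
        obtain ⟨b, hb'⟩ := hT.exists_partial_insert hB hA ha.swap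
          (hsnd U' (h0U.trans hUU')) (hsw.trans_lt (hAB ▸ hκA)) (α i)
        have hp := hb'.swap
        have hUe : Prod.swap ⁻¹' (insert (b, α i) (Prod.swap ⁻¹' U' : Set (B × A))) =
            insert (α i, b) U' := by
          ext ⟨x, y⟩
          simp [and_comm]
        rw [hUe] at hp
        have hsub : U ⊆ insert (α i, b) U' := hUU'.trans (subset_insert _ _)
        refine ⟨⟨insert (α i, b) U', h0U.trans hsub, hp⟩, fun j => (hgU j).trans hsub,
          fun _ => ⟨?_, ⟨b, mem_insert _ _⟩, a, Or.inr (mem_insert _ _)⟩⟩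
        exact (mk_insert_le).trans (add_le_of_le hκω hU'c (one_le_aleph0.trans hκω))
      · exact ⟨⟨U, h0U, hUp⟩, hgU, fun h => absurd h hb⟩)
  have hsize : ∀ i, #(f i).1 ≤ κ i := by
    intro i
    induction i using WellFoundedLT.induction with
    | ind i ih => exact (hR i fun j => ih j j.2).1
  have hG := hU univ (fun i => f i) fun i j hij => hf hij
  have hsub : ∀ i, (f i).1 ⊆ ⋃₀ insert G₀ (range fun j : (univ : Set W) => (f j).1) :=
    fun i => subset_sUnion_of_mem (Or.inr ⟨⟨i, trivial⟩, rfl⟩)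
  obtain ⟨e, -⟩ := Gen.exists_equiv (fun a => by
      obtain ⟨b, hb⟩ := (hR (α.symm a) fun j => hsize j).2.1
      rw [α.apply_symm_apply] at hb
      exact ⟨Language.var ⟨_, hsub _ hb⟩, rfl⟩) (fun b => by
      obtain ⟨a, ha⟩ := (hR (β.symm b) fun j => hsize j).2.2
      rw [β.apply_symm_apply] at ha
      exact ⟨Language.var ⟨_, hsub _ ha⟩, rfl⟩) hG
  exact ⟨e⟩

theorem Tail.cat_of_lt (hT : K.Tail ζ lam) {c : Cardinal.{u}} (hc : lam < c) : K.Cat c := by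
  refine ⟨?_, fun A B _ _ hA hB hAc hBc => hT.nonempty_equiv hA hB (hAc.symm ▸ hc)
    (hAc.trans hBc.symm)⟩
  obtain ⟨A, _, e, hA, hi, hg, -⟩ := K.exists_em (arb_of_unbounded hT.unbounded) c.ord.ToType
  have hJ : #c.ord.ToType = c := mk_ord_toType c
  exact ⟨A, _, hA, (mk_em hi hg (hJ.symm ▸ hT.ls_le.trans hc.le)).trans hJ⟩

theorem exists_tail (h : ∀ θ : Cardinal.{u}, ∃ c : Cardinal.{u}, θ ≤ c ∧ θ ≤ c.ord.cof ∧ K.Cat c) :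
    ∃ ζ lam, K.Tail ζ lam := by
  have ha := arb_of_unbounded h
  obtain ⟨ζ₀, hζ₀⟩ := K.exists_no_orderProp ha
  let ζ := max ζ₀ ℵ₀
  obtain ⟨lam, hl, hcof, hcat⟩ := h (Order.succ (max ζ (2 ^ ls L)))
  have h1 : ζ < lam := (le_max_left _ _).trans_lt ((Order.lt_succ _).trans_le hl)
  have h2 : 2 ^ ls L < lam := (le_max_right _ _).trans_lt ((Order.lt_succ _).trans_le hl)
  have h3 : ζ < lam.ord.cof := (le_max_left _ _).trans_lt ((Order.lt_succ _).trans_le hcof)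
  have h4 : ls L < lam := (cantor _).trans h2
  exact ⟨ζ, lam, {
    ls_le := h4.le
    aleph := le_max_right _ _
    le := h1.le
    ec := fun M _ hM hc δ d hδ => hcat.eCat ha h4 hM hc d (hδ.trans_lt h3)
    nop := fun A _ hA hc p => hζ₀ ζ lam (le_max_left _ _) hcat h2.le h1.le A hA hc p
    lt := h1
    ls_lt := h4
    cat := hcat
    unbounded := h }⟩

/-- Categoricity in cardinals of unbounded cofinality implies categoricity on a tail. -/
theorem exists_cat_tail
    (h : ∀ θ : Cardinal.{u}, ∃ c : Cardinal.{u}, θ ≤ c ∧ θ ≤ c.ord.cof ∧ K.Cat c) :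
    ∃ μ : Cardinal.{u}, ls L ≤ μ ∧ ∀ c, μ ≤ c → K.Cat c := by
  obtain ⟨ζ, lam, hT⟩ := exists_tail h
  exact ⟨Order.succ lam, hT.ls_le.trans (Order.le_succ _),
    fun c hc => hT.cat_of_lt ((Order.lt_succ _).trans_le hc)⟩

end LocalClass

section Models

variable {A : Type w} [L.Structure A]

/-- The copy of a structure along an injection into the ordinals. -/
def Model.ofInj {f : A → Ordinal.{u}} (hf : Function.Injective f) : Model L where
  carrier := range f
  struc := (Equiv.ofInjective f hf).inducedStructure

def Model.ofInjEquiv {f : A → Ordinal.{u}} (hf : Function.Injective f) :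
    A ≃[L] (Model.ofInj (L := L) hf).U :=
  (Equiv.ofInjective f hf).inducedStructureEquiv

theorem Model.ofInj_isSub {f : A → Ordinal.{u}} (hf : Function.Injective f) {N : Model L}
    (g : A ↪[L] N.U) (hg : ∀ a, (g a : Ordinal.{u}) = f a) : (Model.ofInj (L := L) hf).IsSub N := by
  refine ⟨?_, g.comp (Model.ofInjEquiv hf).symm.toEmbedding, fun x => ?_⟩
  · rintro _ ⟨a, rfl⟩
    rw [← hg a]
    exact (g a).2
  · obtain ⟨a, rfl⟩ := (Model.ofInjEquiv (L := L) hf).surjective x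
    refine Eq.trans ?_ (hg a)
    simp

end Models

theorem exists_injective_ordinal (A : Type u) : ∃ f : A → Ordinal.{u}, Function.Injective f :=
  ⟨_, Ordinal.typein_injective (WellOrderingRel : A → A → Prop)⟩

namespace UniversalClass

variable (K : UniversalClass L)

/-- Being isomorphic to a member of `K`. -/
def IsoMem (A : Type w) [L.Structure A] : Prop :=
  ∃ M, K.Mem M ∧ Nonempty (A ≃[L] M.U)

variable {K}

theorem IsoMem.mem_of_equiv {A : Type w} [L.Structure A] (h : K.IsoMem A) {M : Model L}
    (e : A ≃[L] M.U) : K.Mem M := by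
  obtain ⟨N, hN, ⟨f⟩⟩ := h
  exact K.iso_closed hN ⟨e.comp f.symm⟩

theorem IsoMem.of_embedding {A : Type v} {B : Type w} [L.Structure A] [L.Structure B]
    (h : K.IsoMem B) (g : A ↪[L] B) : K.IsoMem A := by
  obtain ⟨M, hM, ⟨e⟩⟩ := h
  have hf : Function.Injective fun a => (e (g a) : Ordinal.{u}) :=
    Subtype.val_injective.comp (e.injective.comp g.injective)
  exact ⟨_, K.sub_closed hM (Model.ofInj_isSub hf (e.toEmbedding.comp g) fun _ => rfl),
    ⟨Model.ofInjEquiv hf⟩⟩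

/-- Closure of `K` under directed unions of finitely generated substructures. -/
theorem isoMem_closure {A : Type u} [L.Structure A]
    (h : ∀ (n : ℕ) (v : Fin n → A), ∃ (B : Type u) (_ : L.Structure B) (w : Fin n → B),
      K.IsoMem B ∧ atp L v = atp L w) (T : Set A) :
    K.IsoMem (Language.Substructure.closure L T) := by
  obtain ⟨f, hf⟩ := exists_injective_ordinal A
  have hfS : ∀ S : L.Substructure A, Function.Injective fun x : S => f x := fun S =>
    hf.comp Subtype.val_injective
  induction hκ : #T using WellFoundedLT.induction generalizing T with
  | ind κ ih =>
    rcases lt_or_ge κ ℵ₀ with hfin | hinf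
    · have : Finite T := lt_aleph0_iff_finite.1 (hκ ▸ hfin)
      obtain ⟨n, ⟨e⟩⟩ := Finite.exists_equiv_fin T
      obtain ⟨B, _, w, hB, hw⟩ := h n fun k => e.symm k
      obtain ⟨g, -⟩ := (gen_closure T).exists_embedding (w := w ∘ e) (by
        rw [← atp_comp hw e, ← atp_embedding (Language.Substructure.closure L T).subtype]
        congr 1
        funext x
        simp)
      exact hB.of_embedding g
    · let W := κ.ord.ToType
      obtain ⟨φ⟩ : Nonempty (W ≃ T) := Cardinal.eq.1 ((mk_ord_toType κ).trans hκ.symm)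
      have : NoMaxOrder W := Cardinal.noMaxOrder hinf
      have hne : Nonempty W := mk_ne_zero_iff.1 (by
        rw [mk_ord_toType]
        exact (aleph0_pos.trans_le hinf).ne')
      let c : W → L.Substructure A := fun i =>
        Language.Substructure.closure L ((fun j => (φ j : A)) '' Iio i)
      have hc : Monotone c := fun i j hij =>
        Language.Substructure.closure_mono (image_mono (Iio_subset_Iio hij))
      have hcT : ∀ i, c i ≤ Language.Substructure.closure L T := fun i =>
        Language.Substructure.closure_mono (by
          rintro _ ⟨j, -, rfl⟩
          exact (φ j).2)
      have hcov : ∀ x ∈ Language.Substructure.closure L T, ∃ i, x ∈ c i := by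
        have hle : Language.Substructure.closure L T ≤ ⨆ i, c i := by
          rw [Language.Substructure.closure_le]
          intro x hx
          obtain ⟨i, hi⟩ := exists_gt (φ.symm ⟨x, hx⟩)
          exact le_iSup c i (Language.Substructure.subset_closure ⟨_, hi, by simp⟩)
        intro x hx
        exact (Language.Substructure.mem_iSup_of_directed hc.directed_le).1 (hle hx)
      let Mo : L.Substructure A → Model L := fun S => Model.ofInj (hfS S)
      have hsub : ∀ S S' : L.Substructure A, S ≤ S' → (Mo S).IsSub (Mo S') := fun S S' hS =>
        Model.ofInj_isSub (hfS S) ((Model.ofInjEquiv (hfS S')).toEmbedding.comp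
          (Language.Substructure.inclusion hS)) fun _ => rfl
      refine ⟨Mo _, K.union_closed (ι := ULift.{u + 1} W) (fun i => Mo (c i.down)) (fun i => ?_)
        (fun i j hij => hsub _ _ (hc hij)) _ ?_ fun i => hsub _ _ (hcT _), ⟨Model.ofInjEquiv _⟩⟩
      · refine (ih _ ?_ _ rfl).mem_of_equiv (Model.ofInjEquiv _)
        exact mk_image_le.trans_lt (mk_Iio_ord_lt i.down)
      · ext o
        rw [mem_iUnion]
        constructor
        · rintro ⟨⟨x, hx⟩, rfl⟩
          obtain ⟨i, hi⟩ := hcov x hx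
          exact ⟨⟨i⟩, ⟨x, hi⟩, rfl⟩
        · rintro ⟨i, ⟨x, hx⟩, rfl⟩
          exact ⟨⟨x, hcT _ hx⟩, rfl⟩

variable (K) in
/-- The class of all small structures isomorphic to a member of `K`. -/
def toLocalClass : LocalClass L where
  Mem A _ := K.IsoMem A
  of_embedding e h := h.of_embedding e
  of_local h := (isoMem_closure h univ).of_embedding (by
    rw [Language.Substructure.closure_univ]
    exact Language.Substructure.topEquiv.symm.toEmbedding)

theorem exists_small_equiv {M : Model L} {lam : Cardinal.{u}}
    (h : M.card = Cardinal.lift.{u + 1} lam) :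
    ∃ (A : Type u) (_ : L.Structure A), #A = lam ∧ Nonempty (A ≃[L] M.U) := by
  obtain ⟨e⟩ : Nonempty (M.U ≃ lam.out) := by
    rw [← lift_mk_eq'.{u + 1, u}, mk_out, lift_id'.{u, u + 1}]
    exact h
  let := e.inducedStructure (L := L)
  exact ⟨lam.out, _, mk_out lam, ⟨(e.inducedStructureEquiv (L := L)).symm⟩⟩

theorem card_of_equiv {M : Model L} {A : Type u} [L.Structure A] (e : A ≃[L] M.U) :
    M.card = Cardinal.lift.{u + 1} #A := by
  have := lift_mk_eq'.{u, u + 1}.2 ⟨e.toEquiv⟩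
  rw [lift_id'.{u, u + 1}] at this
  exact this.symm

theorem cat_toLocalClass_iff {lam : Cardinal.{u}} :
    K.toLocalClass.Cat lam ↔ K.CategoricalIn lam := by
  constructor
  · rintro ⟨⟨A, _, ⟨M, hM, ⟨e⟩⟩, hA⟩, h⟩
    refine ⟨⟨M, hM, hA ▸ card_of_equiv e⟩, fun M N hM hN hMc hNc => ?_⟩
    obtain ⟨A, _, hA, ⟨e⟩⟩ := exists_small_equiv hMc
    obtain ⟨B, _, hB, ⟨f⟩⟩ := exists_small_equiv hNc
    obtain ⟨g⟩ := h A B ⟨M, hM, ⟨e⟩⟩ ⟨N, hN, ⟨f⟩⟩ hA hB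
    exact ⟨(f.comp g).comp e.symm⟩
  · rintro ⟨⟨M, hM, hMc⟩, h⟩
    obtain ⟨A, _, hA, ⟨e⟩⟩ := exists_small_equiv hMc
    refine ⟨⟨A, _, ⟨M, hM, ⟨e⟩⟩, hA⟩, ?_⟩
    rintro A B _ _ ⟨M, hM, ⟨e⟩⟩ ⟨N, hN, ⟨f⟩⟩ hA hB
    obtain ⟨g⟩ := h M N hM hN (hA ▸ card_of_equiv e) (hB ▸ card_of_equiv f)
    exact ⟨(f.symm.comp g).comp e⟩

end UniversalClass

end AECPaper

namespace AECPaper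

/-- Let `K` be a universal class.  If for every cardinal `θ` there exists a
cardinal `λ ≥ θ` of cofinality `≥ θ` in which `K` is categorical, then `K` is categorical on
a tail of cardinals. -/
theorem universalClass_categoricity {L : FirstOrder.Language.{u, u}}
    (K : UniversalClass L)
    (h : ∀ θ : Cardinal.{u}, ∃ lam : Cardinal.{u},
      θ ≤ lam ∧ θ ≤ lam.ord.cof ∧ K.CategoricalIn lam) :
    ∃ μ : Cardinal.{u}, ∀ lam' : Cardinal.{u}, μ ≤ lam' → K.CategoricalIn lam' := by
  simp only [← UniversalClass.cat_toLocalClass_iff] at h ⊢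
  obtain ⟨μ, -, hμ⟩ := K.toLocalClass.exists_cat_tail h
  exact ⟨μ, hμ⟩

end AECPaper
end
end

section
/- Let K be a universal class ordered by ⊆, let N₁,N₂∈K, let A⊆|N₁| with A⊆|N₂|, and let ā₁, ā₂ be sequences of the same length α from N₁ and N₂ respectively. Then gtp(ā₁/A;N₁) = gtp(ā₂/A;N₂) if and only if ā₁ and ā₂ have the same quantifier-free type over A, i.e. for every n<ω, all indices i₀,…,i_{n-1}<α, every quantifier-free first-order L(K)-formula φ(x₀,…,x_{n-1},y₀,…,y_{m-1}) and all parameters b₀,…,b_{m-1}∈A: N₁ ⊨ φ(ā₁(i₀),…,ā₁(i_{n-1}),b₀,…,b_{m-1}) if and only if N₂ ⊨ φ(ā₂(i₀),…,ā₂(i_{n-1}),b₀,…,b_{m-1}). -/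
noncomputable section

open FirstOrder Cardinal Set

universe u

namespace AECPaper

namespace UniversalClass

variable {L : FirstOrder.Language.{u, u}} (K : UniversalClass L)

/-- Atomic equivalence of triples for a universal class (ordered by `⊆`, every embedding
between members is a `K`-embedding): there are embeddings into a common member of `K`
fixing `A` pointwise and agreeing on the two sequences. -/
def Eat {β : Type (u + 1)} (A : Set Ordinal.{u})
    (N₁ : Model L) (b₁ : β → N₁.U) (N₂ : Model L) (b₂ : β → N₂.U) : Prop :=
  K.Mem N₁ ∧ K.Mem N₂ ∧ A ⊆ N₁.carrier ∧ A ⊆ N₂.carrier ∧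
    ∃ (N : Model L) (f₁ : L.Embedding N₁.U N.U) (f₂ : L.Embedding N₂.U N.U),
      K.Mem N ∧
      (∀ x : N₁.U, (↑x : Ordinal.{u}) ∈ A → (↑(f₁ x) : Ordinal.{u}) = ↑x) ∧
      (∀ x : N₂.U, (↑x : Ordinal.{u}) ∈ A → (↑(f₂ x) : Ordinal.{u}) = ↑x) ∧
      ∀ i, (↑(f₁ (b₁ i)) : Ordinal.{u}) = (↑(f₂ (b₂ i)) : Ordinal.{u})

/-- Equality of Galois types: the transitive closure of atomic equivalence. -/
def SameGtp {β : Type (u + 1)} (A : Set Ordinal.{u})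
    (N₁ : Model L) (b₁ : β → N₁.U) (N₂ : Model L) (b₂ : β → N₂.U) : Prop :=
  Relation.TransGen
    (fun p q : Σ N : Model L, β → N.U => K.Eat A p.1 p.2 q.1 q.2) ⟨N₁, b₁⟩ ⟨N₂, b₂⟩

end UniversalClass

open Language

/-- The variables in a finite subset of a sum type can be enumerated by a sum of two `Fin`s. -/
theorem exists_fin_enum {β δ : Type*} (s : Finset (β ⊕ δ)) :
    ∃ (n m : ℕ) (idx : Fin n → β) (par : Fin m → δ) (f : s → Fin n ⊕ Fin m),
      ∀ a, Sum.map idx par (f a) = a := by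
  refine ⟨_, _, fun i => (s.toLeft.equivFin.symm i).1, fun j => (s.toRight.equivFin.symm j).1,
    fun a => match a with
      | ⟨Sum.inl x, h⟩ => Sum.inl (s.toLeft.equivFin ⟨x, Finset.mem_toLeft.2 h⟩)
      | ⟨Sum.inr x, h⟩ => Sum.inr (s.toRight.equivFin ⟨x, Finset.mem_toRight.2 h⟩), ?_⟩
  rintro ⟨x | x, h⟩ <;> simp

theorem isQF_restrictFreeVar {L : FirstOrder.Language.{u, u}} {α γ : Type*} [DecidableEq α] {n : ℕ}
    {φ : L.BoundedFormula α n} (hφ : φ.IsQF) (f : φ.freeVarFinset → γ) :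
    (φ.restrictFreeVar f).IsQF := by
  induction hφ with
  | falsum => exact .falsum
  | of_isAtomic h =>
    cases h with
    | equal t₁ t₂ => exact .of_isAtomic (.equal _ _)
    | rel R ts => exact .of_isAtomic (.rel _ _)
  | imp _ _ ih₁ ih₂ => exact .imp (ih₁ _) (ih₂ _)

/-- A map between tuples preserving quantifier-free formulas extends to an embedding of the
substructure generated by the first tuple. -/
theorem exists_embedding_closure {L : FirstOrder.Language.{u, u}} {P Q γ : Type*}
    [L.Structure P] [L.Structure Q] (x : γ → P) (y : γ → Q)
    (h : ∀ φ : L.Formula γ, φ.IsQF → (φ.Realize x ↔ φ.Realize y)) :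
    ∃ g : Substructure.closure L (range x) ↪[L] Q,
      ∀ i, g ⟨x i, Substructure.subset_closure (mem_range_self i)⟩ = y i := by
  have heq : ∀ s t : L.Term γ, s.realize x = t.realize x ↔ s.realize y = t.realize y := by
    intro s t
    have := h (s.equal t) (.of_isAtomic (.equal _ _))
    simpa only [Formula.realize_equal] using this
  have hrel : ∀ {k : ℕ} (R : L.Relations k) (ts : Fin k → L.Term γ),
      Structure.RelMap R (fun i => (ts i).realize x) ↔
        Structure.RelMap R (fun i => (ts i).realize y) := by
    intro k R ts
    have := h (R.formula ts) (.of_isAtomic (.rel _ _))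
    simpa only [Formula.realize_rel] using this
  have hterm : ∀ p : Substructure.closure L (range x), ∃ t : L.Term γ, t.realize x = p := by
    rintro ⟨p, hp⟩
    obtain ⟨t, rfl⟩ := Substructure.mem_closure_iff_exists_term.1 hp
    choose c hc using fun z : range x => z.2
    refine ⟨t.relabel c, ?_⟩
    rw [Term.realize_relabel]
    congr 1
    exact funext hc
  choose T hT using hterm
  refine ⟨{ toFun := fun p => (T p).realize y, inj' := ?_, map_fun' := ?_, map_rel' := ?_ }, ?_⟩
  · intro p q hpq
    apply Subtype.ext
    rw [← hT p, ← hT q]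
    exact (heq _ _).2 hpq
  · intro k F p
    refine (heq _ (Term.func F fun i => T (p i))).1 ?_
    rw [hT, Term.realize_func]
    simp only [hT]
    rfl
  · intro k R p
    refine (hrel R fun i => T (p i)).symm.trans ?_
    simp only [hT]
    rfl
  · intro i
    exact (heq _ (Term.var i)).1 (hT _)

variable {L : FirstOrder.Language.{u, u}}

/-- The bijection between a substructure and its underlying set of ordinals. -/
def Model.substructureEquivImage (N : Model L) (S : L.Substructure N.U) :
    S ≃ (Subtype.val '' (S : Set N.U) : Set Ordinal.{u}) :=
  Equiv.Set.image _ (S : Set N.U) Subtype.val_injective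

/-- A substructure of a model, as a model. -/
def Model.ofSubstructure (N : Model L) (S : L.Substructure N.U) : Model L where
  carrier := Subtype.val '' (S : Set N.U)
  struc := (N.substructureEquivImage S).inducedStructure

/-- The canonical isomorphism from a substructure to the corresponding model. -/
def Model.ofSubstructureEquiv (N : Model L) (S : L.Substructure N.U) :
    S ≃[L] (N.ofSubstructure S).U :=
  (N.substructureEquivImage S).inducedStructureEquiv

theorem Model.coe_ofSubstructureEquiv (N : Model L) (S : L.Substructure N.U) (x : S) :
    (N.ofSubstructureEquiv S x : Ordinal.{u}) = (x : N.U) := rfl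

theorem Model.coe_ofSubstructureEquiv_symm (N : Model L) (S : L.Substructure N.U)
    (x : (N.ofSubstructure S).U) :
    (((N.ofSubstructureEquiv S).symm x : N.U) : Ordinal.{u}) = x := by
  rw [← N.coe_ofSubstructureEquiv, Language.Equiv.apply_symm_apply]

/-- The inclusion of the model given by a substructure. -/
def Model.ofSubstructureIncl (N : Model L) (S : L.Substructure N.U) :
    (N.ofSubstructure S).U ↪[L] N.U :=
  S.subtype.comp (N.ofSubstructureEquiv S).symm.toEmbedding

theorem Model.coe_ofSubstructureIncl (N : Model L) (S : L.Substructure N.U)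
    (x : (N.ofSubstructure S).U) :
    (N.ofSubstructureIncl S x : Ordinal.{u}) = x :=
  N.coe_ofSubstructureEquiv_symm S x

theorem Model.ofSubstructure_isSub (N : Model L) (S : L.Substructure N.U) :
    (N.ofSubstructure S).IsSub N := by
  refine ⟨?_, N.ofSubstructureIncl S, N.coe_ofSubstructureIncl S⟩
  rintro _ ⟨x, -, rfl⟩
  exact x.2

/-- `b₁` in `N₁` and `b₂` in `N₂` have the same quantifier-free type over `A`. -/
def SameQFType {β : Type (u + 1)} {A : Set Ordinal.{u}} {N₁ N₂ : Model L}
    (hA₁ : A ⊆ N₁.carrier) (hA₂ : A ⊆ N₂.carrier) (b₁ : β → N₁.U) (b₂ : β → N₂.U) : Prop :=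
  ∀ φ : L.Formula (β ⊕ A), φ.IsQF →
    (φ.Realize (Sum.elim b₁ (inclusion hA₁)) ↔ φ.Realize (Sum.elim b₂ (inclusion hA₂)))

open Classical in
theorem sameQFType_iff {β : Type (u + 1)} {A : Set Ordinal.{u}} {N₁ N₂ : Model L}
    (hA₁ : A ⊆ N₁.carrier) (hA₂ : A ⊆ N₂.carrier) (b₁ : β → N₁.U) (b₂ : β → N₂.U) :
    SameQFType hA₁ hA₂ b₁ b₂ ↔
      ∀ (n m : ℕ) (idx : Fin n → β) (φ : L.Formula (Fin n ⊕ Fin m)), φ.IsQF →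
        ∀ (b : Fin m → Ordinal.{u}) (hb : ∀ j, b j ∈ A),
          (φ.Realize (Sum.elim (fun i => b₁ (idx i))
              (fun j => (⟨b j, hA₁ (hb j)⟩ : N₁.U))) ↔
            φ.Realize (Sum.elim (fun i => b₂ (idx i))
              (fun j => (⟨b j, hA₂ (hb j)⟩ : N₂.U)))) := by
  constructor
  · intro h n m idx φ hφ b hb
    have := h (φ.relabel (Sum.map idx fun j => (⟨b j, hb j⟩ : A))) (hφ.relabel _)
    rw [Formula.realize_relabel, Formula.realize_relabel, Sum.elim_comp_map,
      Sum.elim_comp_map] at this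
    exact this
  · intro h φ hφ
    obtain ⟨n, m, idx, par, f, hf⟩ := exists_fin_enum φ.freeVarFinset
    have key : ∀ {N : Model L} (hA : A ⊆ N.carrier) (b : β → N.U),
        Formula.Realize (φ.restrictFreeVar f) (Sum.elim (fun i => b (idx i))
          (fun j => (⟨par j, hA (par j).2⟩ : N.U))) ↔
        φ.Realize (Sum.elim b (inclusion hA)) := by
      intro N hA b
      refine BoundedFormula.realize_restrictFreeVar _ fun a => ?_
      rw [← hf a]
      cases f a <;> rfl
    rw [← key hA₁, ← key hA₂]
    exact h n m idx _ (isQF_restrictFreeVar hφ f) (fun j => par j) (fun j => (par j).2)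

namespace UniversalClass

variable (K : UniversalClass L)

theorem Eat.sameQFType {K : UniversalClass L} {β : Type (u + 1)} {A : Set Ordinal.{u}}
    {N₁ N₂ : Model L} {b₁ : β → N₁.U} {b₂ : β → N₂.U} (h : K.Eat A N₁ b₁ N₂ b₂)
    (hA₁ : A ⊆ N₁.carrier) (hA₂ : A ⊆ N₂.carrier) : SameQFType hA₁ hA₂ b₁ b₂ := by
  obtain ⟨-, -, -, -, N, f₁, f₂, -, hf₁, hf₂, hf⟩ := h
  intro φ hφ
  have hcomp : f₁ ∘ Sum.elim b₁ (inclusion hA₁) = f₂ ∘ Sum.elim b₂ (inclusion hA₂) := by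
    funext i
    apply Subtype.ext
    rcases i with i | a
    · exact hf i
    · exact (hf₁ (inclusion hA₁ a) a.2).trans (hf₂ (inclusion hA₂ a) a.2).symm
  unfold Formula.Realize
  rw [← hφ.realize_embedding f₁, ← hφ.realize_embedding f₂, hcomp,
    Subsingleton.elim (f₁ ∘ default) (f₂ ∘ default)]

theorem SameGtp.sameQFType {K : UniversalClass L} {β : Type (u + 1)} {A : Set Ordinal.{u}}
    {N₁ N₂ : Model L} {b₁ : β → N₁.U} {b₂ : β → N₂.U} (h : K.SameGtp A N₁ b₁ N₂ b₂)
    (hA₁ : A ⊆ N₁.carrier) (hA₂ : A ⊆ N₂.carrier) : SameQFType hA₁ hA₂ b₁ b₂ := by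
  suffices H : ∀ q : Σ N : Model L, β → N.U,
      Relation.TransGen (fun p q : Σ N : Model L, β → N.U => K.Eat A p.1 p.2 q.1 q.2)
        ⟨N₁, b₁⟩ q → ∀ hA : A ⊆ q.1.carrier, SameQFType hA₁ hA b₁ q.2 from H _ h hA₂
  intro q hq
  induction hq with
  | single h => exact fun hA => h.sameQFType hA₁ hA
  | tail _ h ih =>
    intro hA φ hφ
    exact (ih h.2.2.1 φ hφ).trans (h.sameQFType h.2.2.1 hA φ hφ)

theorem sameGtp_of_sameQFType {β : Type (u + 1)} {A : Set Ordinal.{u}}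
    {N₁ N₂ : Model L} (hN₁ : K.Mem N₁) (hN₂ : K.Mem N₂) {b₁ : β → N₁.U} {b₂ : β → N₂.U}
    {hA₁ : A ⊆ N₁.carrier} {hA₂ : A ⊆ N₂.carrier} (h : SameQFType hA₁ hA₂ b₁ b₂) :
    K.SameGtp A N₁ b₁ N₂ b₂ := by
  let x : β ⊕ A → N₁.U := Sum.elim b₁ (inclusion hA₁)
  let S : L.Substructure N₁.U := Substructure.closure L (range x)
  obtain ⟨g, hg⟩ : ∃ g : S ↪[L] N₂.U, ∀ i, g ⟨x i, _⟩ = _ := exists_embedding_closure x _ h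
  have hxS : ∀ i, x i ∈ S := fun i => Substructure.subset_closure (mem_range_self i)
  let e := N₁.ofSubstructureEquiv S
  let c : β → (N₁.ofSubstructure S).U := fun i => e ⟨x (.inl i), hxS _⟩
  have hM : K.Mem (N₁.ofSubstructure S) := K.sub_closed hN₁ (N₁.ofSubstructure_isSub S)
  have hAM : A ⊆ (N₁.ofSubstructure S).carrier := fun a ha =>
    ⟨x (.inr ⟨a, ha⟩), hxS _, rfl⟩
  refine .tail (b := ⟨N₁.ofSubstructure S, c⟩) (.single ?_) ?_
  · exact ⟨hN₁, hM, hA₁, hAM, N₁, .refl L _, N₁.ofSubstructureIncl S, hN₁, fun _ _ => rfl,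
      fun y _ => N₁.coe_ofSubstructureIncl S y,
      fun i => (N₁.coe_ofSubstructureIncl S (c i)).symm⟩
  · refine ⟨hM, hN₂, hAM, hA₂, N₂, g.comp e.symm.toEmbedding, .refl L _, hN₂, ?_,
      fun _ _ => rfl, fun i => ?_⟩
    · intro y hy
      have hey : e.symm y = ⟨x (.inr ⟨y, hy⟩), hxS _⟩ :=
        Subtype.ext (Subtype.ext (N₁.coe_ofSubstructureEquiv_symm S y))
      change ((g (e.symm y) : N₂.U) : Ordinal.{u}) = y
      rw [hey, hg]
      rfl
    · change ((g (e.symm (e _)) : N₂.U) : Ordinal.{u}) = b₂ i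
      rw [Language.Equiv.symm_apply_apply, hg]
      rfl

end UniversalClass

/-- In a universal class, Galois types are quantifier-free types: two
sequences (of the same length, over the same parameter set `A`) have the same Galois type if
and only if they satisfy the same quantifier-free first-order formulas with parameters
in `A`. -/
theorem universalClass_gtp_eq_qf {L : FirstOrder.Language.{u, u}}
    (K : UniversalClass L) {β : Type (u + 1)} (A : Set Ordinal.{u})
    (N₁ N₂ : Model L) (hN₁ : K.Mem N₁) (hN₂ : K.Mem N₂)
    (hA₁ : A ⊆ N₁.carrier) (hA₂ : A ⊆ N₂.carrier)
    (a₁ : β → N₁.U) (a₂ : β → N₂.U) :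
    K.SameGtp A N₁ a₁ N₂ a₂ ↔
      ∀ (n m : ℕ) (idx : Fin n → β) (φ : L.Formula (Fin n ⊕ Fin m)), φ.IsQF →
        ∀ (b : Fin m → Ordinal.{u}) (hb : ∀ j, b j ∈ A),
          (φ.Realize (Sum.elim (fun i => a₁ (idx i))
              (fun j => (⟨b j, hA₁ (hb j)⟩ : N₁.U))) ↔
            φ.Realize (Sum.elim (fun i => a₂ (idx i))
              (fun j => (⟨b j, hA₂ (hb j)⟩ : N₂.U)))) := by
  rw [← sameQFType_iff hA₁ hA₂ a₁ a₂]
  exact ⟨fun h => h.sameQFType hA₁ hA₂, K.sameGtp_of_sameQFType hN₁ hN₂⟩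

end AECPaper
end
end
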